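/- arXiv:1110.1003 — 2 statements merged into one kernel-verified Lean document; each statement's English description precedes it below -/
import Mathlib

section
/- For every infinite cardinal k, the space B*(k) is densely homogeneous with respect to the space A^{II}_k: for any two dense subsets X₁, X₂ of B*(k), each homeomorphic to A^{II}_k, there is a homeomorphism of B*(k) onto itself carrying X₁ onto X₂. -/
open Topology Set Filter

universe u v

noncomputable section

/-- Strong zero-dimensionality (`Ind X = 0`): any two disjoint closed sets
can be separated by a clopen set. -/
def StronglyZeroDim (X : Type*) [TopologicalSpace X] : Prop :=
  ∀ A B : Set X, IsClosed A → IsClosed B → Disjoint A B →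
    ∃ U : Set X, IsClopen U ∧ A ⊆ U ∧ Disjoint B U

/-- The topological weight of a space: the least cardinality of a base. -/
def topWeight (X : Type u) [TopologicalSpace X] : Cardinal.{u} :=
  ⨅ B : {B : Set (Set X) // TopologicalSpace.IsTopologicalBasis B}, Cardinal.mk B.1

/-- The space has a base of cardinality `< k`. -/
def WeightLT (X : Type u) [TopologicalSpace X] (k : Cardinal.{u}) : Prop :=
  ∃ B : Set (Set X), TopologicalSpace.IsTopologicalBasis B ∧ Cardinal.mk B < k

/-- Every point has a neighborhood of weight `< k`. -/
def LocallyWeightLT (X : Type u) [TopologicalSpace X] (k : Cardinal.{u}) : Prop :=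
  ∀ x : X, ∃ s : Set X, s ∈ nhds x ∧ WeightLT ↥s k

/-- `X ∈ σLW(<k)`: `X` is a countable union of subspaces, each locally of weight `< k`. -/
def SigmaLW (X : Type u) [TopologicalSpace X] (k : Cardinal.{u}) : Prop :=
  ∃ S : ℕ → Set X, (⋃ n, S n) = Set.univ ∧ ∀ n, LocallyWeightLT ↥(S n) k

/-- A `G_δσ`-subset: a countable union of `G_δ`-sets. -/
def IsGdeltaSigma {Y : Type*} [TopologicalSpace Y] (s : Set Y) : Prop :=
  ∃ G : ℕ → Set Y, (∀ n, IsGδ (G n)) ∧ s = ⋃ n, G n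

/-- An `F_σ`-subset: a countable union of closed sets. -/
def IsFsigmaSet {Y : Type*} [TopologicalSpace Y] (s : Set Y) : Prop :=
  ∃ F : ℕ → Set Y, (∀ n, IsClosed (F n)) ∧ s = ⋃ n, F n

/-- An `F_σδ`-subset: a countable intersection of `F_σ`-sets. -/
def IsFsigmaDelta {Y : Type*} [TopologicalSpace Y] (s : Set Y) : Prop :=
  ∃ F : ℕ → Set Y, (∀ n, IsFsigmaSet (F n)) ∧ s = ⋂ n, F n

/-- An absolute `G_δσ`-set: a metrizable space whose image under every embedding
into a metrizable space is a countable union of `G_δ`-sets. -/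
def AbsGdeltaSigma (X : Type u) [TopologicalSpace X] : Prop :=
  TopologicalSpace.MetrizableSpace X ∧
    ∀ (Y : Type u) [TopologicalSpace Y] [TopologicalSpace.MetrizableSpace Y]
      (f : X → Y), Topology.IsEmbedding f → IsGdeltaSigma (Set.range f)

/-- An absolute `F_σδ`-set: a metrizable space whose image under every embedding
into a metrizable space is an `F_σδ`-set. -/
def AbsFsigmaDelta (X : Type u) [TopologicalSpace X] : Prop :=
  TopologicalSpace.MetrizableSpace X ∧
    ∀ (Y : Type u) [TopologicalSpace Y] [TopologicalSpace.MetrizableSpace Y]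
      (f : X → Y), Topology.IsEmbedding f → IsFsigmaDelta (Set.range f)

/-- `X ∈ σLW(<k) + 𝒢_δσ` : `X = A ∪ B` with `A ∈ σLW(<k)` and `B` an absolute
`G_δσ`-set. -/
def SLWplusGDS (X : Type u) [TopologicalSpace X] (k : Cardinal.{u}) : Prop :=
  ∃ A B : Set X, A ∪ B = Set.univ ∧ SigmaLW ↥A k ∧ AbsGdeltaSigma ↥B

/-- No nonempty open subspace is `σLW(<k) + 𝒢_δσ`. -/
def NowhereSLWplusGDS (X : Type u) [TopologicalSpace X] (k : Cardinal.{u}) : Prop :=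
  ∀ U : Set X, IsOpen U → U.Nonempty → ¬ SLWplusGDS ↥U k

/-- A space is of first category if it is meager in itself. -/
def FirstCategory (X : Type*) [TopologicalSpace X] : Prop :=
  IsMeagre (Set.univ : Set X)

/-- A Souslin (analytic) subset of a space:
`s = ⋃_{t ∈ ω^ω} ⋂_n F(t↾n)` for a family of closed sets indexed by finite tuples. -/
def IsSuslinIn {Y : Type*} [TopologicalSpace Y] (s : Set Y) : Prop :=
  ∃ F : List ℕ → Set Y, (∀ l, IsClosed (F l)) ∧
    s = ⋃ t : ℕ → ℕ, ⋂ n : ℕ, F (List.ofFn fun i : Fin n => t i)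

/-- An absolute Souslin space: metrizable, and Souslin in every completely metrizable
space into which it embeds. -/
def AbsSuslin (X : Type u) [TopologicalSpace X] : Prop :=
  TopologicalSpace.MetrizableSpace X ∧
    ∀ (Y : Type u) [MetricSpace Y] [CompleteSpace Y] (f : X → Y),
      Topology.IsEmbedding f → IsSuslinIn (Set.range f)

/-- An h-homogeneous space: every nonempty clopen subset is homeomorphic to the
whole space. -/
def HHomogeneous (X : Type*) [TopologicalSpace X] : Prop :=
  ∀ U : Set X, IsClopen U → U.Nonempty → Nonempty (↥U ≃ₜ X)

/-- A discrete family of sets: every point has a neighborhood meeting at most one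
member of the family. -/
def DiscreteFamily {X : Type*} [TopologicalSpace X] {ι : Type*} (f : ι → Set X) : Prop :=
  ∀ x : X, ∃ U ∈ nhds x, {i | (f i ∩ U).Nonempty}.Subsingleton

/-- A discrete space of cardinality `k`. -/
def DiscT (k : Cardinal.{u}) : Type u := k.out

instance (k : Cardinal.{u}) : TopologicalSpace (DiscT k) := ⊥
instance (k : Cardinal.{u}) : DiscreteTopology (DiscT k) := ⟨rfl⟩

/-- The Baire space `B(k) = k^ω`. -/
def BaireB (k : Cardinal.{u}) : Type u := ℕ → DiscT k

instance (k : Cardinal.{u}) : TopologicalSpace (BaireB k) :=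
  inferInstanceAs (TopologicalSpace (ℕ → DiscT k))

open Classical in
/-- The discrete factor of `B*(k)`: two points if `k = ℵ₀`, and `k` points otherwise. -/
def StarT (k : Cardinal.{u}) : Type u :=
  if k = Cardinal.aleph0 then ULift Bool else DiscT k

instance (k : Cardinal.{u}) : TopologicalSpace (StarT k) := ⊥
instance (k : Cardinal.{u}) : DiscreteTopology (StarT k) := ⟨rfl⟩

/-- `B*(k)`: the Cantor set `2^ω` if `k = ℵ₀`, and the Baire space `B(k)` if `k > ℵ₀`. -/
def BaireStar (k : Cardinal.{u}) : Type u := ℕ → StarT k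

instance (k : Cardinal.{u}) : TopologicalSpace (BaireStar k) :=
  inferInstanceAs (TopologicalSpace (ℕ → StarT k))

/-- A discrete space of cardinality `k` (for infinite `k`), with a distinguished basepoint. -/
def QBase (k : Cardinal.{u}) : Type u := DiscT k ⊕ PUnit.{u + 1}

instance (k : Cardinal.{u}) : TopologicalSpace (QBase k) := ⊥
instance (k : Cardinal.{u}) : DiscreteTopology (QBase k) := ⟨rfl⟩

/-- `Q(k)`: the σ-product of `ω` copies of a discrete space of cardinality `k`, i.e.
the subspace of the product consisting of the sequences eventually equal to the basepoint. -/
def Qk (k : Cardinal.{u}) : Type u :=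
  {x : ℕ → QBase k // ∀ᶠ n in Filter.atTop, x n = Sum.inr PUnit.unit}

instance (k : Cardinal.{u}) : TopologicalSpace (Qk k) :=
  inferInstanceAs (TopologicalSpace
    {x : ℕ → QBase k // ∀ᶠ n in Filter.atTop, x n = Sum.inr PUnit.unit})

/-- The countable power `Q(k)^ω`. -/
def QkOmega (k : Cardinal.{u}) : Type u := ℕ → Qk k

instance (k : Cardinal.{u}) : TopologicalSpace (QkOmega k) :=
  inferInstanceAs (TopologicalSpace (ℕ → Qk k))

/-- `Z` is homeomorphic to `Q(k)^ω`. -/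
def IsQkOmega (k : Cardinal.{u}) (Z : Type*) [TopologicalSpace Z] : Prop :=
  Nonempty (Z ≃ₜ QkOmega k)

/-- `Z` is homeomorphic to `A^{II}_k`, the complement in `B*(k)` of a dense copy of
`Q(k)^ω`. -/
def IsAII (k : Cardinal.{u}) (Z : Type*) [TopologicalSpace Z] : Prop :=
  ∃ A : Set (BaireStar k), Dense A ∧ IsQkOmega k ↥A ∧ Nonempty (Z ≃ₜ ↥(Aᶜ))

/-- `Z` is homeomorphic to `A^I_k = Q × A^{II}_k`. -/
def IsAI (k : Cardinal.{u}) (Z : Type*) [TopologicalSpace Z] : Prop :=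
  ∃ A : Set (BaireStar k), Dense A ∧ IsQkOmega k ↥A ∧ Nonempty (Z ≃ₜ (ℚ × ↥(Aᶜ)))

/-- `Z` is homeomorphic to `M^{II}_k`, the complement in `B*(k)` of a dense copy of
`A^I_k`. -/
def IsMII (k : Cardinal.{u}) (Z : Type*) [TopologicalSpace Z] : Prop :=
  ∃ Y : Set (BaireStar k), Dense Y ∧ IsAI k ↥Y ∧ Nonempty (Z ≃ₜ ↥(Yᶜ))

/-- `X ∈ 𝓕_σδ ∖ σLW(<k)`: `X` is homeomorphic to `F ∖ L` for some absolute
`F_σδ`-space `F` and some `L ⊆ F` with `L ∈ σLW(<k)`. -/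
def FsdMinusSLW (X : Type u) [TopologicalSpace X] (k : Cardinal.{u}) : Prop :=
  ∃ (F : TopCat.{u}) (L : Set F), AbsFsigmaDelta ↥F ∧ SigmaLW ↥L k ∧
    Nonempty (X ≃ₜ ↥(Lᶜ))

/-- No nonempty open subspace is in the class `𝓕_σδ ∖ σLW(<k)`. -/
def NowhereFsdMinusSLW (X : Type u) [TopologicalSpace X] (k : Cardinal.{u}) : Prop :=
  ∀ U : Set X, IsOpen U → U.Nonempty → ¬ FsdMinusSLW ↥U k

/-- A topologically complete (i.e. completely metrizable) space. -/
def CompletelyMetrizable (X : Type*) [t : TopologicalSpace X] : Prop :=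
  ∃ m : MetricSpace X, m.toUniformSpace.toTopologicalSpace = t ∧
    @CompleteSpace X m.toUniformSpace

end

namespace DHA

theorem gdelta_preimage {X Y : Type*} [TopologicalSpace X] [TopologicalSpace Y] {G : Set X}
    {F : X → Y} {P : Set Y} (hG : IsGδ G) (hF : ContinuousOn F G) (hP : IsGδ P) :
    IsGδ (G ∩ F ⁻¹' P) := by
  obtain ⟨O, hO, rfl⟩ := isGδ_iff_eq_iInter_nat.1 hP
  have : ∀ n, ∃ U, IsOpen U ∧ F ⁻¹' (O n) ∩ G = U ∩ G := fun n =>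
    continuousOn_iff'.1 hF (O n) (hO n)
  choose U hU hUG using this
  have e : G ∩ F ⁻¹' (⋂ n, O n) = G ∩ ⋂ n, U n := by
    ext x
    simp only [mem_inter_iff, mem_preimage, mem_iInter]
    refine and_congr_right fun hx => forall_congr' fun n => ?_
    have := Set.ext_iff.1 (hUG n) x
    simpa [hx] using this
  rw [e]
  exact hG.inter (IsGδ.iInter_of_isOpen hU)

theorem extend_gdelta {X Y : Type*} [TopologicalSpace X] [TopologicalSpace Y]
    [TopologicalSpace.MetrizableSpace X] [TopologicalSpace.IsCompletelyMetrizableSpace Y]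
    (A : Set X) (f : X → Y) (hf : ContinuousOn f A) :
    ∃ (G : Set X) (F : X → Y), IsGδ G ∧ A ⊆ G ∧ G ⊆ closure A ∧ ContinuousOn F G ∧
      ∀ a ∈ A, F a = f a := by
  let _ := TopologicalSpace.metrizableSpaceMetric X
  let _ := TopologicalSpace.upgradeIsCompletelyMetrizable Y
  let O : ℕ → Set X := fun n => ⋃₀ {O | IsOpen O ∧ ∀ x ∈ A ∩ O, ∀ y ∈ A ∩ O,
    dist (f x) (f y) < 1 / ((n : ℝ) + 1)}
  have hO : ∀ n, IsOpen (O n) := fun n => isOpen_sUnion fun s hs => hs.1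
  have hAO : ∀ n, A ⊆ O n := by
    intro n a ha
    have h1 : f ⁻¹' (Metric.ball (f a) (1 / ((n : ℝ) + 1) / 2)) ∈ 𝓝[A] a :=
      hf a ha (Metric.ball_mem_nhds _ (by positivity))
    obtain ⟨U, hU, haU, hUs⟩ := mem_nhdsWithin.1 h1
    refine ⟨U, ⟨hU, ?_⟩, haU⟩
    intro x hx y hy
    have hx' := hUs ⟨hx.2, hx.1⟩
    have hy' := hUs ⟨hy.2, hy.1⟩
    simp only [mem_preimage, Metric.mem_ball] at hx' hy'
    have := dist_triangle_right (f x) (f y) (f a)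
    linarith
  have hlim : ∀ x ∈ closure A ∩ ⋂ n, O n, ∃ y, Tendsto f (𝓝[A] x) (𝓝 y) := by
    rintro x ⟨hxA, hxO⟩
    have hne : (𝓝[A] x).NeBot := mem_closure_iff_nhdsWithin_neBot.1 hxA
    apply cauchy_map_iff_exists_tendsto.1
    rw [Metric.cauchy_iff]
    refine ⟨inferInstance, fun ε hε => ?_⟩
    obtain ⟨n, hn⟩ := exists_nat_one_div_lt hε
    obtain ⟨U, ⟨hU, hUd⟩, hxU⟩ := mem_iInter.1 hxO n
    refine ⟨f '' (A ∩ U), image_mem_map ?_, ?_⟩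
    · exact inter_mem self_mem_nhdsWithin (mem_nhdsWithin_of_mem_nhds (hU.mem_nhds hxU))
    · rintro _ ⟨a, ha, rfl⟩ _ ⟨b, hb, rfl⟩
      exact (hUd a ha b hb).trans hn
  refine ⟨closure A ∩ ⋂ n, O n, extendFrom A f, ?_, ?_, inter_subset_left, ?_, ?_⟩
  · exact isClosed_closure.isGδ.inter (IsGδ.iInter_of_isOpen hO)
  · exact fun a ha => ⟨subset_closure ha, mem_iInter.2 fun n => hAO n ha⟩
  · exact continuousOn_extendFrom inter_subset_left hlim
  · exact fun a ha => extendFrom_eq (subset_closure ha) (hf a ha)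

/-- A homeomorphism between `G_δ` subsets. -/
structure GHomeo (X Y : Type*) [TopologicalSpace X] [TopologicalSpace Y] where
  G : Set X
  G' : Set Y
  F : X → Y
  F' : Y → X
  hG : IsGδ G
  hG' : IsGδ G'
  cF : ContinuousOn F G
  cF' : ContinuousOn F' G'
  mF : ∀ x ∈ G, F x ∈ G'
  mF' : ∀ y ∈ G', F' y ∈ G
  left : ∀ x ∈ G, F' (F x) = x
  right : ∀ y ∈ G', F (F' y) = y

theorem gdelta_fix {X : Type*} [TopologicalSpace X] [TopologicalSpace.MetrizableSpace X]
    {G : Set X} {g : X → X} (hG : IsGδ G) (hg : ContinuousOn g G) :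
    IsGδ (G ∩ {x | g x = x}) := by
  let _ := TopologicalSpace.metrizableSpaceMetric X
  have h : ContinuousOn (fun x => (g x, x)) G := hg.prodMk continuousOn_id
  have := gdelta_preimage hG h (isClosed_diagonal (X := X)).isGδ
  simpa [preimage, diagonal] using this

theorem lavrentiev {X Y : Type*} [TopologicalSpace X] [TopologicalSpace Y]
    [TopologicalSpace.IsCompletelyMetrizableSpace X]
    [TopologicalSpace.IsCompletelyMetrizableSpace Y]
    (A : Set X) (hA : A.Nonempty) (f : A → Y) (hf : IsEmbedding f) :
    ∃ h : GHomeo X Y, A ⊆ h.G ∧ range f ⊆ h.G' ∧ (∀ a : A, h.F a = f a) ∧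
      (∀ a : A, h.F' (f a) = a) := by
  classical
  obtain ⟨a0, ha0⟩ := hA
  lift a0 to A using ha0
  let f0 : X → Y := fun x => if h : x ∈ A then f ⟨x, h⟩ else f a0
  have f0v : ∀ a : A, f0 a = f a := fun a => by simp [f0]
  have hf0 : ContinuousOn f0 A := by
    rw [continuousOn_iff_continuous_domRestrict]
    convert hf.continuous using 1
    ext a; exact f0v a
  let e := hf.toHomeomorph
  let g0 : Y → X := fun y => if h : y ∈ range f then (e.symm ⟨y, h⟩ : X) else a0
  have g0v : ∀ a : A, g0 (f a) = a := fun a => by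
    have h : f a ∈ range f := ⟨a, rfl⟩
    have : e.symm ⟨f a, h⟩ = a := by
      rw [Homeomorph.symm_apply_eq]; rfl
    simp only [g0, h, dif_pos, this]
  have hg0 : ContinuousOn g0 (range f) := by
    rw [continuousOn_iff_continuous_domRestrict]
    convert continuous_subtype_val.comp e.symm.continuous using 1
    ext ⟨y, hy⟩; simp only [g0, domRestrict_apply, hy, dif_pos]; rfl
  obtain ⟨P, F, hP, hAP, hPc, hF, hFf⟩ := extend_gdelta A f0 hf0
  obtain ⟨Q, F', hQ, hAQ, hQc, hF', hFf'⟩ := extend_gdelta (range f) g0 hg0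
  have hFa : ∀ a : A, F a = f a := fun a => (hFf a a.2).trans (f0v a)
  have hFa' : ∀ a : A, F' (f a) = a := fun a => (hFf' _ ⟨a, rfl⟩).trans (g0v a)
  refine ⟨⟨(P ∩ F ⁻¹' Q) ∩ {x | F' (F x) = x}, (Q ∩ F' ⁻¹' P) ∩ {y | F (F' y) = y}, F, F',
    ?_, ?_, ?_, ?_, ?_, ?_, ?_, ?_⟩, ?_, ?_, hFa, hFa'⟩
  · refine gdelta_fix (g := fun x => F' (F x)) (gdelta_preimage hP hF hQ) ?_
    exact hF'.comp (hF.mono inter_subset_left) fun x hx => hx.2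
  · refine gdelta_fix (g := fun x => F (F' x)) (gdelta_preimage hQ hF' hP) ?_
    exact hF.comp (hF'.mono inter_subset_left) fun x hx => hx.2
  · exact hF.mono fun x hx => hx.1.1
  · exact hF'.mono fun x hx => hx.1.1
  · rintro x ⟨⟨h1, h2⟩, h3⟩
    simp only [mem_ofPred_eq] at h3
    exact ⟨⟨h2, by simp only [mem_preimage, h3, h1]⟩, by simp only [mem_ofPred_eq, h3]⟩
  · rintro x ⟨⟨h1, h2⟩, h3⟩
    simp only [mem_ofPred_eq] at h3
    exact ⟨⟨h2, by simp only [mem_preimage, h3, h1]⟩, by simp only [mem_ofPred_eq, h3]⟩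
  · exact fun x hx => hx.2
  · exact fun x hx => hx.2
  · intro a ha
    have h1 := hFa ⟨a, ha⟩
    have h2 := hFa' ⟨a, ha⟩
    simp only at h1 h2
    refine ⟨⟨hAP ha, ?_⟩, ?_⟩
    · rw [mem_preimage, h1]; exact hAQ ⟨_, rfl⟩
    · rw [mem_ofPred_eq, h1, h2]
  · rintro _ ⟨a, rfl⟩
    have h1 := hFa a
    have h2 := hFa' a
    refine ⟨⟨hAQ ⟨_, rfl⟩, ?_⟩, ?_⟩
    · rw [mem_preimage, h2]; exact hAP a.2
    · rw [mem_ofPred_eq, h2, h1]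

end DHA

namespace DHA

variable {T : Type u}

/-- Agreement of two sequences on the first `n` coordinates. -/
def Ag (n : ℕ) (x y : ℕ → T) : Prop := ∀ i < n, x i = y i

theorem Ag.refl (n : ℕ) (x : ℕ → T) : Ag n x x := fun _ _ => rfl
theorem Ag.symm {n : ℕ} {x y : ℕ → T} (h : Ag n x y) : Ag n y x := fun i hi => (h i hi).symm
theorem Ag.trans {n : ℕ} {x y z : ℕ → T} (h : Ag n x y) (h' : Ag n y z) : Ag n x z :=
  fun i hi => (h i hi).trans (h' i hi)
theorem Ag.mono {n m : ℕ} {x y : ℕ → T} (h : Ag n x y) (hm : m ≤ n) : Ag m x y :=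
  fun i hi => h i (hi.trans_le hm)
theorem eq_of_Ag {x y : ℕ → T} (h : ∀ n, Ag n x y) : x = y :=
  funext fun i => h (i + 1) i (Nat.lt_succ_self i)

section top
variable [TopologicalSpace T] [DiscreteTopology T]

theorem mem_nhds_Ag {x : ℕ → T} {s : Set (ℕ → T)} :
    s ∈ 𝓝 x ↔ ∃ n, ∀ y, Ag n x y → y ∈ s := by
  constructor
  · intro h
    obtain ⟨_, ⟨z, n, rfl⟩, hx, hs⟩ :=
      (PiNat.isTopologicalBasis_cylinders (fun _ : ℕ => T)).mem_nhds_iff.1 h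
    refine ⟨n, fun y hy => hs ?_⟩
    rw [PiNat.mem_cylinder_iff] at hx ⊢
    exact fun i hi => (hy i hi).symm.trans (hx i hi)
  · rintro ⟨n, hn⟩
    refine mem_of_superset ((PiNat.isOpen_cylinder (fun _ : ℕ => T) x n).mem_nhds
      (PiNat.self_mem_cylinder x n)) ?_
    intro y hy
    rw [PiNat.mem_cylinder_iff] at hy
    exact hn y fun i hi => (hy i hi).symm

theorem isOpen_Ag {s : Set (ℕ → T)} :
    IsOpen s ↔ ∀ x ∈ s, ∃ n, ∀ y, Ag n x y → y ∈ s := by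
  rw [isOpen_iff_mem_nhds]
  exact forall₂_congr fun x _ => mem_nhds_Ag

theorem isClopen_Ag {s : Set (ℕ → T)} (h : ∀ x, ∃ n, ∀ y, Ag n x y → (x ∈ s ↔ y ∈ s)) :
    IsClopen s := by
  constructor
  · rw [← isOpen_compl_iff, isOpen_Ag]
    intro x hx
    obtain ⟨n, hn⟩ := h x
    exact ⟨n, fun y hy hys => hx ((hn y hy).2 hys)⟩
  · rw [isOpen_Ag]
    intro x hx
    obtain ⟨n, hn⟩ := h x
    exact ⟨n, fun y hy => (hn y hy).1 hx⟩

theorem isClosed_Ag {s : Set (ℕ → T)} :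
    IsClosed s ↔ ∀ x, x ∉ s → ∃ n, ∀ y, Ag n x y → y ∉ s := by
  rw [← isOpen_compl_iff, isOpen_Ag]; rfl

theorem continuous_Ag {f : (ℕ → T) → (ℕ → T)} :
    Continuous f ↔ ∀ x n, ∃ m, ∀ y, Ag m x y → Ag n (f x) (f y) := by
  rw [continuous_iff_continuousAt]
  refine forall_congr' fun x => ?_
  constructor
  · intro h n
    exact mem_nhds_Ag.1 (h (mem_nhds_Ag.2 ⟨n, fun y hy => hy⟩ : {y | Ag n (f x) y} ∈ 𝓝 (f x)))
  · intro h s hs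
    obtain ⟨n, hn⟩ := mem_nhds_Ag.1 hs
    obtain ⟨m, hm⟩ := h n
    exact mem_nhds_Ag.2 ⟨m, fun y hy => hn _ (hm y hy)⟩

/-- Point pairs of a relation. -/
structure Pt (Y Y' : Set (ℕ → T)) (R : (ℕ → T) → (ℕ → T) → Prop) (x y : ℕ → T) : Prop where
  u1 : ∀ y', R x y' → y' = y
  u2 : ∀ x', R x' y → x' = x
  mat : x ∈ Y ↔ y ∈ Y'
  c1 : ∀ n, ∃ m, ∀ x' y', Ag m x x' → R x' y' → Ag n y y'
  c2 : ∀ n, ∃ m, ∀ x' y', Ag m y y' → R x' y' → Ag n x x'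

/-- Cell pairs of a relation. -/
structure Cell (R : (ℕ → T) → (ℕ → T) → Prop) (x y : ℕ → T) : Prop where
  o1 : IsClopen {x' | R x' y}
  o2 : IsClopen {y' | R x y'}
  r1 : ∀ x' y', R x' y → (R x' y' ↔ R x y')
  r2 : ∀ x' y', R x y' → (R x' y' ↔ R x' y)

structure Good (Y Y' U U' : Set (ℕ → T)) (R : (ℕ → T) → (ℕ → T) → Prop) : Prop where
  s1 : ∀ x y, R x y → x ∈ U
  s2 : ∀ x y, R x y → y ∈ U'
  t1 : ∀ x ∈ U, ∃ y, R x y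
  t2 : ∀ y ∈ U', ∃ x, R x y
  g : ∀ x y, R x y → Pt Y Y' R x y ∨ Cell R x y

theorem Pt.flip {Y Y' : Set (ℕ → T)} {R : (ℕ → T) → (ℕ → T) → Prop} {x y : ℕ → T}
    (h : Pt Y Y' R x y) : Pt Y' Y (fun a b => R b a) y x :=
  ⟨h.u2, h.u1, h.mat.symm, fun n => (h.c2 n).imp fun _ hm a b => hm b a,
    fun n => (h.c1 n).imp fun _ hm a b => hm b a⟩

theorem Cell.flip {R : (ℕ → T) → (ℕ → T) → Prop} {x y : ℕ → T}
    (h : Cell R x y) : Cell (fun a b => R b a) y x :=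
  ⟨h.o2, h.o1, fun a b => h.r2 b a, fun a b => h.r1 b a⟩

theorem Good.flip {Y Y' U U' : Set (ℕ → T)} {R : (ℕ → T) → (ℕ → T) → Prop}
    (h : Good Y Y' U U' R) : Good Y' Y U' U (fun a b => R b a) :=
  ⟨fun a b => h.s2 b a, fun a b => h.s1 b a, h.t2, h.t1,
    fun a b hab => (h.g b a hab).imp Pt.flip Cell.flip⟩

theorem Pt.mono {Y Y' : Set (ℕ → T)} {R R' : (ℕ → T) → (ℕ → T) → Prop} {x y : ℕ → T}
    (h : Pt Y Y' R x y) (hR : ∀ x y, R' x y → R x y) : Pt Y Y' R' x y :=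
  ⟨fun y' h' => h.u1 y' (hR _ _ h'), fun y' h' => h.u2 y' (hR _ _ h'), h.mat,
    fun n => (h.c1 n).imp fun _ hm a b hab h' => hm a b hab (hR _ _ h'),
    fun n => (h.c2 n).imp fun _ hm a b hab h' => hm a b hab (hR _ _ h')⟩

/-- smallness of the left sections -/
def SmallL (n : ℕ) (R : (ℕ → T) → (ℕ → T) → Prop) : Prop :=
  ∀ x x' y, R x y → R x' y → Ag n x x'

/-- the left set `S` has been absorbed -/
def AbsL (Y Y' S : Set (ℕ → T)) (R : (ℕ → T) → (ℕ → T) → Prop) : Prop :=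
  ∀ x y, x ∈ S → R x y → Pt Y Y' R x y

theorem SmallL.mono {n : ℕ} {R R' : (ℕ → T) → (ℕ → T) → Prop} (h : SmallL n R)
    (hR : ∀ x y, R' x y → R x y) : SmallL n R' :=
  fun x x' y h1 h2 => h x x' y (hR _ _ h1) (hR _ _ h2)

theorem AbsL.mono {Y Y' S : Set (ℕ → T)} {R R' : (ℕ → T) → (ℕ → T) → Prop} (h : AbsL Y Y' S R)
    (hR : ∀ x y, R' x y → R x y) : AbsL Y Y' S R' :=
  fun x y hx h1 => (h x y hx (hR _ _ h1)).mono hR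

theorem refine_rel {Y Y' : Set (ℕ → T)} {R : (ℕ → T) → (ℕ → T) → Prop}
    (hR : Good Y Y' univ univ R)
    (L : Set (ℕ → T) → Set (ℕ → T) → (ℕ → T) → (ℕ → T) → Prop)
    (hL : ∀ U U', IsClopen U → IsClopen U' → U.Nonempty → U'.Nonempty →
      Good Y Y' U U' (L U U')) :
    ∃ R', Good Y Y' univ univ R' ∧ (∀ x y, R' x y → R x y) ∧
      (∀ x y, R' x y → Pt Y Y' R' x y ∨ ∃ U U', IsClopen U ∧ IsClopen U' ∧ U.Nonempty ∧
        U'.Nonempty ∧ x ∈ U ∧ y ∈ U' ∧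
        (∀ x' y', x' ∈ U ∨ y' ∈ U' → (R' x' y' ↔ L U U' x' y'))) := by
  let R' : (ℕ → T) → (ℕ → T) → Prop := fun x y =>
    R x y ∧ (Pt Y Y' R x y ∨ L {x' | R x' y} {y' | R x y'} x y)
  have sub : ∀ x y, R' x y → R x y := fun x y h => h.1
  have main : ∀ x y, R x y → Pt Y Y' R x y ∨ ∃ U U', IsClopen U ∧ IsClopen U' ∧ U.Nonempty ∧
        U'.Nonempty ∧ x ∈ U ∧ y ∈ U' ∧
        (∀ x' y', x' ∈ U ∨ y' ∈ U' → (R' x' y' ↔ L U U' x' y')) := by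
    intro x y hxy
    by_cases hp : Pt Y Y' R x y
    · exact Or.inl hp
    refine Or.inr ?_
    have hc : Cell R x y := (hR.g x y hxy).resolve_left hp
    refine ⟨{x' | R x' y}, {y' | R x y'}, hc.o1, hc.o2, ⟨x, hxy⟩, ⟨y, hxy⟩, hxy, hxy, ?_⟩
    intro x' y' h
    have hG := hL _ _ hc.o1 hc.o2 ⟨x, hxy⟩ ⟨y, hxy⟩
    have key : R x' y → R x y' → (R' x' y' ↔ L {x' | R x' y} {y' | R x y'} x' y') := by
      intro h1 h2
      have h3 : R x' y' := (hc.r1 x' y' h1).2 h2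
      have e1 : {x'' | R x'' y'} = {x' | R x' y} := by
        ext a; exact hc.r2 a y' h2
      have e2 : {y'' | R x' y''} = {y' | R x y'} := by
        ext a; exact hc.r1 x' a h1
      have np : ¬ Pt Y Y' R x' y' := by
        intro hp'
        have a1 : x = x' := hp'.u2 x h2
        have a2 : y = y' := hp'.u1 y h1
        subst a1; subst a2
        exact hp hp'
      simp only [R', h3, np, e1, e2, true_and, false_or]
    constructor
    · intro h'
      have h3 := sub _ _ h'
      rcases h with h | h
      · exact (key h ((hc.r1 x' y' h).1 h3)).1 h'
      · exact (key ((hc.r2 x' y' h).1 h3) h).1 h'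
    · intro h'
      exact (key (hG.s1 _ _ h') (hG.s2 _ _ h')).2 h'
  refine ⟨R', ⟨fun _ _ _ => mem_univ _, fun _ _ _ => mem_univ _, ?_, ?_, ?_⟩, sub, ?_⟩
  · intro x _
    obtain ⟨y, hxy⟩ := hR.t1 x (mem_univ _)
    rcases main x y hxy with h | ⟨U, U', h1, h2, h3, h4, h5, h6, h7⟩
    · exact ⟨y, hxy, Or.inl h⟩
    · obtain ⟨z, hz⟩ := (hL U U' h1 h2 h3 h4).t1 x h5
      exact ⟨z, (h7 x z (Or.inl h5)).2 hz⟩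
  · intro y _
    obtain ⟨x, hxy⟩ := hR.t2 y (mem_univ _)
    rcases main x y hxy with h | ⟨U, U', h1, h2, h3, h4, h5, h6, h7⟩
    · exact ⟨x, hxy, Or.inl h⟩
    · obtain ⟨z, hz⟩ := (hL U U' h1 h2 h3 h4).t2 y h6
      exact ⟨z, (h7 z y (Or.inr h6)).2 hz⟩
  · intro x y hxy
    rcases main x y (sub _ _ hxy) with h | ⟨U, U', h1, h2, h3, h4, h5, h6, h7⟩
    · exact Or.inl (h.mono sub)
    · have hG := hL U U' h1 h2 h3 h4
      have hl : L U U' x y := (h7 x y (Or.inl h5)).1 hxy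
      have e1 : ∀ x', R' x' y ↔ L U U' x' y := fun x' => h7 x' y (Or.inr h6)
      have e2 : ∀ y', R' x y' ↔ L U U' x y' := fun y' => h7 x y' (Or.inl h5)
      rcases hG.g x y hl with hp | hc
      · left
        refine ⟨fun y' h => hp.u1 y' ((e2 y').1 h), fun x' h => hp.u2 x' ((e1 x').1 h), hp.mat,
          ?_, ?_⟩
        · intro n
          obtain ⟨m, hm⟩ := hp.c1 n
          obtain ⟨m', hm'⟩ := isOpen_Ag.1 h1.2 x h5
          refine ⟨max m m', fun x' y' ha hr => ?_⟩
          exact hm x' y' (ha.mono (le_max_left _ _))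
            ((h7 x' y' (Or.inl (hm' x' (ha.mono (le_max_right _ _))))).1 hr)
        · intro n
          obtain ⟨m, hm⟩ := hp.c2 n
          obtain ⟨m', hm'⟩ := isOpen_Ag.1 h2.2 y h6
          refine ⟨max m m', fun x' y' ha hr => ?_⟩
          exact hm x' y' (ha.mono (le_max_left _ _))
            ((h7 x' y' (Or.inr (hm' y' (ha.mono (le_max_right _ _))))).1 hr)
      · right
        refine ⟨?_, ?_, ?_, ?_⟩
        · simpa only [e1] using hc.o1
        · simpa only [e2] using hc.o2
        · intro x' y' h
          have h' := (e1 x').1 h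
          rw [h7 x' y' (Or.inl (hG.s1 _ _ h')), e2]
          exact hc.r1 x' y' h'
        · intro x' y' h
          have h' := (e2 y').1 h
          rw [h7 x' y' (Or.inr (hG.s2 _ _ h')), e1]
          exact hc.r2 x' y' h'
  · intro x y hxy
    exact (main x y (sub _ _ hxy)).imp_left fun h => h.mono sub

theorem refine_small {Y Y' : Set (ℕ → T)} {R : (ℕ → T) → (ℕ → T) → Prop}
    (hR : Good Y Y' univ univ R) (n : ℕ)
    (hL : ∀ U U' : Set (ℕ → T), IsClopen U → IsClopen U' → U.Nonempty → U'.Nonempty →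
      ∃ L, Good Y Y' U U' L ∧ SmallL n L) :
    ∃ R', Good Y Y' univ univ R' ∧ (∀ x y, R' x y → R x y) ∧ SmallL n R' := by
  classical
  choose! L hL1 hL2 using hL
  obtain ⟨R', h1, h2, h3⟩ := refine_rel hR L hL1
  refine ⟨R', h1, h2, ?_⟩
  intro x x' y hx hx'
  rcases h3 x y hx with h | ⟨U, U', a1, a2, a3, a4, a5, a6, a7⟩
  · rw [h.u2 x' hx']; exact Ag.refl _ _
  · exact hL2 U U' a1 a2 a3 a4 x x' y ((a7 x y (Or.inr a6)).1 hx) ((a7 x' y (Or.inr a6)).1 hx')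

theorem refine_abs {Y Y' S : Set (ℕ → T)} {R : (ℕ → T) → (ℕ → T) → Prop}
    (hR : Good Y Y' univ univ R)
    (hL : ∀ U U' : Set (ℕ → T), IsClopen U → IsClopen U' → U.Nonempty → U'.Nonempty →
      ∃ L, Good Y Y' U U' L ∧ AbsL Y Y' S L) :
    ∃ R', Good Y Y' univ univ R' ∧ (∀ x y, R' x y → R x y) ∧ AbsL Y Y' S R' := by
  classical
  choose! L hL1 hL2 using hL
  obtain ⟨R', h1, h2, h3⟩ := refine_rel hR L hL1
  refine ⟨R', h1, h2, ?_⟩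
  intro x y hxS hxy
  rcases h3 x y hxy with h | ⟨U, U', a1, a2, a3, a4, h5, h6, h7⟩
  · exact h
  · have hp := hL2 U U' a1 a2 a3 a4 x y hxS ((h7 x y (Or.inr h6)).1 hxy)
    refine ⟨fun y' h => hp.u1 y' ((h7 x y' (Or.inl h5)).1 h),
      fun x' h => hp.u2 x' ((h7 x' y (Or.inr h6)).1 h), hp.mat, ?_, ?_⟩
    · intro n
      obtain ⟨m, hm⟩ := hp.c1 n
      obtain ⟨m', hm'⟩ := isOpen_Ag.1 a1.2 x h5
      refine ⟨max m m', fun x' y' ha hr => ?_⟩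
      exact hm x' y' (ha.mono (le_max_left _ _))
        ((h7 x' y' (Or.inl (hm' x' (ha.mono (le_max_right _ _))))).1 hr)
    · intro n
      obtain ⟨m, hm⟩ := hp.c2 n
      obtain ⟨m', hm'⟩ := isOpen_Ag.1 a2.2 y h6
      refine ⟨max m m', fun x' y' ha hr => ?_⟩
      exact hm x' y' (ha.mono (le_max_left _ _))
        ((h7 x' y' (Or.inr (hm' y' (ha.mono (le_max_right _ _))))).1 hr)

/-- The limit map of a decreasing sequence of relations. -/
theorem limit_map {Y Y' : Set (ℕ → T)} (R : ℕ → (ℕ → T) → (ℕ → T) → Prop)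
    (hG : ∀ n, Good Y Y' univ univ (R n)) (hdec : ∀ n x y, R (n + 1) x y → R n x y)
    (hs : ∀ n, SmallL n (fun a b => R (n + 1) b a)) :
    ∃ f : (ℕ → T) → (ℕ → T), Continuous f ∧ (∀ n x, R n x (f x)) ∧
      ∀ x y, (∀ n, R n x y) → y = f x := by
  have hdec' : ∀ m n, n ≤ m → ∀ x y, R m x y → R n x y := by
    intro m n h
    induction h with
    | refl => exact fun _ _ h => h
    | step _ ih => exact fun x y h => ih x y (hdec _ x y h)
  have ht : ∀ n x, ∃ y, R n x y := fun n x => (hG n).t1 x (mem_univ _)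
  choose c hc using ht
  let f : (ℕ → T) → (ℕ → T) := fun x i => c (i + 2) x i
  have hcAg : ∀ x m, Ag m (c (m + 1) x) (f x) := by
    intro x m i hi
    exact hs (i + 1) (c (m + 1) x) (c (i + 2) x) x (hdec' _ _ (by omega) _ _ (hc (m + 1) x)) (hc (i + 2) x) i
      (Nat.lt_succ_self i)
  have hRf : ∀ n x, R n x (f x) := by
    intro n x
    rcases (hG n).g x _ (hc n x) with h | h
    · have : f x = c n x := by
        apply eq_of_Ag
        intro m
        have h1 : R n x (c (max m n + 1) x) := hdec' _ _ (by omega) _ _ (hc _ x)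
        rw [← h.u1 _ h1]
        exact ((hcAg x (max m n)).mono (le_max_left _ _)).symm
      rw [this]; exact hc n x
    · by_contra hcon
      obtain ⟨m, hm⟩ := isClosed_Ag.1 h.o2.1 (f x) hcon
      refine hm (c (max m n + 1) x) ((hcAg x (max m n)).mono (le_max_left _ _)).symm ?_
      exact hdec' _ _ (by omega) _ _ (hc _ x)
  have huniq : ∀ x y, (∀ n, R n x y) → y = f x := by
    intro x y h
    exact eq_of_Ag fun n => hs n y (f x) x (h _) (hRf _ x)
  refine ⟨f, ?_, hRf, huniq⟩
  rw [continuous_Ag]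
  intro x n
  rcases (hG (n + 1)).g x _ (hRf (n + 1) x) with h | h
  · obtain ⟨m, hm⟩ := h.c1 n
    exact ⟨m, fun x' hx' => hm x' _ hx' (hRf _ x')⟩
  · obtain ⟨m, hm⟩ := isOpen_Ag.1 h.o1.2 x (hRf (n + 1) x)
    refine ⟨m, fun x' hx' => hs n _ _ x (hRf _ x) ?_⟩
    exact (h.r1 x' _ (hm x' hx')).1 (hRf _ x')

theorem back_forth {Y Y' : Set (ℕ → T)} (S S' : ℕ → Set (ℕ → T))
    (hY : Y ⊆ ⋃ n, S n) (hY' : Y' ⊆ ⋃ n, S' n)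
    (h1 : ∀ (U U' : Set (ℕ → T)) (n : ℕ), IsClopen U → IsClopen U' → U.Nonempty → U'.Nonempty →
      ∃ L, Good Y Y' U U' L ∧ SmallL n L)
    (h1' : ∀ (U U' : Set (ℕ → T)) (n : ℕ), IsClopen U → IsClopen U' → U.Nonempty → U'.Nonempty →
      ∃ L, Good Y' Y U U' L ∧ SmallL n L)
    (h2 : ∀ (U U' : Set (ℕ → T)) (n : ℕ), IsClopen U → IsClopen U' → U.Nonempty → U'.Nonempty →
      ∃ L, Good Y Y' U U' L ∧ AbsL Y Y' (S n) L)
    (h2' : ∀ (U U' : Set (ℕ → T)) (n : ℕ), IsClopen U → IsClopen U' → U.Nonempty → U'.Nonempty →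
      ∃ L, Good Y' Y U U' L ∧ AbsL Y' Y (S' n) L) [Nonempty T] :
    ∃ f : (ℕ → T) ≃ₜ (ℕ → T), ∀ x, x ∈ Y ↔ f x ∈ Y' := by
  have step : ∀ (n : ℕ) (R : {R : (ℕ → T) → (ℕ → T) → Prop // Good Y Y' univ univ R}),
      ∃ R' : {R : (ℕ → T) → (ℕ → T) → Prop // Good Y Y' univ univ R},
        (∀ x y, R'.1 x y → R.1 x y) ∧ SmallL n R'.1 ∧ SmallL n (fun a b => R'.1 b a) ∧
        AbsL Y Y' (S n) R'.1 ∧ AbsL Y' Y (S' n) (fun a b => R'.1 b a) := by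
    rintro n ⟨R, hR⟩
    obtain ⟨R1, g1, d1, s1⟩ := refine_small hR n (fun U U' => h1 U U' n)
    obtain ⟨R2, g2, d2, s2⟩ := refine_small g1.flip n (fun U U' => h1' U U' n)
    obtain ⟨R3, g3, d3, s3⟩ := refine_abs g2.flip (S := S n) (fun U U' => h2 U U' n)
    obtain ⟨R4, g4, d4, s4⟩ := refine_abs g3.flip (S := S' n) (fun U U' => h2' U U' n)
    refine ⟨⟨fun a b => R4 b a, g4.flip⟩, ?_, ?_, ?_, ?_, ?_⟩
    · exact fun x y h => d1 _ _ (d2 _ _ (d3 _ _ (d4 _ _ h)))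
    · exact s1.mono fun x y h => d2 _ _ (d3 _ _ (d4 _ _ h))
    · exact s2.mono fun x y h => d3 _ _ (d4 _ _ h)
    · exact s3.mono fun x y h => d4 _ _ h
    · exact s4
  choose next hn using step
  have g0 : Good Y Y' univ univ (fun _ _ : ℕ → T => True) := by
    refine ⟨by simp, by simp, by simp, by simp, fun x y _ => Or.inr ⟨?_, ?_, by simp, by simp⟩⟩
    · exact isClopen_univ
    · exact isClopen_univ
  let Q : ℕ → {R : (ℕ → T) → (ℕ → T) → Prop // Good Y Y' univ univ R} := fun n =>
    Nat.rec ⟨_, g0⟩ (fun n R => next n R) n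
  have hQ : ∀ n, Q (n + 1) = next n (Q n) := fun n => rfl
  obtain ⟨f, fc, fR, fu⟩ := limit_map (fun n => (Q n).1) (fun n => (Q n).2)
    (fun n => (hn n (Q n)).1) (fun n => (hn n (Q n)).2.2.1)
  obtain ⟨g, gc, gR, gu⟩ := limit_map (fun n a b => (Q n).1 b a) (fun n => (Q n).2.flip)
    (fun n x y => (hn n (Q n)).1 y x) (fun n => (hn n (Q n)).2.1)
  refine ⟨⟨⟨f, g, ?_, ?_⟩, fc, gc⟩, ?_⟩
  · intro x; exact (gu (f x) x fun n => fR n x).symm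
  · intro x; exact (fu (g x) x fun n => gR n x).symm
  · intro x
    change x ∈ Y ↔ f x ∈ Y'
    constructor
    · intro h
      obtain ⟨n, hnS⟩ := mem_iUnion.1 (hY h)
      exact ((hn n (Q n)).2.2.2.1 x (f x) hnS (fR (n + 1) x)).mat.1 h
    · intro h
      obtain ⟨n, hnS⟩ := mem_iUnion.1 (hY' h)
      exact ((hn n (Q n)).2.2.2.2 (f x) x hnS (fR (n + 1) x)).mat.1 h

end top
end DHA

namespace DHA

section local_lemmas
variable {T : Type u} [TopologicalSpace T] [DiscreteTopology T]

theorem clopen_loc {U : Set (ℕ → T)} (hU : IsClopen U) (x : ℕ → T) :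
    ∃ m, ∀ y, Ag m x y → (x ∈ U ↔ y ∈ U) := by
  by_cases hx : x ∈ U
  · obtain ⟨m, hm⟩ := isOpen_Ag.1 hU.isOpen x hx
    exact ⟨m, fun y hy => ⟨fun _ => hm y hy, fun _ => hx⟩⟩
  · obtain ⟨m, hm⟩ := isClosed_Ag.1 hU.isClosed x hx
    exact ⟨m, fun y hy => ⟨fun h => (hx h).elim, fun h => (hm y hy h).elim⟩⟩

theorem shrink (Y Y' : Set (ℕ → T)) (U U' : Set (ℕ → T)) (n : ℕ) (hU : IsClopen U)
    (hU' : IsClopen U') (hn : U.Nonempty) (hn' : U'.Nonempty) :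
    ∃ L, Good Y Y' U U' L ∧ SmallL n L := by
  classical
  obtain ⟨x0, hx0⟩ := hn
  obtain ⟨y0, hy0⟩ := hn'
  obtain ⟨N, hN⟩ := isOpen_Ag.1 hU'.isOpen y0 hy0
  let sh : (ℕ → T) → (ℕ → T) := fun y i => y (N + i)
  let ρ : (ℕ → T) → (ℕ → T) := fun y =>
    if Ag N y0 y ∧ ∃ x ∈ U, Ag n x (sh y) then sh y else x0
  have hsh : ∀ y y', Ag (N + n) y y' → Ag n (sh y) (sh y') := fun y y' h i hi =>
    h (N + i) (by omega)
  have hρ : ∀ y y', Ag (N + n) y y' → Ag n (ρ y) (ρ y') := by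
    intro y y' h
    have e : (Ag N y0 y ∧ ∃ x ∈ U, Ag n x (sh y)) ↔ (Ag N y0 y' ∧ ∃ x ∈ U, Ag n x (sh y')) := by
      refine and_congr ⟨fun a => a.trans (h.mono (by omega)),
        fun a => a.trans (h.mono (by omega)).symm⟩ ?_
      refine exists_congr fun x => and_congr_right fun _ => ?_
      exact ⟨fun a => a.trans (hsh _ _ h), fun a => a.trans (hsh _ _ h).symm⟩
    by_cases c : Ag N y0 y ∧ ∃ x ∈ U, Ag n x (sh y)
    · have c' := e.1 c
      simp only [ρ, if_pos c, if_pos c']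
      exact hsh _ _ h
    · have c' := fun k => c (e.2 k)
      simp only [ρ, if_neg c, if_neg c']
      exact Ag.refl _ _
  refine ⟨fun x y => x ∈ U ∧ y ∈ U' ∧ Ag n x (ρ y), ⟨fun x y h => h.1, fun x y h => h.2.1,
    ?_, ?_, ?_⟩, ?_⟩
  · intro x hx
    let y : ℕ → T := fun i => if i < N then y0 i else x (i - N)
    have h1 : Ag N y0 y := fun i hi => by simp [y, hi]
    have h2 : sh y = x := by
      funext i; simp [sh, y]
    refine ⟨y, hx, hN y h1, ?_⟩
    have : ρ y = sh y := if_pos ⟨h1, x, hx, by rw [h2]; exact Ag.refl _ _⟩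
    rw [this, h2]; exact Ag.refl _ _
  · intro y hy
    by_cases c : Ag N y0 y ∧ ∃ x ∈ U, Ag n x (sh y)
    · obtain ⟨x, hx, hxy⟩ := c.2
      refine ⟨x, hx, hy, ?_⟩
      simp only [ρ, if_pos c]; exact hxy
    · refine ⟨x0, hx0, hy, ?_⟩
      simp only [ρ, if_neg c]; exact Ag.refl _ _
  · rintro x y ⟨hx, hy, hxy⟩
    refine Or.inr ⟨?_, ?_, ?_, ?_⟩
    · refine isClopen_Ag fun a => ?_
      obtain ⟨m, hm⟩ := clopen_loc hU a
      refine ⟨max m n, fun b hb => ?_⟩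
      have h1 := hm b (hb.mono (le_max_left _ _))
      have h2 := hb.mono (le_max_right m n)
      exact and_congr h1 (and_congr_right fun _ => ⟨fun k => h2.symm.trans k, fun k => h2.trans k⟩)
    · refine isClopen_Ag fun a => ?_
      obtain ⟨m, hm⟩ := clopen_loc hU' a
      refine ⟨max m (N + n), fun b hb => ?_⟩
      have h1 := hm b (hb.mono (le_max_left _ _))
      have h2 := hρ _ _ (hb.mono (le_max_right m (N + n)))
      exact and_congr_right fun _ => and_congr h1 ⟨fun k => k.trans h2, fun k => k.trans h2.symm⟩
    · rintro x' y' ⟨hx', -, h⟩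
      exact ⟨fun k => ⟨hx, k.2.1, hxy.trans (h.symm.trans k.2.2)⟩,
        fun k => ⟨hx', k.2.1, h.trans (hxy.symm.trans k.2.2)⟩⟩
    · rintro x' y' ⟨-, hy', h⟩
      exact ⟨fun k => ⟨k.1, hy, k.2.2.trans (h.symm.trans hxy)⟩,
        fun k => ⟨k.1, hy', k.2.2.trans (hxy.symm.trans h)⟩⟩
  · rintro x x' y ⟨_, _, h⟩ ⟨_, _, h'⟩
    exact h.trans h'.symm

theorem exists_retr {F : Set (ℕ → T)} (hF : IsClosed F) (hne : F.Nonempty) :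
    ∃ r : (ℕ → T) → (ℕ → T), (∀ x ∈ F, r x = x) ∧ (∀ x, r x ∈ F) ∧
      ∀ n x y, Ag n x y → Ag n (r x) (r y) := by
  obtain ⟨f, f1, f2, f3⟩ := PiNat.exists_lipschitz_retraction_of_isClosed hF hne
  refine ⟨f, f1, fun x => f2 ▸ mem_range_self x, fun n x y h => ?_⟩
  let _ := PiNat.metricSpace (E := fun _ : ℕ => T)
  have h0 : dist x y ≤ (1 / 2) ^ n := PiNat.mem_cylinder_iff_dist_le.1 (fun i hi => h i hi)
  have h1 : dist (f x) (f y) ≤ (1 / 2) ^ n := by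
    have := f3.dist_le_mul x y
    simp only [NNReal.coe_one, one_mul] at this
    exact this.trans h0
  have := PiNat.mem_cylinder_iff_dist_le.2 h1
  exact fun i hi => this i hi

structure Side (U F : Set (ℕ → T)) (E : ℕ → (ℕ → T) → (ℕ → T) → Prop)
    (r : (ℕ → T) → (ℕ → T)) (l : (ℕ → T) → ℕ) : Prop where
  r1 : ∀ x, r x ∈ F
  r3 : ∀ x ∈ U \ F, Ag (l x) x (r x)
  r4 : ∀ x ∈ U \ F, ∃ m, ∀ x', Ag m x x' → x' ∈ U \ F ∧ l x' = l x ∧ E (l x) (r x) (r x')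
  r5 : ∀ p ∈ F, ∀ n, ∃ m, ∀ x ∈ U \ F, Ag m p x → n ≤ l x ∧ E n p (r x)
  r6 : ∀ p ∈ F, ∀ n, ∃ x ∈ U \ F, l x = n ∧ E n p (r x)

theorem side {U F : Set (ℕ → T)} (hU : IsClopen U) (hF : IsClosed F) (hFU : F ⊆ U)
    (hne : F.Nonempty) (hnd : ∀ p ∈ F, ∀ N, ∃ x, x ∉ F ∧ Ag N x p)
    (E : ℕ → (ℕ → T) → (ℕ → T) → Prop) (hE : ∀ n, Equivalence (E n))
    (hEm : ∀ n x y, E (n + 1) x y → E n x y)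
    (hEc : ∀ p ∈ F, ∀ n, ∃ m, ∀ p' ∈ F, Ag m p p' → E n p p') :
    ∃ r l, Side U F E r l := by
  classical
  obtain ⟨r, rid, rF, rL⟩ := exists_retr hF hne
  have hEm' : ∀ n m, n ≤ m → ∀ x y, E m x y → E n x y := by
    intro n m h
    induction h with
    | refl => exact fun x y h => h
    | step h ih => exact fun x y h => ih _ _ (hEm _ _ _ h)
  have hinh : Nonempty (ℕ → T) := ⟨hne.some⟩
  have key : ∀ (n : ℕ) (p : ℕ → T) (N : ℕ), ∃ (x : ℕ → T) (K : ℕ), p ∈ F →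
      x ∈ U \ F ∧ E n p (r x) ∧ Ag N x (r x) ∧ ¬ Ag K x (r x) := by
    intro n p N
    by_cases hp : p ∈ F
    swap
    · exact ⟨p, 0, fun h => (hp h).elim⟩
    obtain ⟨m, hm⟩ := hEc p hp n
    obtain ⟨m', hm'⟩ := clopen_loc hU p
    obtain ⟨x, hx, hxp⟩ := hnd p hp (max (max m N) m')
    have h1 : Ag (max (max m N) m') p (r x) := by
      have := rL _ _ _ hxp
      rw [rid p hp] at this
      exact this.symm
    have h2 : ∃ K, ¬ Ag K x (r x) := by
      by_contra! h
      exact hx (by rw [eq_of_Ag h]; exact rF x)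
    obtain ⟨K, hK⟩ := h2
    refine ⟨x, K, fun _ => ⟨⟨?_, hx⟩, hm _ (rF x) (h1.mono (by omega)),
      (hxp.trans h1).mono (by omega), hK⟩⟩
    exact (hm' x (hxp.symm.mono (by omega))).1 (hFU hp)
  choose X K hXK using key
  let rep : ℕ → (ℕ → T) → (ℕ → T) := fun n p => Classical.epsilon fun p' => p' ∈ F ∧ E n p p'
  have rep_spec : ∀ n, ∀ p ∈ F, rep n p ∈ F ∧ E n p (rep n p) := fun n p hp =>
    Classical.epsilon_spec (p := fun p' => p' ∈ F ∧ E n p p') ⟨p, hp, (hE n).refl p⟩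
  have rep_inv : ∀ n p p', E n p p' → rep n p = rep n p' := by
    intro n p p' h
    have : (fun q => q ∈ F ∧ E n p q) = fun q => q ∈ F ∧ E n p' q := by
      funext q
      exact propext (and_congr_right fun _ =>
        ⟨fun k => (hE n).trans ((hE n).symm h) k, fun k => (hE n).trans h k⟩)
    simp only [rep, this]
  let g : ℕ → (ℕ → T) → ℕ := fun n => Nat.rec (fun _ => 0)
    (fun n gn p => max (gn p + 1) (K n (rep n p) (gn p))) n
  have g0 : ∀ p, g 0 p = 0 := fun p => rfl
  have gs : ∀ n p, g (n + 1) p = max (g n p + 1) (K n (rep n p) (g n p)) := fun n p => rfl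
  have g_inv : ∀ n p p', E n p p' → g (n + 1) p = g (n + 1) p' := by
    intro n
    induction n with
    | zero => intro p p' h; rw [gs, gs, rep_inv _ _ _ h, g0, g0]
    | succ n ih => intro p p' h; rw [gs (n + 1), gs (n + 1), rep_inv _ _ _ h, ih p p' (hEm _ _ _ h)]
  have g_inv' : ∀ n p p', E n p p' → ∀ j, j ≤ n + 1 → g j p = g j p' := by
    intro n p p' h j hj
    rcases j with _ | j
    · rfl
    · exact g_inv j _ _ (hEm' j n (by omega) _ _ h)
  have g_mono : ∀ p, StrictMono (fun n => g n p) := fun p =>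
    strictMono_nat_of_lt_succ fun n => by
      show g n p < g (n + 1) p
      rw [gs]
      have := le_max_left (g n p + 1) (K n (rep n p) (g n p))
      omega
  have g_le : ∀ n p, n ≤ g n p := fun n p => (g_mono p).le_apply
  have hex : ∀ x ∈ U \ F, ∃ n, ¬ Ag (g (n + 1) (r x)) x (r x) := by
    intro x hx
    by_contra! h
    refine hx.2 ?_
    rw [eq_of_Ag (x := x) (y := r x) fun n => (h n).mono ((Nat.le_succ n).trans (g_le _ _))]
    exact rF x
  let l : (ℕ → T) → ℕ := fun x =>
    if h : ∃ n, ¬ Ag (g (n + 1) (r x)) x (r x) then Nat.find h else 0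
  have lchar : ∀ x n, Ag (g n (r x)) x (r x) → ¬ Ag (g (n + 1) (r x)) x (r x) → l x = n := by
    intro x n h1 h2
    have h : ∃ n, ¬ Ag (g (n + 1) (r x)) x (r x) := ⟨n, h2⟩
    simp only [l, dif_pos h]
    rw [Nat.find_eq_iff]
    refine ⟨h2, fun j hj k => k (h1.mono ((g_mono _).monotone (show j + 1 ≤ n by omega)))⟩
  have lspec : ∀ x ∈ U \ F, Ag (g (l x) (r x)) x (r x) ∧ ¬ Ag (g (l x + 1) (r x)) x (r x) := by
    intro x hx
    have h := hex x hx
    have hl : l x = Nat.find h := dif_pos h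
    rw [hl]
    refine ⟨?_, Nat.find_spec h⟩
    rcases hj : Nat.find h with _ | j
    · rw [g0]; exact fun i hi => by omega
    · exact not_not.1 (Nat.find_min h (m := j) (by omega))
  have lge : ∀ x ∈ U \ F, ∀ n, Ag (g n (r x)) x (r x) → n ≤ l x := by
    intro x hx n h
    by_contra! hlt
    exact (lspec x hx).2 (h.mono ((g_mono _).monotone (show l x + 1 ≤ n by omega)))
  refine ⟨r, l, rF, ?_, ?_, ?_, ?_⟩
  · exact fun x hx => (lspec x hx).1.mono (g_le _ _)
  · intro x hx
    obtain ⟨m1, hm1⟩ := clopen_loc hU x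
    obtain ⟨m2, hm2⟩ := isClosed_Ag.1 hF x hx.2
    obtain ⟨m3, hm3⟩ := hEc (r x) (rF x) (l x)
    refine ⟨max (max m1 m2) (max m3 (g (l x + 1) (r x))), fun x' h => ?_⟩
    have hrr := rL _ _ _ h
    have hEE : E (l x) (r x) (r x') := hm3 _ (rF x') (hrr.mono (by omega))
    refine ⟨⟨(hm1 x' (h.mono (by omega))).1 hx.1, hm2 x' (h.mono (by omega))⟩, ?_, hEE⟩
    have hle : g (l x) (r x) ≤ g (l x + 1) (r x) := (g_mono _).monotone (Nat.le_succ _)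
    obtain ⟨s1, s2⟩ := lspec x hx
    refine lchar x' (l x) ?_ ?_
    · rw [← g_inv' _ _ _ hEE _ (by omega)]
      exact (h.mono (by omega)).symm.trans (s1.trans (hrr.mono (by omega)))
    · rw [← g_inv' _ _ _ hEE (l x + 1) (by omega)]
      intro k
      exact s2 ((h.mono (by omega)).trans (k.trans (hrr.mono (by omega)).symm))
  · intro p hp n
    obtain ⟨m, hm⟩ := hEc p hp n
    refine ⟨max m (g n p), fun x hx h => ?_⟩
    have hrr := rL _ _ _ h
    rw [rid p hp] at hrr
    have hEE : E n p (r x) := hm _ (rF x) (hrr.mono (by omega))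
    refine ⟨lge x hx n ?_, hEE⟩
    rw [← g_inv' _ _ _ hEE _ (by omega)]
    exact (h.symm.trans hrr).mono (by omega)
  · intro p hp n
    obtain ⟨q1, q2⟩ := rep_spec n p hp
    have hq : rep n (rep n p) = rep n p := (rep_inv _ _ _ q2).symm
    obtain ⟨x1, x2, x3, x4⟩ := hXK n (rep n p) (g n (rep n p)) q1
    set x := X n (rep n p) (g n (rep n p))
    refine ⟨x, x1, lchar x n ?_ ?_, (hE n).trans q2 x2⟩
    · rw [← g_inv' _ _ _ x2 _ (by omega)]; exact x3
    · rw [← g_inv' _ _ _ x2 (n + 1) (by omega), gs, hq]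
      exact fun k => x4 (k.mono (le_max_right _ _))

/-- `Y2` is universal for `Y1`, everywhere. -/
def Uni (Y1 Y2 : Set (ℕ → T)) : Prop :=
  ∀ V : Set (ℕ → T), IsClopen V → V.Nonempty → ∃ ψ : (ℕ → T) → (ℕ → T),
    IsClosedEmbedding ψ ∧ (∀ x, ψ x ∈ V) ∧ ∀ x, ψ x ∈ Y2 ↔ x ∈ Y1

theorem absorb {Y Y' S : Set (ℕ → T)} (hUni : Uni Y Y') (hS : IsClosed S)
    (hSn : ∀ p ∈ S, ∀ N, ∃ x, x ∉ S ∧ Ag N x p)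
    (U U' : Set (ℕ → T)) (hU : IsClopen U)
    (hU' : IsClopen U') (hn : U.Nonempty) (hn' : U'.Nonempty) :
    ∃ L, Good Y Y' U U' L ∧ AbsL Y Y' S L := by
  classical
  obtain hem | hne := (S ∩ U).eq_empty_or_nonempty
  · refine ⟨fun x y => x ∈ U ∧ y ∈ U', ⟨fun x y h => h.1, fun x y h => h.2,
      fun x hx => hn'.imp fun y hy => ⟨hx, hy⟩, fun y hy => hn.imp fun x hx => ⟨hx, hy⟩, ?_⟩, ?_⟩
    · rintro x y ⟨hx, hy⟩
      refine Or.inr ⟨?_, ?_, ?_, ?_⟩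
      · simpa [hy] using hU
      · simpa [hx] using hU'
      · rintro x' y' ⟨hx', -⟩; simp [hx, hx']
      · rintro x' y' ⟨-, hy'⟩; simp [hy, hy']
    · rintro x y hx ⟨hxU, -⟩
      exact (hem.subset ⟨hx, hxU⟩).elim
  obtain ⟨ψ, hψ, hψV, hψY⟩ := hUni U' hU' hn'
  set F := S ∩ U with hFdef
  have hF : IsClosed F := hS.inter hU.isClosed
  have hFU : F ⊆ U := inter_subset_right
  have hFn : ∀ p ∈ F, ∀ N, ∃ x, x ∉ F ∧ Ag N x p := fun p hp N =>
    (hSn p hp.1 N).imp fun x hx => ⟨fun h => hx.1 h.1, hx.2⟩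
  have hF' : IsClosed (ψ '' F) := hψ.isClosedMap F hF
  have hFU' : ψ '' F ⊆ U' := by rintro _ ⟨x, -, rfl⟩; exact hψV x
  have hinj := hψ.injective
  have hcont := continuous_Ag.1 hψ.continuous
  have hmemF : ∀ x, ψ x ∈ ψ '' F ↔ x ∈ F := fun x => hinj.mem_set_image
  have hFn' : ∀ p ∈ ψ '' F, ∀ N, ∃ x, x ∉ ψ '' F ∧ Ag N x p := by
    rintro _ ⟨p, hp, rfl⟩ N
    obtain ⟨m, hm⟩ := hcont p N
    obtain ⟨x, hx, hxp⟩ := hFn p hp m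
    exact ⟨ψ x, fun h => hx ((hmemF x).1 h), (hm x hxp.symm).symm⟩
  have hinh : Nonempty (ℕ → T) := ⟨hn.some⟩
  let φ : (ℕ → T) → (ℕ → T) := Function.invFun ψ
  have hφ : ∀ x, φ (ψ x) = x := Function.leftInverse_invFun hinj
  have hφF : ∀ y ∈ ψ '' F, φ y ∈ F ∧ ψ (φ y) = y := by
    rintro _ ⟨x, hx, rfl⟩; rw [hφ]; exact ⟨hx, rfl⟩
  have hφc : ∀ p n, ∃ m, ∀ p', Ag m (ψ p) (ψ p') → Ag n p p' := by
    intro p n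
    have h1 : {y | Ag n p y} ∈ 𝓝 p := mem_nhds_Ag.2 ⟨n, fun y hy => hy⟩
    rw [hψ.isInducing.nhds_eq_comap, mem_comap] at h1
    obtain ⟨t, ht, hts⟩ := h1
    obtain ⟨m, hm⟩ := mem_nhds_Ag.1 ht
    exact ⟨m, fun p' hp' => hts (hm _ hp')⟩
  let E : ℕ → (ℕ → T) → (ℕ → T) → Prop := fun n p p' => Ag n p p' ∧ Ag n (ψ p) (ψ p')
  have hE : ∀ n, Equivalence (E n) := fun n => ⟨fun x => ⟨Ag.refl _ _, Ag.refl _ _⟩,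
    fun h => ⟨h.1.symm, h.2.symm⟩, fun h h' => ⟨h.1.trans h'.1, h.2.trans h'.2⟩⟩
  have hEm : ∀ n x y, E (n + 1) x y → E n x y := fun n x y h =>
    ⟨h.1.mono (Nat.le_succ n), h.2.mono (Nat.le_succ n)⟩
  have hEm' : ∀ n m, n ≤ m → ∀ x y, E m x y → E n x y := fun n m h x y k =>
    ⟨k.1.mono h, k.2.mono h⟩
  let E' : ℕ → (ℕ → T) → (ℕ → T) → Prop := fun n y y' => E n (φ y) (φ y')
  obtain ⟨r, l, h⟩ := side hU hF hFU hne hFn E hE hEm (by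
    intro p hp n
    obtain ⟨m, hm⟩ := hcont p n
    exact ⟨max n m, fun p' _ k => ⟨k.mono (le_max_left _ _), hm _ (k.mono (le_max_right _ _))⟩⟩)
  obtain ⟨r', l', h'⟩ := side hU' hF' hFU' (hne.image ψ) hFn' E'
    (fun n => ⟨fun x => (hE n).refl _, fun h => (hE n).symm h, fun h h' => (hE n).trans h h'⟩)
    (fun n x y h => hEm n _ _ h) (by
    rintro _ ⟨p, hp, rfl⟩ n
    obtain ⟨m, hm⟩ := hφc p n
    refine ⟨max n m, ?_⟩
    rintro _ ⟨p', hp', rfl⟩ k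
    show E n (φ (ψ p)) (φ (ψ p'))
    rw [hφ, hφ]
    exact ⟨hm _ (k.mono (le_max_right _ _)), k.mono (le_max_left _ _)⟩)
  let R : (ℕ → T) → (ℕ → T) → Prop := fun x y => (x ∈ F ∧ y = ψ x) ∨
    (x ∈ U \ F ∧ y ∈ U' \ ψ '' F ∧ l x = l' y ∧ E (l x) (r x) (φ (r' y)))
  have hR1 : ∀ x ∈ F, ∀ y, R x y ↔ y = ψ x := fun x hx y => by
    simp [R, hx]
  have hR2 : ∀ x ∈ F, ∀ x', R x' (ψ x) ↔ x' = x := fun x hx x' => by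
    constructor
    · rintro (⟨-, k⟩ | ⟨-, k, -⟩)
      · exact (hinj k).symm
      · exact (k.2 ⟨x, hx, rfl⟩).elim
    · rintro rfl; exact Or.inl ⟨hx, rfl⟩
  have hPt : ∀ x ∈ F, Pt Y Y' R x (ψ x) := by
    intro x hx
    refine ⟨fun y' k => (hR1 x hx y').1 k, fun x' k => (hR2 x hx x').1 k, (hψY x).symm, ?_, ?_⟩
    · intro n
      obtain ⟨m1, hm1⟩ := hcont x n
      obtain ⟨m2, hm2⟩ := h.r5 x hx n
      refine ⟨max m1 m2, fun x' y' hxx k => ?_⟩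
      rcases k with ⟨-, rfl⟩ | ⟨k1, k2, k3, k4⟩
      · exact hm1 _ (hxx.mono (le_max_left _ _))
      · obtain ⟨q1, q2⟩ := hm2 x' k1 (hxx.mono (le_max_right _ _))
        have q3 := (hE n).trans q2 (hEm' _ _ q1 _ _ k4)
        have q4 := q3.2
        rw [(hφF _ (h'.r1 y')).2] at q4
        exact q4.trans ((h'.r3 y' k2).symm.mono (by omega))
    · intro n
      obtain ⟨m1, hm1⟩ := hφc x n
      obtain ⟨m2, hm2⟩ := h'.r5 (ψ x) ⟨x, hx, rfl⟩ n
      refine ⟨max m1 m2, fun x' y' hxx k => ?_⟩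
      rcases k with ⟨-, rfl⟩ | ⟨k1, k2, k3, k4⟩
      · exact hm1 _ (hxx.mono (le_max_left _ _))
      · obtain ⟨q1, q2⟩ := hm2 y' k2 (hxx.mono (le_max_right _ _))
        have q2' : E n x (φ (r' y')) := by
          have : E n (φ (ψ x)) (φ (r' y')) := q2
          rwa [hφ] at this
        have q3 := (hE n).trans q2' ((hE n).symm (hEm' _ _ (by omega) _ _ k4))
        exact q3.1.trans ((h.r3 x' k1).symm.mono (by omega))
  refine ⟨R, ⟨?_, ?_, ?_, ?_, ?_⟩, ?_⟩
  · rintro x y (k | k)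
    exacts [hFU k.1, k.1.1]
  · rintro x y (⟨k, rfl⟩ | k)
    exacts [hψV x, k.2.1.1]
  · intro x hx
    by_cases hxF : x ∈ F
    · exact ⟨ψ x, Or.inl ⟨hxF, rfl⟩⟩
    · obtain ⟨y, hy, hl, hEE⟩ := h'.r6 (ψ (r x)) ⟨r x, h.r1 x, rfl⟩ (l x)
      refine ⟨y, Or.inr ⟨⟨hx, hxF⟩, hy, hl.symm, ?_⟩⟩
      have : E (l x) (φ (ψ (r x))) (φ (r' y)) := hEE
      rwa [hφ] at this
  · intro y hy
    by_cases hyF : y ∈ ψ '' F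
    · obtain ⟨x, hx, rfl⟩ := hyF
      exact ⟨x, Or.inl ⟨hx, rfl⟩⟩
    · obtain ⟨x, hx, hl, hEE⟩ := h.r6 (φ (r' y)) (hφF _ (h'.r1 y)).1 (l' y)
      refine ⟨x, Or.inr ⟨hx, ⟨hy, hyF⟩, hl, ?_⟩⟩
      rw [hl]; exact (hE _).symm hEE
  · rintro x y (⟨k, rfl⟩ | ⟨k1, k2, k3, k4⟩)
    · exact Or.inl (hPt x k)
    have e1 : ∀ x', R x' y ↔ x' ∈ U \ F ∧ l x' = l' y ∧ E (l' y) (r x') (φ (r' y)) := by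
      intro x'
      constructor
      · rintro (⟨q, rfl⟩ | ⟨q1, q2, q3, q4⟩)
        · exact (k2.2 ⟨x', q, rfl⟩).elim
        · exact ⟨q1, q3, q3 ▸ q4⟩
      · rintro ⟨q1, q3, q4⟩
        exact Or.inr ⟨q1, k2, q3, q3.symm ▸ q4⟩
    have e2 : ∀ y', R x y' ↔ y' ∈ U' \ ψ '' F ∧ l x = l' y' ∧ E (l x) (r x) (φ (r' y')) := by
      intro y'
      constructor
      · rintro (⟨q, rfl⟩ | ⟨q1, q2, q3, q4⟩)
        · exact (k1.2 q).elim
        · exact ⟨q2, q3, q4⟩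
      · rintro ⟨q1, q3, q4⟩
        exact Or.inr ⟨k1, q1, q3, q4⟩
    refine Or.inr ⟨?_, ?_, ?_, ?_⟩
    · simp only [e1]
      refine isClopen_Ag fun a => ?_
      by_cases ha : a ∈ U
      swap
      · obtain ⟨m, hm⟩ := clopen_loc hU a
        exact ⟨m, fun b hb => iff_of_false (fun q => ha q.1.1)
          (fun q => ha ((hm b hb).2 q.1.1))⟩
      by_cases haF : a ∈ F
      · obtain ⟨m, hm⟩ := h.r5 a haF (l' y + 1)
        refine ⟨m, fun b hb => iff_of_false (fun q => q.1.2 haF) ?_⟩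
        rintro ⟨q1, q2, q3⟩
        have := (hm b q1 hb).1
        omega
      · obtain ⟨m, hm⟩ := h.r4 a ⟨ha, haF⟩
        refine ⟨m, fun b hb => ?_⟩
        obtain ⟨q1, q2, q3⟩ := hm b hb
        constructor
        · rintro ⟨p1, p2, p3⟩
          exact ⟨q1, q2.trans p2, (hE _).trans ((hE _).symm (p2 ▸ q3)) p3⟩
        · rintro ⟨p1, p2, p3⟩
          have p2' := q2.symm.trans p2
          exact ⟨⟨ha, haF⟩, p2', (hE _).trans (p2' ▸ q3) p3⟩
    · simp only [e2]
      refine isClopen_Ag fun a => ?_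
      by_cases ha : a ∈ U'
      swap
      · obtain ⟨m, hm⟩ := clopen_loc hU' a
        exact ⟨m, fun b hb => iff_of_false (fun q => ha q.1.1)
          (fun q => ha ((hm b hb).2 q.1.1))⟩
      by_cases haF : a ∈ ψ '' F
      · obtain ⟨m, hm⟩ := h'.r5 a haF (l x + 1)
        refine ⟨m, fun b hb => iff_of_false (fun q => q.1.2 haF) ?_⟩
        rintro ⟨q1, q2, q3⟩
        have := (hm b q1 hb).1
        omega
      · obtain ⟨m, hm⟩ := h'.r4 a ⟨ha, haF⟩
        refine ⟨m, fun b hb => ?_⟩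
        obtain ⟨q1, q2, q3⟩ := hm b hb
        have q3' : E (l' a) (φ (r' a)) (φ (r' b)) := q3
        constructor
        · rintro ⟨p1, p2, p3⟩
          exact ⟨q1, p2.trans q2.symm, (hE _).trans p3 (p2.symm ▸ q3')⟩
        · rintro ⟨p1, p2, p3⟩
          have p2' := p2.trans q2
          exact ⟨⟨ha, haF⟩, p2', (hE _).trans p3 ((hE _).symm (p2'.symm ▸ q3'))⟩
    · intro x' y' hx'y
      obtain ⟨q1, q2, q3⟩ := (e1 x').1 hx'y
      have hl : l x' = l x := q2.trans k3.symm
      have hee : E (l x) (r x) (r x') := by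
        have a1 : E (l x) (r x') (φ (r' y)) := k3 ▸ q3
        exact (hE _).trans k4 ((hE _).symm a1)
      rw [e2]
      constructor
      · rintro (⟨p, rfl⟩ | ⟨p1, p2, p3, p4⟩)
        · exact (q1.2 p).elim
        · exact ⟨p2, hl ▸ p3, (hE _).trans hee (hl ▸ p4)⟩
      · rintro ⟨p1, p2, p3⟩
        exact Or.inr ⟨q1, p1, hl.trans p2, hl.symm ▸ (hE _).trans ((hE _).symm hee) p3⟩
    · intro x' y' hxy'
      obtain ⟨q1, q2, q3⟩ := (e2 y').1 hxy'
      have hl : l' y' = l' y := q2.symm.trans k3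
      have hee : E (l' y) (φ (r' y)) (φ (r' y')) := by
        rw [← k3]
        exact (hE _).trans ((hE _).symm k4) q3
      rw [e1]
      constructor
      · rintro (⟨p, rfl⟩ | ⟨p1, p2, p3, p4⟩)
        · exact (q1.2 ⟨x', p, rfl⟩).elim
        · have p3' := p3.trans hl
          exact ⟨p1, p3', (hE _).trans (p3' ▸ p4) ((hE _).symm hee)⟩
      · rintro ⟨p1, p2, p3⟩
        exact Or.inr ⟨p1, q1, p2.trans hl.symm, p2.symm ▸ (hE _).trans p3 hee⟩
  · rintro x y hx (⟨k, rfl⟩ | ⟨k, -⟩)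
    · exact hPt x k
    · exact (k.2 ⟨hx, k.1⟩).elim

theorem theoremA {Y Y' : Set (ℕ → T)} [Nonempty T] (u1 : Uni Y Y') (u2 : Uni Y' Y)
    (S S' : ℕ → Set (ℕ → T)) (hY : Y ⊆ ⋃ n, S n) (hY' : Y' ⊆ ⋃ n, S' n)
    (hS : ∀ n, IsClosed (S n)) (hS' : ∀ n, IsClosed (S' n))
    (hSi : ∀ n, interior (S n) = ∅) (hSi' : ∀ n, interior (S' n) = ∅) :
    ∃ f : (ℕ → T) ≃ₜ (ℕ → T), ∀ x, x ∈ Y ↔ f x ∈ Y' := by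
  have aux : ∀ S : Set (ℕ → T), interior S = ∅ → ∀ p ∈ S, ∀ N, ∃ x, x ∉ S ∧ Ag N x p := by
    intro S hS p hp N
    by_contra! hc
    have : S ∈ 𝓝 p := mem_nhds_Ag.2 ⟨N, fun y hy => by_contra fun k => hc y k hy.symm⟩
    have := mem_interior_iff_mem_nhds.2 this
    rw [hS] at this
    exact this
  exact back_forth S S' hY hY' (shrink Y Y') (shrink Y' Y)
    (fun U U' n => absorb u1 (hS n) (aux _ (hSi n)) U U')
    (fun U U' n => absorb u2 (hS' n) (aux _ (hSi' n)) U U')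

end local_lemmas
end DHA

namespace DHA

section lemD
variable {T : Type u}

theorem lemmaD (hT : Finite T ∨ Uncountable T) (Z : Set (ℕ → T)) (hZ : Z.Nonempty)
    (h : ∀ c ∈ Z, ∀ N : ℕ, ∃ f : T → (ℕ → T), (∀ t, f t ∈ Z ∧ Ag N c (f t)) ∧
      ∀ t, ∃ n, ∀ t', Ag n (f t) (f t') → t = t') :
    ∃ (w : T → (ℕ → T)) (ν : T → ℕ), (∀ t, w t ∈ Z) ∧
      ∀ x, ∃ n, ∀ t t' y y', Ag n x y → Ag (ν t) (w t) y → Ag n x y' → Ag (ν t') (w t') y' →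
        t = t' := by
  classical
  by_cases hA : ∃ (f : T → (ℕ → T)) (n : ℕ), (∀ t, f t ∈ Z) ∧ ∀ t t', Ag n (f t) (f t') → t = t'
  · obtain ⟨f, n, f1, f2⟩ := hA
    refine ⟨f, fun _ => n, f1, fun x => ⟨n, fun t t' y y' h1 h2 h3 h4 => f2 t t' ?_⟩⟩
    exact h2.trans (h1.symm.trans (h3.trans h4.symm))
  obtain ⟨c0, hc0⟩ := hZ
  rcases hT with hT | hT
  · exfalso
    obtain ⟨f, f1, f2⟩ := h c0 hc0 0
    choose nn hnn using f2
    have := Fintype.ofFinite T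
    refine hA ⟨f, Finset.univ.sup nn, fun t => (f1 t).1, fun t t' k => hnn t t' (k.mono ?_)⟩
    exact Finset.le_sup (Finset.mem_univ t)
  choose! f hf1 nn hnn using h
  let Tf : (ℕ → T) → ℕ → ℕ → Type u := fun c N j => {t : T // nn c N t = j}
  have small : ∀ c ∈ Z, ∀ N j, Cardinal.mk (Tf c N j) < Cardinal.mk T := by
    intro c hc N j
    by_contra! hge
    obtain ⟨g⟩ := hge
    refine hA ⟨fun t => f c N (g t).1, j, fun t => (hf1 c hc N _).1, fun t t' k => ?_⟩
    have := hnn c hc N (g t).1 (g t').1 (by rw [(g t).2]; exact k)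
    exact g.injective (Subtype.ext this)
  have total : ∀ c N, Cardinal.mk T = Cardinal.mk (Σ j, Tf c N j) := fun c N =>
    Cardinal.mk_congr (Equiv.sigmaFiberEquiv (nn c N)).symm
  have hω : Cardinal.aleph0 < Cardinal.mk T := by
    rw [Cardinal.aleph0_lt_mk_iff]; exact hT
  have big : ∀ c ∈ Z, ∀ N, ∀ κ < Cardinal.mk T, ∃ n, κ ≤ Cardinal.mk (Tf c N n) := by
    intro c hc N κ hκ
    by_contra! hlt
    have h1 : Cardinal.mk T ≤ max Cardinal.aleph0 κ := by
      rw [total c N, Cardinal.mk_sigma]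
      have : Cardinal.sum (fun j => Cardinal.mk (Tf c N j)) ≤ Cardinal.sum (fun _ : ℕ => κ) :=
        Cardinal.sum_le_sum _ _ fun j => (hlt j).le
      refine this.trans ?_
      rw [Cardinal.sum_const]
      simp only [Cardinal.mk_nat, Cardinal.lift_aleph0, Cardinal.lift_uzero]
      refine (Cardinal.mul_le_max _ _).trans ?_
      simp
    exact absurd (max_lt hω hκ) (not_lt.2 h1)
  have hM : ∃ M, Infinite (Tf c0 0 M) := by
    by_contra! hfin
    have : Countable (Σ j, Tf c0 0 j) := by
      have : ∀ j, Finite (Tf c0 0 j) := fun j => by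
        have := hfin j
        infer_instance
      infer_instance
    have h2 : Countable T := (Equiv.sigmaFiberEquiv (nn c0 0)).symm.injective.countable
    exact not_countable h2
  obtain ⟨M, hM⟩ := hM
  let ι := Infinite.natEmbedding (Tf c0 0 M)
  let c : ℕ → (ℕ → T) := fun j => f c0 0 (ι j).1
  have hc : ∀ j, c j ∈ Z := fun j => (hf1 c0 hc0 0 _).1
  have hcsep : ∀ i j, Ag M (c i) (c j) → i = j := by
    intro i j k
    have := hnn c0 hc0 0 (ι i).1 (ι j).1 (by rw [(ι i).2]; exact k)
    exact ι.injective (Subtype.ext this)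
  have hb : ∀ j, ∃ n, Cardinal.mk (Tf c0 0 j) ≤ Cardinal.mk (Tf (c j) M n) := fun j =>
    big (c j) (hc j) M _ (small c0 hc0 0 j)
  choose lv hlv using hb
  have emb : ∀ j, Nonempty (Tf c0 0 j ↪ Tf (c j) M (lv j)) := fun j => hlv j
  let em := fun j => (emb j).some
  let J : T → ℕ := fun t => nn c0 0 t
  let w : T → (ℕ → T) := fun t => f (c (J t)) M (em (J t) ⟨t, rfl⟩).1
  have hw : ∀ t t', J t = J t' → Ag (lv (J t)) (w t) (w t') → t = t' := by
    intro t t' hj k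
    have e1 : w t' = f (c (J t)) M (em (J t) ⟨t', hj.symm⟩).1 := by
      have : ∀ j (hj : J t' = j), w t' = f (c j) M (em j ⟨t', hj⟩).1 := by
        rintro _ rfl; rfl
      exact this _ hj.symm
    have := hnn (c (J t)) (hc _) M (em (J t) ⟨t, rfl⟩).1 (em (J t) ⟨t', hj.symm⟩).1 (by
      rw [(em (J t) ⟨t, rfl⟩).2, ← e1]; exact k)
    have := (em (J t)).injective (Subtype.ext this)
    exact congrArg Subtype.val this
  have hwM : ∀ t, Ag M (c (J t)) (w t) := fun t => (hf1 _ (hc _) M _).2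
  refine ⟨w, fun t => max (lv (J t)) M, fun t => (hf1 _ (hc _) M _).1, fun x => ?_⟩
  by_cases hx : ∃ j, Ag M x (c j)
  · obtain ⟨j, hj⟩ := hx
    refine ⟨max (lv j) M, fun t t' y y' h1 h2 h3 h4 => ?_⟩
    have key : ∀ t y, Ag (max (lv j) M) x y → Ag (max (lv (J t)) M) (w t) y → J t = j := by
      intro t y h1 h2
      refine hcsep _ _ ((hwM t).trans ((h2.mono (le_max_right _ _)).trans
        ((h1.mono (le_max_right _ _)).symm.trans hj)))
    have e1 := key t y h1 h2
    have e2 := key t' y' h3 h4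
    refine hw t t' (e1.trans e2.symm) ?_
    simp only [e1] at h2 ⊢
    simp only [e2] at h4
    exact (h2.trans (h1.symm.trans (h3.trans h4.symm))).mono (le_max_left _ _)
  · refine ⟨M, fun t t' y y' h1 h2 h3 h4 => (hx ⟨J t, ?_⟩).elim⟩
    exact h1.trans ((h2.mono (le_max_right _ _)).symm.trans (hwM t).symm)

end lemD

section flags
variable {T : Type u} [TopologicalSpace T] [DiscreteTopology T]

theorem exists_flags (F : ℕ → ℕ → Set (ℕ → T)) (hF : ∀ i j, IsClosed (F i j)) :
    ∃ a : (ℕ → T) → ℕ → ℕ → Prop, (∀ x x' n, Ag n x x' → a x n = a x' n) ∧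
      ∀ x i, (∀ᶠ n in atTop, ¬ a x n i) ↔ ∃ j, x ∈ F i j := by
  classical
  let P : ℕ → (ℕ → T) → ℕ → ℕ → Prop := fun i x n j => n < j ∨ ∃ y ∈ F i j, Ag n x y
  have hP : ∀ i x n, ∃ j, P i x n j := fun i x n => ⟨n + 1, Or.inl (Nat.lt_succ_self n)⟩
  let c : ℕ → (ℕ → T) → ℕ → ℕ := fun i x n => Nat.find (hP i x n)
  have hPag : ∀ i x x' n j, Ag n x x' → P i x n j → P i x' n j := by
    rintro i x x' n j h (k | ⟨y, hy, k⟩)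
    · exact Or.inl k
    · exact Or.inr ⟨y, hy, h.symm.trans k⟩
  have hcag : ∀ i x x' n, Ag n x x' → c i x n = c i x' n := by
    intro i x x' n h
    apply le_antisymm
    · exact Nat.find_min' _ (hPag i x' x n _ h.symm (Nat.find_spec (hP i x' n)))
    · exact Nat.find_min' _ (hPag i x x' n _ h (Nat.find_spec (hP i x n)))
  have hPm : ∀ i x n m j, n ≤ m → P i x m j → P i x n j := by
    rintro i x n m j h (k | ⟨y, hy, k⟩)
    · exact Or.inl (by omega)
    · exact Or.inr ⟨y, hy, k.mono h⟩
  have hcm : ∀ i x, Monotone (c i x) := fun i x n m h =>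
    Nat.find_min' _ (hPm i x n m _ h (Nat.find_spec (hP i x m)))
  refine ⟨fun x n i => c i x n ≠ c i x (n - 1), ?_, ?_⟩
  · intro x x' n h
    funext i
    show (c i x n ≠ c i x (n - 1)) = (c i x' n ≠ c i x' (n - 1))
    rw [hcag i x x' n h, hcag i x x' (n - 1) (h.mono (Nat.sub_le _ _))]
  · intro x i
    simp only [ne_eq, not_not]
    constructor
    · intro hev
      obtain ⟨n0, hn0⟩ := eventually_atTop.1 hev
      have hconst : ∀ k, c i x (n0 + k) = c i x n0 := by
        intro k
        induction k with
        | zero => rfl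
        | succ k ih =>
          have := hn0 (n0 + (k + 1)) (by omega)
          rw [this, show n0 + (k + 1) - 1 = n0 + k by omega, ih]
      refine ⟨c i x n0, ?_⟩
      by_contra hx
      obtain ⟨n, hn⟩ := isClosed_Ag.1 (hF i (c i x n0)) x hx
      have h1 : P i x (n0 + (max n (c i x n0))) (c i x n0) := by
        have h0 : P i x (n0 + (max n (c i x n0))) (c i x (n0 + (max n (c i x n0)))) :=
          Nat.find_spec (hP i x _)
        rwa [hconst] at h0
      rcases h1 with h1 | ⟨y, hy, h1⟩
      · omega
      · exact hn y (h1.mono (by omega)) hy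
    · rintro ⟨j, hj⟩
      have hb : ∀ n, c i x n ≤ j := fun n => Nat.find_min' _ (Or.inr ⟨x, hj, Ag.refl _ _⟩)
      have hbd : BddAbove (range (c i x)) := ⟨j, by rintro _ ⟨n, rfl⟩; exact hb n⟩
      obtain ⟨n0, hn0⟩ : ∃ n0, c i x n0 = sSup (range (c i x)) :=
        Nat.sSup_mem (range_nonempty _) hbd
      have hmax : ∀ n, c i x n ≤ c i x n0 := fun n => by
        rw [hn0]; exact le_csSup hbd ⟨n, rfl⟩
      refine eventually_atTop.2 ⟨n0 + 1, fun n hn => ?_⟩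
      have a1 := hmax n
      have a2 := hmax (n - 1)
      have a3 := hcm i x (show n0 ≤ n by omega)
      have a4 := hcm i x (show n0 ≤ n - 1 by omega)
      omega

theorem closed_emb {ψ : (ℕ → T) → (ℕ → T)} (hc : Continuous ψ)
    (hd : ∀ c n, ∃ m, ∀ x x', Ag m c (ψ x) → Ag m c (ψ x') → Ag n x x') :
    IsClosedEmbedding ψ := by
  have hinj : Function.Injective ψ := by
    intro x x' h
    refine eq_of_Ag fun n => ?_
    obtain ⟨m, hm⟩ := hd (ψ x) n
    exact hm x x' (Ag.refl _ _) (by rw [h]; exact Ag.refl _ _)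
  refine IsClosedEmbedding.of_continuous_injective_isClosedMap hc hinj fun F hF => ?_
  rw [isClosed_Ag]
  intro c hcF
  by_contra! hcon
  choose y hy1 hy2 using hcon
  choose ξ hξF hξ using hy2
  choose μ hμ using hd c
  let x : ℕ → T := fun i => ξ (μ (i + 1)) i
  have hξ' : ∀ k, Ag k c (ψ (ξ k)) := fun k => by rw [hξ]; exact hy1 k
  have hx : ∀ n k, (∀ i < n, μ (i + 1) ≤ k) → Ag n x (ξ k) := by
    intro n k hk i hi
    exact hμ (i + 1) _ _ (hξ' _) ((hξ' k).mono (hk i hi)) i (Nat.lt_succ_self i)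
  have hbd : ∀ n, ∃ k0, ∀ k ≥ k0, ∀ i < n, μ (i + 1) ≤ k := fun n =>
    ⟨(Finset.range n).sup fun i => μ (i + 1), fun k hk i hi =>
      (Finset.le_sup (f := fun i => μ (i + 1)) (Finset.mem_range.2 hi)).trans hk⟩
  have hxF : x ∈ F := by
    by_contra hx'
    obtain ⟨n, hn⟩ := isClosed_Ag.1 hF x hx'
    obtain ⟨k0, hk0⟩ := hbd n
    exact hn _ (hx n k0 (hk0 k0 le_rfl)) (hξF k0)
  refine hcF ⟨x, hxF, eq_of_Ag fun n => ?_⟩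
  obtain ⟨m, hm⟩ := continuous_Ag.1 hc x n
  obtain ⟨k0, hk0⟩ := hbd m
  have := hm _ (hx m (max k0 n) (hk0 _ (le_max_left _ _)))
  exact this.trans ((hξ' (max k0 n)).symm.mono (le_max_right _ _))

end flags
end DHA

namespace DHA

section box
variable {D : Type v}

/-- agreement on the `N`-square -/
def Bx (N : ℕ) (e z : ℕ → ℕ → D) : Prop := ∀ i < N, ∀ j < N, e i j = z i j

theorem Bx.refl (N : ℕ) (e : ℕ → ℕ → D) : Bx N e e := fun _ _ _ _ => rfl
theorem Bx.symm {N : ℕ} {e z : ℕ → ℕ → D} (h : Bx N e z) : Bx N z e :=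
  fun i hi j hj => (h i hi j hj).symm
theorem Bx.trans {N : ℕ} {e z w : ℕ → ℕ → D} (h : Bx N e z) (h' : Bx N z w) : Bx N e w :=
  fun i hi j hj => (h i hi j hj).trans (h' i hi j hj)
theorem Bx.mono {N M : ℕ} {e z : ℕ → ℕ → D} (h : Bx N e z) (hM : M ≤ N) : Bx M e z :=
  fun i hi j hj => h i (hi.trans_le hM) j (hj.trans_le hM)

/-- all rows are eventually equal to the base point -/
def Es (o : D) : Set (ℕ → ℕ → D) := {z | ∀ i, ∀ᶠ j in atTop, z i j = o}

/-- sequences eventually equal to the base point (as a discrete space) -/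
def Row (o : D) : Type v := {s : ℕ → D // ∀ᶠ j in atTop, s j = o}

instance (o : D) : TopologicalSpace (Row o) := ⊥
instance (o : D) : DiscreteTopology (Row o) := ⟨rfl⟩

end box

section H
variable {D : Type v} [TopologicalSpace D] [DiscreteTopology D]

theorem mem_nhds_Bx {e : ℕ → ℕ → D} {s : Set (ℕ → ℕ → D)} :
    s ∈ 𝓝 e ↔ ∃ N, ∀ z, Bx N e z → z ∈ s := by
  constructor
  · intro h
    rw [nhds_pi, Filter.mem_pi] at h
    obtain ⟨I, hI, t, ht, hs⟩ := h
    choose n hn using fun i => mem_nhds_Ag.1 (ht i)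
    refine ⟨hI.toFinset.sup fun i => max (n i) (i + 1), fun z hz => hs fun i hi => ?_⟩
    have hle : max (n i) (i + 1) ≤ hI.toFinset.sup fun i => max (n i) (i + 1) :=
      Finset.le_sup (f := fun i => max (n i) (i + 1)) (hI.mem_toFinset.2 hi)
    exact hn i _ fun j hj => hz i (by omega) j (by omega)
  · rintro ⟨N, hN⟩
    have : (⋂ i ∈ Finset.range N, ⋂ j ∈ Finset.range N, {z : ℕ → ℕ → D | e i j = z i j}) ∈ 𝓝 e := by
      rw [Filter.biInter_finset_mem]
      intro i _
      rw [Filter.biInter_finset_mem]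
      intro j _
      have hc : Continuous fun z : ℕ → ℕ → D => z i j := by fun_prop
      exact ((isOpen_discrete {d : D | e i j = d}).preimage hc).mem_nhds rfl
    refine mem_of_superset this fun z hz => hN z fun i hi j hj => ?_
    simp only [mem_iInter, Finset.mem_range] at hz
    exact hz i hi j hj

theorem dense_Es (o : D) : Dense (Es o) := by
  classical
  intro e
  rw [mem_closure_iff_nhds]
  intro s hs
  obtain ⟨N, hN⟩ := mem_nhds_Bx.1 hs
  refine ⟨fun i j => if j < N then e i j else o, hN _ fun i hi j hj => by simp [hj], fun i => ?_⟩
  exact eventually_atTop.2 ⟨N, fun j hj => by simp [not_lt.2 hj]⟩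

structure Iface (T : Type u) [TopologicalSpace T] [DiscreteTopology T] (o : D)
    (Y : Set (ℕ → T)) where
  GH : Set (ℕ → ℕ → D)
  K : ℕ → Set (ℕ → ℕ → D)
  L : ℕ → Set (ℕ → ℕ → D)
  Φ : (ℕ → ℕ → D) → (ℕ → T)
  Ψ : (ℕ → T) → (ℕ → ℕ → D)
  P : Set (ℕ → T)
  hG : IsGδ GH
  cΦ : ContinuousOn Φ GH
  mΦ : ∀ z ∈ GH, Φ z ∈ P
  cΨ : ContinuousOn Ψ P
  left : ∀ z ∈ GH, Ψ (Φ z) = z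
  mem : ∀ z ∈ GH, (Φ z ∈ Y ↔ z ∈ Es o)
  cov : ∀ z ∈ Es o, z ∉ GH → ∃ n, z ∈ K n
  KE : ∀ n, K n ⊆ Es o
  KG : ∀ n, IsGδ (K n)
  Lc : ∀ n, IsClosed (L n)
  KL : ∀ n, ∀ z ∈ Es o, (z ∈ K n ↔ z ∈ L n)
  loc : ∀ V : Set (ℕ → T), IsClopen V → V.Nonempty → ∃ B : Set (ℕ → ℕ → D), IsOpen B ∧
    (B ∩ Es o).Nonempty ∧ ∀ z ∈ B, z ∈ GH → Φ z ∈ V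

/-- rows below `m` from `e`, the rest from `y` -/
def spl (m : ℕ) (e y : ℕ → ℕ → D) : ℕ → ℕ → D := fun i => if i < m then e i else y i

theorem spl_cont (m : ℕ) (e : ℕ → ℕ → D) : Continuous (spl m e) := by
  refine continuous_pi fun i => ?_
  unfold spl
  by_cases h : i < m
  · simp only [h, if_true]; exact continuous_const
  · simp only [h, if_false]; exact continuous_apply i

theorem slice_not {o one : D} (hone : one ≠ o) {K : Set (ℕ → ℕ → D)} (hK : IsGδ K) (hKE : K ⊆ Es o)
    (m : ℕ) (e : ℕ → ℕ → D) (h : ∀ y ∈ Es o, spl m e y ∈ K) : False := by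
  classical
  have h1 : IsGδ (spl m e ⁻¹' K) := hK.preimage (spl_cont m e)
  have h2 : Dense (spl m e ⁻¹' K) := (dense_Es o).mono h
  let N : ℕ → Set (ℕ → ℕ → D) := fun k => {y | ∃ j, k ≤ j ∧ y m j ≠ o}
  have hNo : ∀ k, IsOpen (N k) := by
    intro k
    rw [isOpen_iff_mem_nhds]
    rintro y ⟨j, hj, hy⟩
    refine mem_nhds_Bx.2 ⟨max m j + 1, fun z hz => ⟨j, hj, ?_⟩⟩
    rw [← hz m (by omega) j (by omega)]; exact hy
  have hNd : ∀ k, Dense (N k) := by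
    intro k y
    rw [mem_closure_iff_nhds]
    intro s hs
    obtain ⟨M, hM⟩ := mem_nhds_Bx.1 hs
    refine ⟨fun i j => if j < M then y i j else one, hM _ fun i hi j hj => by simp [hj],
      max k M, le_max_left _ _, ?_⟩
    simp [hone]
  have h3 : Dense (⋂ k, N k) := dense_iInter_of_isOpen_nat hNo hNd
  have h4 : IsGδ (⋂ k, N k) := IsGδ.iInter_of_isOpen hNo
  obtain ⟨y, hy1, hy2⟩ := (h2.inter_of_Gδ h1 h4 h3).nonempty_iff.2 ⟨e⟩
  have h5 := hKE hy1 m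
  have : spl m e y m = y m := by simp [spl]
  rw [this] at h5
  obtain ⟨k, hk⟩ := eventually_atTop.1 h5
  obtain ⟨j, hj, hne⟩ := mem_iInter.1 hy2 k
  exact hne (hk j hj)

variable {T : Type u} [TopologicalSpace T] [DiscreteTopology T] {o : D} {Y : Set (ℕ → T)}

/-- extension into `Es ∩ GH` -/
theorem Iface.ext (I : Iface T o Y) {one : D} (hone : one ≠ o) (e : ℕ → ℕ → D) (he : e ∈ Es o)
    (m : ℕ) : ∃ e' ∈ Es o, e' ∈ I.GH ∧ ∀ i < m, e' i = e i := by
  classical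
  by_contra! hcon
  let q : (ℕ → Row o) → (ℕ → ℕ → D) := fun w i => (w i).1
  have hq : Continuous q := continuous_pi fun i =>
    (continuous_of_discreteTopology (f := fun s : Row o => s.1)).comp (continuous_apply i)
  have hqE : ∀ w, q w ∈ Es o := fun w i => (w i).2
  have hsE : ∀ m e y, e ∈ Es o → y ∈ Es o → spl m e y ∈ Es o := by
    intro m e y he hy i
    by_cases h : i < m
    · simpa [spl, h] using he i
    · simpa [spl, h] using hy i
  have hne : Nonempty (ℕ → Row o) := ⟨fun i => ⟨e i, he i⟩⟩
  have hcov : (⋃ n, (fun w => spl m e (q w)) ⁻¹' (I.L n)) = univ := by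
    refine eq_univ_of_forall fun w => ?_
    have h1 := hsE m e _ he (hqE w)
    have h2 : spl m e (q w) ∉ I.GH := fun h => by
      obtain ⟨i, hi, hne⟩ := hcon _ h1 h
      exact hne (by simp [spl, hi])
    obtain ⟨n, hn⟩ := I.cov _ h1 h2
    exact mem_iUnion.2 ⟨n, (I.KL n _ h1).1 hn⟩
  obtain ⟨n, w0, hw0⟩ := nonempty_interior_of_iUnion_of_closed
    (fun n => (I.Lc n).preimage ((spl_cont m e).comp hq)) hcov
  obtain ⟨m', hm'⟩ := mem_nhds_Ag.1 (mem_interior_iff_mem_nhds.1 hw0)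
  refine slice_not hone (I.KG n) (I.KE n) (max m m') (spl m e (q w0)) fun y hy => ?_
  have hE2 := hsE (max m m') _ y (hsE m e _ he (hqE w0)) hy
  rw [I.KL n _ hE2]
  let w : ℕ → Row o := fun i => if i < max m m' then w0 i else ⟨y i, hy i⟩
  have hw1 : ∀ i, i < max m m' → w i = w0 i := fun i hi => if_pos hi
  have hw2 : ∀ i, ¬ i < max m m' → w i = ⟨y i, hy i⟩ := fun i hi => if_neg hi
  have h1 : spl m e (q w) ∈ I.L n := hm' w fun i hi => (hw1 i (by omega)).symm
  have h2 : spl m e (q w) = spl (max m m') (spl m e (q w0)) y := by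
    funext i
    by_cases a : i < m
    · have b : i < max m m' := by omega
      simp only [spl, a, b, if_true]
    · by_cases b : i < max m m'
      · simp only [spl, a, b, if_true, if_false, q, hw1 i b]
      · simp only [spl, a, b, if_false, q, hw2 i b]
  rwa [← h2]

theorem Iface.modΦ (I : Iface T o Y) (z : ℕ → ℕ → D) (hz : z ∈ I.GH) (n : ℕ) :
    ∃ M, ∀ z' ∈ I.GH, Bx M z z' → Ag n (I.Φ z) (I.Φ z') := by
  have h := I.cΦ z hz (mem_nhds_Ag.2 ⟨n, fun y hy => hy⟩ : {y | Ag n (I.Φ z) y} ∈ 𝓝 (I.Φ z))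
  rw [mem_map, mem_nhdsWithin_iff_exists_mem_nhds_inter] at h
  obtain ⟨u, hu, hs⟩ := h
  obtain ⟨M, hM⟩ := mem_nhds_Bx.1 hu
  exact ⟨M, fun z' hz' hb => hs ⟨hM z' hb, hz'⟩⟩

theorem Iface.modΨ (I : Iface T o Y) (z : ℕ → ℕ → D) (hz : z ∈ I.GH) (n : ℕ) :
    ∃ M, ∀ z' ∈ I.GH, Ag M (I.Φ z) (I.Φ z') → Bx n z z' := by
  have h := I.cΨ (I.Φ z) (I.mΦ z hz) (mem_nhds_Bx.2 ⟨n, fun y hy => hy⟩ :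
    {y | Bx n (I.Ψ (I.Φ z)) y} ∈ 𝓝 (I.Ψ (I.Φ z)))
  rw [mem_map, mem_nhdsWithin_iff_exists_mem_nhds_inter] at h
  obtain ⟨u, hu, hs⟩ := h
  obtain ⟨M, hM⟩ := mem_nhds_Ag.1 hu
  refine ⟨M, fun z' hz' hb => ?_⟩
  have := hs ⟨hM _ hb, I.mΦ z' hz'⟩
  have this : Bx n (I.Ψ (I.Φ z)) (I.Ψ (I.Φ z')) := this
  rwa [I.left z hz, I.left z' hz'] at this

structure StepOut (I : Iface T o Y) (e : ℕ → ℕ → D) (N : ℕ) (a : ℕ → Prop)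
    (O : Set (ℕ → ℕ → D)) (w : T → (ℕ → ℕ → D)) (M : T → ℕ) : Prop where
  s1 : ∀ t, w t ∈ Es o ∧ w t ∈ I.GH
  s2 : ∀ t, N < M t
  s3 : ∀ t, Bx N e (w t)
  s4 : ∀ t, ∀ i < N, ¬ a i → w t i = e i
  s5 : ∀ t, ∀ i < N, a i → w t i N ≠ o
  s6 : ∀ t z, Bx (M t) (w t) z → z ∈ O
  s8 : ∀ c, ∃ n, ∀ t t', ∀ z ∈ I.GH, ∀ z' ∈ I.GH, Bx (M t) (w t) z → Bx (M t') (w t') z' →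
    Ag n c (I.Φ z) → Ag n c (I.Φ z') → t = t'

theorem Iface.step (I : Iface T o Y) (hT : Finite T ∨ Uncountable T) {one : D} (hone : one ≠ o)
    (ι : T → D) (hι : Function.Injective ι) (e : ℕ → ℕ → D) (he : e ∈ Es o)
    (N : ℕ) (a : ℕ → Prop) (O : Set (ℕ → ℕ → D)) (hO : IsOpen O) (hGO : I.GH ⊆ O) :
    ∃ w M, StepOut I e N a O w M := by
  classical
  let e' : ℕ → ℕ → D := fun i j => if i < N ∧ a i ∧ j = N then one else e i j
  have he' : e' ∈ Es o := fun i => by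
    filter_upwards [he i, eventually_gt_atTop N] with j h1 h2
    simp only [e']
    rw [if_neg (by omega), h1]
  let Zs : Set (ℕ → ℕ → D) := {z | z ∈ Es o ∧ z ∈ I.GH ∧ ∀ i < N + 1, z i = e' i}
  have hD := lemmaD hT (I.Φ '' Zs) (by
    obtain ⟨z, h1, h2, h3⟩ := I.ext hone e' he' (N + 1)
    exact ⟨_, z, ⟨h1, h2, h3⟩, rfl⟩) (by
    rintro _ ⟨z, ⟨z1, z2, z3⟩, rfl⟩ n
    obtain ⟨M, hM⟩ := I.modΦ z z2 n
    let m := max (N + 1) M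
    have hext : ∀ t, ∃ f ∈ Es o, f ∈ I.GH ∧ ∀ i < m + 1,
        f i = Function.update z m (fun j => if j = 0 then ι t else o) i := by
      intro t
      refine I.ext hone _ (fun i => ?_) (m + 1)
      by_cases hi : i = m
      · subst hi
        filter_upwards [eventually_gt_atTop 0] with j hj
        simp [hj.ne']
      · simpa [Function.update_of_ne hi] using z1 i
    choose f f1 f2 f3 using hext
    have f4 : ∀ t, ∀ i < m, f t i = z i := fun t i hi => by
      rw [f3 t i (by omega), Function.update_of_ne (by omega)]
    have f5 : ∀ t, f t m 0 = ι t := fun t => by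
      rw [f3 t m (by omega)]; simp
    refine ⟨fun t => I.Φ (f t), fun t => ⟨⟨f t, ⟨f1 t, f2 t, fun i hi => ?_⟩, rfl⟩, ?_⟩, fun t => ?_⟩
    · rw [f4 t i (lt_of_lt_of_le hi (le_max_left _ _)), z3 i hi]
    · refine hM _ (f2 t) fun i hi j hj => ?_
      rw [f4 t i (lt_of_lt_of_le hi (le_max_right _ _))]
    · obtain ⟨k, hk⟩ := I.modΨ (f t) (f2 t) (m + 1)
      refine ⟨k, fun t' h => hι ?_⟩
      have := hk (f t') (f2 t') h m (by omega) 0 (by omega)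
      rwa [f5, f5] at this)
  obtain ⟨v, ν, hv, hdis⟩ := hD
  choose w hw hwv using hv
  have hM : ∀ t, ∃ M, N < M ∧ (∀ z, Bx M (w t) z → z ∈ O) ∧
      ∀ z ∈ I.GH, Bx M (w t) z → Ag (ν t) (I.Φ (w t)) (I.Φ z) := by
    intro t
    obtain ⟨M1, hM1⟩ := mem_nhds_Bx.1 (hO.mem_nhds (hGO (hw t).2.1))
    obtain ⟨M2, hM2⟩ := I.modΦ (w t) (hw t).2.1 (ν t)
    refine ⟨max (N + 1) (max M1 M2), by omega, fun z hz => hM1 z (hz.mono (by omega)),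
      fun z hz hb => hM2 z hz (hb.mono (by omega))⟩
  choose M hM1 hM2 hM3 using hM
  refine ⟨w, M, fun t => ⟨(hw t).1, (hw t).2.1⟩, hM1, ?_, ?_, ?_, hM2, ?_⟩
  · intro t i hi j hj
    rw [(hw t).2.2 i (by omega)]
    simp only [e']
    rw [if_neg (by omega)]
  · intro t i hi ha
    rw [(hw t).2.2 i (by omega)]
    funext j
    simp [e', ha]
  · intro t i hi ha
    rw [(hw t).2.2 i (by omega)]
    simp [e', ha, hi, hone]
  · intro c
    obtain ⟨n, hn⟩ := hdis c
    refine ⟨n, fun t t' z hz z' hz' b b' g g' => hn t t' _ _ g ?_ g' ?_⟩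
    · rw [← hwv t]; exact hM3 t z hz b
    · rw [← hwv t']; exact hM3 t' z' hz' b'

theorem Iface.uni (I : Iface T o Y) (hT : Finite T ∨ Uncountable T) {one : D} (hone : one ≠ o)
    (ι : T → D) (hι : Function.Injective ι) (F : ℕ → ℕ → Set (ℕ → T))
    (hF : ∀ i j, IsClosed (F i j)) : Uni (⋂ i, ⋃ j, F i j) Y := by
  classical
  intro V hV hVn
  obtain ⟨B, hB, ⟨eB, heB, heB'⟩, hBV⟩ := I.loc V hV hVn
  obtain ⟨N0, hN0⟩ := mem_nhds_Bx.1 (hB.mem_nhds heB)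
  obtain ⟨e0, he0, he0G, he0eq⟩ := I.ext hone eB heB' N0
  obtain ⟨O, hO, hGO⟩ := I.hG.eq_iInter_nat
  obtain ⟨a, ha, haF⟩ := exists_flags F hF
  let St := {p : (ℕ → ℕ → D) × ℕ // p.1 ∈ Es o}
  have hstep := fun (s : St) (b : ℕ → Prop) (n : ℕ) =>
    I.step hT hone ι hι s.1.1 s.2 s.1.2 b (O n) (hO n)
      (by rw [hGO]; exact iInter_subset _ n)
  choose w M hwM using hstep
  let next : St → (ℕ → Prop) → ℕ → T → St := fun s b n t =>
    ⟨(w s b n t, M s b n t), ((hwM s b n).s1 t).1⟩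
  let st : (ℕ → T) → ℕ → St := fun x n => Nat.rec ⟨(e0, N0), he0⟩
    (fun n s => next s (a x n) n (x n)) n
  have st0 : ∀ x, st x 0 = ⟨(e0, N0), he0⟩ := fun x => rfl
  have sts : ∀ x n, st x (n + 1) = next (st x n) (a x n) n (x n) := fun x n => rfl
  have st_ag : ∀ n x x', Ag n x x' → st x n = st x' n := by
    intro n
    induction n with
    | zero => intro x x' _; rfl
    | succ n ih =>
      intro x x' h
      rw [sts, sts, ih x x' (h.mono (Nat.le_succ n)), ha x x' n (h.mono (Nat.le_succ n)),
        h n (Nat.lt_succ_self n)]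
  let E : (ℕ → T) → ℕ → (ℕ → ℕ → D) := fun x n => (st x n).1.1
  let N : (ℕ → T) → ℕ → ℕ := fun x n => (st x n).1.2
  have out : ∀ x n, StepOut I (E x n) (N x n) (a x n) (O n)
      (w (st x n) (a x n) n) (M (st x n) (a x n) n) := fun x n => hwM (st x n) (a x n) n
  have Es' : ∀ x n, E x (n + 1) = w (st x n) (a x n) n (x n) := fun x n => rfl
  have Ns' : ∀ x n, N x (n + 1) = M (st x n) (a x n) n (x n) := fun x n => rfl
  have Nmono : ∀ x, StrictMono (N x) := fun x => strictMono_nat_of_lt_succ fun n => by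
    rw [Ns']; exact (out x n).s2 _
  have Nle : ∀ x n, n ≤ N x n := fun x n => (Nmono x).le_apply
  have hEE : ∀ x n m, n ≤ m → Bx (N x n) (E x n) (E x m) := by
    intro x n m h
    induction m, h using Nat.le_induction with
    | base => exact Bx.refl _ _
    | succ m h ih =>
      refine ih.trans ?_
      have := (out x m).s3 (x m)
      rw [Es']
      exact this.mono ((Nmono x).monotone h)
  let z : (ℕ → T) → (ℕ → ℕ → D) := fun x i j => E x (max i j + 1) i j
  have hEz : ∀ x n, Bx (N x n) (E x n) (z x) := by
    intro x n i hi j hj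
    show E x n i j = E x (max i j + 1) i j
    rcases le_total n (max i j + 1) with h | h
    · exact hEE x n _ h i hi j hj
    · have := Nle x (max i j + 1)
      exact (hEE x _ n h i (by omega) j (by omega)).symm
  have hzG : ∀ x, z x ∈ I.GH := by
    intro x
    rw [hGO]
    refine mem_iInter.2 fun n => (out x n).s6 (x n) _ ?_
    exact hEz x (n + 1)
  have hψc : Continuous fun x => I.Φ (z x) := by
    rw [continuous_Ag]
    intro x n
    obtain ⟨m, hm⟩ := I.modΦ (z x) (hzG x) n
    refine ⟨m, fun x' h => hm _ (hzG x') ?_⟩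
    have h1 := hEz x m
    have h2 := hEz x' m
    have hs := st_ag m x x' h
    have e1 : E x' m = E x m := by simp only [E, hs]
    have e2 : N x' m = N x m := by simp only [N, hs]
    rw [e1, e2] at h2
    exact (h1.symm.trans h2).mono (Nle x m)
  have hdag : ∀ c n, ∃ m, ∀ x x', Ag m c (I.Φ (z x)) → Ag m c (I.Φ (z x')) → Ag n x x' := by
    intro c n
    induction n with
    | zero => exact ⟨0, fun x x' _ _ i hi => by omega⟩
    | succ n ih =>
      obtain ⟨m, hm⟩ := ih
      by_cases hx : ∃ x1, Ag m c (I.Φ (z x1))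
      swap
      · exact ⟨m, fun x x' h _ => (hx ⟨x, h⟩).elim⟩
      obtain ⟨x1, hx1⟩ := hx
      obtain ⟨m', hm'⟩ := (out x1 n).s8 c
      refine ⟨max m m', fun x x' h h' => ?_⟩
      have key : ∀ x, Ag (max m m') c (I.Φ (z x)) →
          Bx (M (st x1 n) (a x1 n) n (x n)) (w (st x1 n) (a x1 n) n (x n)) (z x) := by
        intro x h
        have hag := hm x1 x hx1 (h.mono (le_max_left _ _))
        have := hEz x (n + 1)
        rwa [Es', Ns', ← st_ag n x1 x hag, ← ha x1 x n hag] at this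
      have heq := hm' (x n) (x' n) (z x) (hzG x) (z x') (hzG x') (key x h) (key x' h')
        (h.mono (le_max_right _ _)) (h'.mono (le_max_right _ _))
      have hag := hm x x' (h.mono (le_max_left _ _)) (h'.mono (le_max_left _ _))
      intro i hi
      rcases Nat.lt_succ_iff_lt_or_eq.1 hi with hi | rfl
      · exact hag i hi
      · exact heq
  have hzE : ∀ x, z x ∈ Es o ↔ x ∈ ⋂ i, ⋃ j, F i j := by
    intro x
    simp only [mem_iInter, mem_iUnion]
    refine forall_congr' fun i => ?_
    rw [← haF x i]
    constructor
    · intro h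
      obtain ⟨k, hk⟩ := eventually_atTop.1 h
      refine eventually_atTop.2 ⟨max k (i + 1), fun n hn hani => ?_⟩
      have hnN := Nle x n
      have h5 := (out x n).s5 (x n) i (by omega) hani
      have h6 := hEz x (n + 1) i (by have := Nle x (n + 1); omega) (N x n)
        (Nmono x (Nat.lt_succ_self n))
      rw [← Es', h6] at h5
      exact h5 (hk _ (by omega))
    · intro h
      obtain ⟨k, hk⟩ := eventually_atTop.1 h
      have hst : ∀ n, max k (i + 1) ≤ n → E x n i = E x (max k (i + 1)) i := by
        intro n hn
        induction n, hn using Nat.le_induction with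
        | base => rfl
        | succ n hn ih =>
          rw [← ih, Es']
          exact (out x n).s4 (x n) i (by have := Nle x n; omega) (hk n (by omega))
      have hE := (st x (max k (i + 1))).2 i
      filter_upwards [hE, eventually_ge_atTop (max k (i + 1))] with j hj hjk
      show E x (max i j + 1) i j = o
      rw [congrFun (hst (max i j + 1) (by omega)) j]
      exact hj
  refine ⟨fun x => I.Φ (z x), closed_emb hψc hdag, fun x => ?_, fun x => ?_⟩
  · refine hBV _ (hN0 _ ?_) (hzG x)
    have h1 : Bx N0 e0 (z x) := hEz x 0
    refine Bx.trans (fun i hi j _ => ?_) h1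
    rw [he0eq i hi]
  · rw [I.mem _ (hzG x), hzE]

end H
end DHA

namespace DHA

theorem lav2 {X : Type u} {Y : Type v} [TopologicalSpace X] [TopologicalSpace Y]
    [TopologicalSpace.IsCompletelyMetrizableSpace X]
    [TopologicalSpace.IsCompletelyMetrizableSpace Y] (P : Set X) (Q : Set Y) (hP : P.Nonempty)
    (f : P ≃ₜ Q) : ∃ h : GHomeo X Y, P ⊆ h.G ∧ Q ⊆ h.G' ∧ (∀ x ∈ h.G, (x ∈ P ↔ h.F x ∈ Q)) ∧
      ∀ y ∈ h.G', (y ∈ Q ↔ h.F' y ∈ P) := by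
  obtain ⟨h, h1, h2, h3, h4⟩ := lavrentiev P hP (fun a => (f a : Y))
    (IsEmbedding.subtypeVal.comp f.isEmbedding)
  have hr : range (fun a => (f a : Y)) = Q := by
    ext y
    constructor
    · rintro ⟨a, rfl⟩; exact (f a).2
    · intro hy; exact ⟨f.symm ⟨y, hy⟩, by simp⟩
  rw [hr] at h2
  have e1 : ∀ x ∈ P, h.F x ∈ Q := fun x hx => by rw [h3 ⟨x, hx⟩]; exact (f _).2
  have e2 : ∀ y ∈ Q, h.F' y ∈ P := fun y hy => by
    rw [← hr] at hy
    obtain ⟨a, rfl⟩ := hy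
    rw [h4 a]; exact a.2
  refine ⟨h, h1, h2, fun x hx => ⟨e1 x, fun k => ?_⟩, fun y hy => ⟨e2 y, fun k => ?_⟩⟩
  · rw [← h.left x hx]; exact e2 _ k
  · rw [← h.right y hy]; exact e1 _ k

section fin
variable {T : Type u} [TopologicalSpace T] [DiscreteTopology T]

/-- countable intersections of countable unions of closed sets -/
def Fsd {Z : Type v} [TopologicalSpace Z] (s : Set Z) : Prop :=
  ∃ F : ℕ → ℕ → Set Z, (∀ i j, IsClosed (F i j)) ∧ s = ⋂ i, ⋃ j, F i j

theorem open_fs {U : Set (ℕ → T)} (hU : IsOpen U) :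
    ∃ F : ℕ → Set (ℕ → T), (∀ n, IsClosed (F n)) ∧ U = ⋃ n, F n := by
  refine ⟨fun n => {x | ∀ y, Ag n x y → y ∈ U}, fun n => ?_, ?_⟩
  · rw [isClosed_Ag]
    intro x hx
    exact ⟨n, fun y hy hyn => hx fun z hz => hyn z (hy.symm.trans hz)⟩
  · ext x
    simp only [mem_iUnion]
    constructor
    · exact fun hx => isOpen_Ag.1 hU x hx
    · rintro ⟨n, hn⟩; exact hn x (Ag.refl _ _)

theorem fsd_pull {Z : Type v} [TopologicalSpace Z] (h : GHomeo (ℕ → T) Z) {P : Set (ℕ → T)}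
    {Q : Set Z} (hQ : Fsd Q) (hP : P ⊆ h.G) (hPQ : ∀ x ∈ h.G, (x ∈ P ↔ h.F x ∈ Q)) : Fsd P := by
  classical
  obtain ⟨F, hF, rfl⟩ := hQ
  choose w w1 w2 using fun i j => continuousOn_iff_isClosed.1 h.cF (F i j) (hF i j)
  have hw : ∀ i j, ∀ x ∈ h.G, (h.F x ∈ F i j ↔ x ∈ w i j) := fun i j x hx => by
    have := Set.ext_iff.1 (w2 i j) x
    simpa [hx] using this
  obtain ⟨O, hO, hGO⟩ := h.hG.eq_iInter_nat
  choose c c1 c2 using fun n => open_fs (hO n)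
  refine ⟨fun i j => if i % 2 = 0 then w (i / 2) j else c (i / 2) j, fun i j => ?_, ?_⟩
  · dsimp only
    split_ifs
    exacts [w1 _ _, c1 _ _]
  · have hG : ∀ x, x ∈ h.G ↔ ∀ n, ∃ j, x ∈ c n j := fun x => by
      rw [hGO, mem_iInter]
      exact forall_congr' fun n => by rw [c2 n, mem_iUnion]
    ext x
    have hx2 : x ∈ P ↔ x ∈ h.G ∧ ∀ i, ∃ j, x ∈ w i j := by
      constructor
      · intro hx
        have hxG := hP hx
        refine ⟨hxG, fun i => ?_⟩
        obtain ⟨j, hj⟩ := mem_iUnion.1 (mem_iInter.1 ((hPQ x hxG).1 hx) i)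
        exact ⟨j, (hw i j x hxG).1 hj⟩
      · rintro ⟨hxG, hx⟩
        refine (hPQ x hxG).2 (mem_iInter.2 fun i => mem_iUnion.2 ?_)
        exact (hx i).imp fun j hj => (hw i j x hxG).2 hj
    rw [hx2, hG]
    simp only [mem_iInter, mem_iUnion]
    constructor
    · rintro ⟨a, b⟩ i
      by_cases hi : i % 2 = 0
      · simpa [hi] using b (i / 2)
      · simpa [hi] using a (i / 2)
    · intro k
      constructor
      · intro n
        have := k (2 * n + 1)
        simpa [show (2 * n + 1) % 2 = 1 by omega, show (2 * n + 1) / 2 = n by omega] using this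
      · intro n
        have := k (2 * n)
        simpa using this

theorem fsd_pull_compl {Z : Type v} [TopologicalSpace Z] (h : GHomeo (ℕ → T) Z) {P : Set (ℕ → T)}
    {Q : Set Z} (hQ : Fsd Qᶜ) (hP : P ⊆ h.G) (hPQ : ∀ x ∈ h.G, (x ∈ P ↔ h.F x ∈ Q)) :
    Fsd Pᶜ := by
  classical
  obtain ⟨F, hF, hQF⟩ := hQ
  choose w w1 w2 using fun i j => continuousOn_iff_isClosed.1 h.cF (F i j) (hF i j)
  have hw : ∀ i j, ∀ x ∈ h.G, (h.F x ∈ F i j ↔ x ∈ w i j) := fun i j x hx => by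
    have := Set.ext_iff.1 (w2 i j) x
    simpa [hx] using this
  obtain ⟨O, hO, hGO⟩ := h.hG.eq_iInter_nat
  refine ⟨fun i j => if j % 2 = 0 then w i (j / 2) else (O (j / 2))ᶜ, fun i j => ?_, ?_⟩
  · dsimp only
    split_ifs
    exacts [w1 _ _, (hO _).isClosed_compl]
  · have hG : ∀ x, x ∉ h.G ↔ ∃ n, x ∉ O n := fun x => by
      rw [hGO, mem_iInter, not_forall]
    ext x
    simp only [mem_iInter, mem_iUnion]
    by_cases hxG : x ∈ h.G
    · have hxO : ∀ n, x ∈ O n := by rw [hGO] at hxG; exact mem_iInter.1 hxG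
      have : x ∈ Pᶜ ↔ h.F x ∈ Qᶜ := not_congr (hPQ x hxG)
      rw [this, hQF]
      simp only [mem_iInter, mem_iUnion]
      refine forall_congr' fun i => ?_
      constructor
      · rintro ⟨j, hj⟩
        refine ⟨2 * j, ?_⟩
        simpa using (hw i j x hxG).1 hj
      · rintro ⟨j, hj⟩
        by_cases hj2 : j % 2 = 0
        · simp only [hj2, if_true] at hj
          exact ⟨_, (hw i _ x hxG).2 hj⟩
        · simp only [hj2, if_false] at hj
          exact (hj (hxO _)).elim
    · obtain ⟨n, hn⟩ := (hG x).1 hxG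
      refine iff_of_true (fun k => hxG (hP k)) fun i => ⟨2 * n + 1, ?_⟩
      simpa [show (2 * n + 1) % 2 = 1 by omega, show (2 * n + 1) / 2 = n by omega] using hn

variable {D : Type v} [TopologicalSpace D] [DiscreteTopology D]

theorem closed_tail (o : D) (i k : ℕ) : IsClosed {z : ℕ → ℕ → D | ∀ j, k ≤ j → z i j = o} := by
  simp only [setOf_forall]
  refine isClosed_iInter fun j => isClosed_iInter fun _ => ?_
  have hc : Continuous fun z : ℕ → ℕ → D => z i j := by fun_prop
  exact isClosed_eq hc continuous_const

theorem fsd_Es (o : D) : Fsd (Es o) := by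
  refine ⟨fun i k => {z | ∀ j, k ≤ j → z i j = o}, fun i k => closed_tail o i k, ?_⟩
  ext z
  simp only [mem_iInter, mem_iUnion]
  exact forall_congr' fun i => eventually_atTop

theorem main_data [Nonempty T] {o one : D} (hone : one ≠ o) {A X : Set (ℕ → T)} (hA : Dense A)
    (hX : Dense X) (fA : A ≃ₜ Es o) (fX : X ≃ₜ (Aᶜ : Set (ℕ → T))) :
    Nonempty (Iface T o Xᶜ) ∧ Fsd Xᶜ ∧ ∃ S : ℕ → Set (ℕ → T), Xᶜ ⊆ (⋃ n, S n) ∧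
      (∀ n, IsClosed (S n)) ∧ ∀ n, interior (S n) = ∅ := by
  classical
  obtain ⟨α, a1, a2, a3, a4⟩ := lav2 A (Es o) hA.nonempty fA
  obtain ⟨β, b1, b2, b3, b4⟩ := lav2 X Aᶜ hX.nonempty fX
  refine ⟨?_, ?_, ?_⟩
  · obtain ⟨O, hO, hGO⟩ := β.hG'.eq_iInter_nat
    have hOA : ∀ n x, x ∉ O n → x ∈ A := fun n x hx => by
      by_contra hxA
      have := b2 hxA
      rw [hGO] at this
      exact hx (mem_iInter.1 this n)
    choose L L1 L2 using fun n => continuousOn_iff_isClosed.1 α.cF' (O n)ᶜ (hO n).isClosed_compl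
    refine ⟨⟨α.G' ∩ α.F' ⁻¹' β.G', fun n => α.G' ∩ α.F' ⁻¹' (O n)ᶜ, L, fun z => β.F' (α.F' z),
      fun x => α.F (β.F x), β.G ∩ β.F ⁻¹' α.G, gdelta_preimage α.hG' α.cF' β.hG', ?_, ?_, ?_, ?_,
      ?_, ?_, ?_, ?_, L1, ?_, ?_⟩⟩
    · exact β.cF'.comp (α.cF'.mono inter_subset_left) fun z hz => hz.2
    · rintro z ⟨z1, z2⟩
      refine ⟨β.mF' _ z2, ?_⟩
      show β.F (β.F' (α.F' z)) ∈ α.G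
      rw [β.right _ z2]; exact α.mF' _ z1
    · exact α.cF.comp (β.cF.mono inter_subset_left) fun z hz => hz.2
    · rintro z ⟨z1, z2⟩
      show α.F (β.F (β.F' (α.F' z))) = z
      rw [β.right _ z2, α.right _ z1]
    · rintro z ⟨z1, z2⟩
      show ¬ (β.F' (α.F' z) ∈ X) ↔ _
      rw [← b4 _ z2, a4 _ z1]
      simp
    · intro z hz hzG
      have hz' := a2 hz
      have : α.F' z ∉ β.G' := fun k => hzG ⟨hz', k⟩
      rw [hGO, mem_iInter, not_forall] at this
      exact this.imp fun n hn => ⟨hz', hn⟩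
    · rintro n z ⟨z1, z2⟩
      exact (a4 z z1).2 (hOA n _ z2)
    · intro n
      exact gdelta_preimage α.hG' α.cF' (IsClosed.isGδ (hO n).isClosed_compl)
    · intro n z hz
      have := Set.ext_iff.1 (L2 n) z
      have hz' := a2 hz
      simpa [hz'] using this
    · intro V hV hVn
      obtain ⟨x, hxV, hxX⟩ := hX.inter_open_nonempty V hV.isOpen hVn
      obtain ⟨W, W1, W2⟩ := continuousOn_iff'.1 β.cF' V hV.isOpen
      have hxG := b1 hxX
      have hxW : β.F x ∈ W := by
        have := Set.ext_iff.1 W2 (β.F x)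
        exact (this.1 ⟨by show β.F' (β.F x) ∈ V; rwa [β.left x hxG], β.mF x hxG⟩).1
      obtain ⟨a, haW, haA⟩ := hA.inter_open_nonempty W W1 ⟨_, hxW⟩
      obtain ⟨B, B1, B2⟩ := continuousOn_iff'.1 α.cF' W W1
      have haG := a1 haA
      refine ⟨B, B1, ⟨α.F a, ?_, (a3 a haG).1 haA⟩, ?_⟩
      · have := Set.ext_iff.1 B2 (α.F a)
        exact (this.1 ⟨by show α.F' (α.F a) ∈ W; rwa [α.left a haG], α.mF a haG⟩).1
      · rintro z hzB ⟨z1, z2⟩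
        have h1 : α.F' z ∈ W := ((Set.ext_iff.1 B2 z).2 ⟨hzB, z1⟩).1
        exact ((Set.ext_iff.1 W2 (α.F' z)).2 ⟨h1, z2⟩).1
  · have hAF : Fsd A := fsd_pull α (fsd_Es o) a1 a3
    exact fsd_pull_compl β (by rwa [compl_compl]) b1 b3
  · choose w w1 w2 using fun n => continuousOn_iff_isClosed.1 α.cF _ (closed_tail o 0 n)
    have hw : ∀ n, ∀ x ∈ α.G, (x ∈ w n ↔ ∀ j, n ≤ j → α.F x 0 j = o) := fun n x hx => by
      have := Set.ext_iff.1 (w2 n) x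
      simpa [hx] using this.symm
    have hAw : ∀ x, (∀ n, x ∉ w n) → x ∉ A := by
      intro x hx hxA
      obtain ⟨n, hn⟩ := eventually_atTop.1 ((a3 x (a1 hxA)).1 hxA 0)
      exact hx n ((hw n x (a1 hxA)).2 hn)
    have hwi : ∀ n, interior (w n) = ∅ := by
      intro n
      by_contra hne
      obtain ⟨a, haW, haA⟩ := hA.inter_open_nonempty _ isOpen_interior
        (nonempty_iff_ne_empty.2 hne)
      obtain ⟨B, B1, B2⟩ := continuousOn_iff'.1 α.cF' _ (isOpen_interior (s := w n))
      have haG := a1 haA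
      have haB : α.F a ∈ B := by
        have := Set.ext_iff.1 B2 (α.F a)
        exact (this.1 ⟨by show α.F' (α.F a) ∈ interior (w n); rwa [α.left a haG], α.mF a haG⟩).1
      obtain ⟨N, hN⟩ := mem_nhds_Bx.1 (B1.mem_nhds haB)
      let z : ℕ → ℕ → D := fun i j => if j = max n N then one else α.F a i j
      have hzB : z ∈ B := hN z fun i hi j hj => by
        simp only [z]; rw [if_neg (by omega)]
      have hzE : z ∈ Es o := fun i => by
        filter_upwards [(a3 a haG).1 haA i, eventually_gt_atTop (max n N)] with j h1 h2
        simp only [z]; rw [if_neg (by omega), h1]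
      have hzG := a2 hzE
      have h1 : α.F' z ∈ w n := interior_subset ((Set.ext_iff.1 B2 z).2 ⟨hzB, hzG⟩).1
      have h2 := (hw n _ (α.mF' z hzG)).1 h1 (max n N) (le_max_left _ _)
      rw [α.right z hzG] at h2
      simp only [z, if_true] at h2
      exact hone h2
    have hdense : Dense (⋂ n, (w n)ᶜ) :=
      dense_iInter_of_isOpen_nat (fun n => (w1 n).isOpen_compl)
        (fun n => interior_eq_empty_iff_dense_compl.1 (hwi n))
    obtain ⟨O, hO, hGO⟩ := β.hG.eq_iInter_nat
    choose v v1 v2 using fun n => continuousOn_iff_isClosed.1 β.cF _ (w1 n)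
    have hv : ∀ n, ∀ x ∈ β.G, (x ∈ v n ↔ β.F x ∈ w n) := fun n x hx => by
      have := Set.ext_iff.1 (v2 n) x
      simpa [hx] using this.symm
    refine ⟨fun n => if n % 2 = 0 then (O (n / 2))ᶜ else v (n / 2), ?_, fun n => ?_, fun n => ?_⟩
    · intro x hx
      rw [mem_iUnion]
      by_cases hxG : x ∈ β.G
      · have h1 : β.F x ∈ A := by
          by_contra k
          exact hx ((b3 x hxG).2 k)
        have h2 : ∃ n, β.F x ∈ w n := by
          by_contra! k
          exact hAw _ k h1
        obtain ⟨n, hn⟩ := h2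
        refine ⟨2 * n + 1, ?_⟩
        simpa [show (2 * n + 1) % 2 = 1 by omega, show (2 * n + 1) / 2 = n by omega]
          using (hv n x hxG).2 hn
      · rw [hGO, mem_iInter, not_forall] at hxG
        obtain ⟨n, hn⟩ := hxG
        exact ⟨2 * n, by simpa using hn⟩
    · dsimp only
      split_ifs
      exacts [(hO _).isClosed_compl, v1 _]
    · dsimp only
      split_ifs
      · rw [interior_eq_empty_iff_dense_compl, compl_compl]
        refine hX.mono (b1.trans ?_)
        rw [hGO]; exact iInter_subset _ _
      · by_contra hne
        obtain ⟨x, hxW, hxX⟩ := hX.inter_open_nonempty _ isOpen_interior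
          (nonempty_iff_ne_empty.2 hne)
        obtain ⟨W, W1, W2⟩ := continuousOn_iff'.1 β.cF' _ (isOpen_interior (s := v (n / 2)))
        have hxG := b1 hxX
        have hxB : β.F x ∈ W := by
          have := Set.ext_iff.1 W2 (β.F x)
          exact (this.1 ⟨by show β.F' (β.F x) ∈ interior (v (n / 2)); rwa [β.left x hxG], β.mF x hxG⟩).1
        obtain ⟨y, hyW, hy⟩ := hdense.inter_open_nonempty W W1 ⟨_, hxB⟩
        have hyw : ∀ k, y ∉ w k := fun k => mem_iInter.1 hy k
        have hyG : y ∈ β.G' := b2 (hAw y hyw)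
        have h1 : β.F' y ∈ v (n / 2) := interior_subset ((Set.ext_iff.1 W2 y).2 ⟨hyW, hyG⟩).1
        have h2 := (hv _ _ (β.mF' y hyG)).1 h1
        rw [β.right y hyG] at h2
        exact hyw _ h2

theorem main_thm [Nonempty T] (hT : Finite T ∨ Uncountable T) {o one : D} (hone : one ≠ o)
    (ι : T → D) (hι : Function.Injective ι) {A₁ X₁ A₂ X₂ : Set (ℕ → T)} (hA₁ : Dense A₁)
    (hX₁ : Dense X₁) (fA₁ : A₁ ≃ₜ Es o) (fX₁ : X₁ ≃ₜ (A₁ᶜ : Set (ℕ → T))) (hA₂ : Dense A₂)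
    (hX₂ : Dense X₂) (fA₂ : A₂ ≃ₜ Es o) (fX₂ : X₂ ≃ₜ (A₂ᶜ : Set (ℕ → T))) :
    ∃ f : (ℕ → T) ≃ₜ (ℕ → T), f '' X₁ = X₂ := by
  obtain ⟨⟨I₁⟩, ⟨F₁, c₁, e₁⟩, S₁, s₁, t₁, r₁⟩ := main_data hone hA₁ hX₁ fA₁ fX₁
  obtain ⟨⟨I₂⟩, ⟨F₂, c₂, e₂⟩, S₂, s₂, t₂, r₂⟩ := main_data hone hA₂ hX₂ fA₂ fX₂
  have u1 : Uni X₁ᶜ X₂ᶜ := by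
    have := I₂.uni hT hone ι hι F₁ c₁
    rwa [← e₁] at this
  have u2 : Uni X₂ᶜ X₁ᶜ := by
    have := I₁.uni hT hone ι hι F₂ c₂
    rwa [← e₂] at this
  obtain ⟨f, hf⟩ := theoremA u1 u2 S₁ S₂ s₁ s₂ t₁ t₂ r₁ r₂
  refine ⟨f, ?_⟩
  ext y
  constructor
  · rintro ⟨x, hx, rfl⟩
    by_contra k
    exact (hf x).2 k hx
  · intro hy
    refine ⟨f.symm y, ?_, f.apply_symm_apply y⟩
    by_contra k
    have := (hf (f.symm y)).1 k
    rw [f.apply_symm_apply] at this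
    exact this hy

end fin
end DHA


namespace DHA

/-- `Q(k)^ω` as a subspace of the double product. -/
def qkHomeo (k : Cardinal.{u}) :
    QkOmega k ≃ₜ Es (D := QBase k) (Sum.inr PUnit.unit) where
  toFun w := ⟨fun i => (w i).1, fun i => (w i).2⟩
  invFun z := fun i => ⟨z.1 i, z.2 i⟩
  left_inv _ := rfl
  right_inv _ := rfl
  continuous_toFun := by
    refine Continuous.subtype_mk ?_ _
    refine continuous_pi fun i => ?_
    exact continuous_subtype_val.comp (continuous_apply (A := fun _ : ℕ => Qk k) i)
  continuous_invFun := by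
    refine continuous_pi (A := fun _ : ℕ => Qk k) fun i => ?_
    exact Continuous.subtype_mk ((continuous_apply i).comp continuous_subtype_val) _

theorem starT_facts (k : Cardinal.{u}) (hk : Cardinal.aleph0 ≤ k) :
    Nonempty (StarT k) ∧ (Finite (StarT k) ∨ Uncountable (StarT k)) ∧
      ∃ ι : StarT k → QBase k, Function.Injective ι := by
  have hD : Cardinal.mk (DiscT k) = k := Cardinal.mk_out k
  by_cases h : k = Cardinal.aleph0
  · have e : StarT k = ULift Bool := if_pos h
    rw [e]
    refine ⟨⟨⟨true⟩⟩, Or.inl inferInstance, ?_⟩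
    have hi : Infinite (DiscT k) := by
      rw [Cardinal.infinite_iff, hD]; exact hk
    let g := Infinite.natEmbedding (DiscT k)
    refine ⟨fun b => Sum.inl (g (if b.down then 1 else 0)), ?_⟩
    rintro ⟨a⟩ ⟨b⟩ hab
    have h1 := g.injective (Sum.inl_injective hab)
    revert h1
    cases a <;> cases b <;> simp
  · have e : StarT k = DiscT k := if_neg h
    rw [e]
    have hu : Uncountable (DiscT k) := by
      rw [← Cardinal.aleph0_lt_mk_iff, hD]
      exact lt_of_le_of_ne hk (Ne.symm h)
    exact ⟨inferInstance, Or.inr hu, Sum.inl, Sum.inl_injective⟩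

end DHA

/-- Theorem `t-dha2`: `B*(k)` is densely homogeneous with respect to
the space `A^{II}_k`. -/
theorem stmt_12 (k : Cardinal.{u}) (hk : Cardinal.aleph0 ≤ k)
    (X₁ X₂ : Set (BaireStar k)) (hd₁ : Dense X₁) (hd₂ : Dense X₂)
    (he₁ : IsAII k ↥X₁) (he₂ : IsAII k ↥X₂) :
    ∃ f : BaireStar k ≃ₜ BaireStar k, f '' X₁ = X₂ := by
  obtain ⟨A₁, hA₁, ⟨fA₁⟩, ⟨fX₁⟩⟩ := he₁
  obtain ⟨A₂, hA₂, ⟨fA₂⟩, ⟨fX₂⟩⟩ := he₂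
  obtain ⟨hne, hT, ι, hι⟩ := DHA.starT_facts k hk
  have hi : Nonempty (DiscT k) := by
    rw [← Cardinal.mk_ne_zero_iff, show Cardinal.mk (DiscT k) = k from Cardinal.mk_out k]
    exact (lt_of_lt_of_le Cardinal.aleph0_pos hk).ne'
  obtain ⟨d⟩ := hi
  have hone : @Ne (QBase k) (Sum.inl d) (Sum.inr PUnit.unit) := Sum.inl_ne_inr
  exact DHA.main_thm (T := StarT k) (D := QBase k) hT hone ι hι hA₁ hd₁
    (fA₁.trans (DHA.qkHomeo k)) fX₁ hA₂ hd₂ (fA₂.trans (DHA.qkHomeo k)) fX₂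
end

section
/- Let k be an infinite cardinal and let X be an F_σδ-subset of the space B*(k) such that X does not belong to σLW(<k) + 𝒢_δσ. Then there exists a closed subset M ⊆ B*(k) such that: M ∩ X is a nowhere dense closed subset of X; M ∩ X is homeomorphic to Q(k)^ω; M ∖ X is a nowhere dense closed subset of B*(k) ∖ X; M ∖ X is homeomorphic to A^{II}_k; and M is homeomorphic to B*(k). -/
open Topology Set Filter

universe u v

/-! ### Part 1: the ideal of small sets -/

section Ideal

variable {E : Type u} [TopologicalSpace E]

/-- The set `A` has a family of fewer than `k` open sets that is an outer base at its points. -/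
def OWeight (k : Cardinal.{u}) (A : Set E) : Prop :=
  ∃ B : Set (Set E), Cardinal.mk B < k ∧ (∀ b ∈ B, IsOpen b) ∧
    ∀ x ∈ A, ∀ U : Set E, IsOpen U → x ∈ U → ∃ b ∈ B, x ∈ b ∧ b ∩ A ⊆ U

lemma OWeight.mono {k : Cardinal.{u}} {A A' : Set E} (h : OWeight k A) (hA : A' ⊆ A) :
    OWeight k A' := by
  obtain ⟨B, hB, hBo, hBx⟩ := h
  refine ⟨B, hB, hBo, fun x hx U hU hxU => ?_⟩
  obtain ⟨b, hb, hxb, hbU⟩ := hBx x (hA hx) U hU hxU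
  exact ⟨b, hb, hxb, fun y hy => hbU ⟨hy.1, hA hy.2⟩⟩

lemma OWeight.weightLT {k : Cardinal.{u}} {A : Set E} (h : OWeight k A)
    {Z : Type u} [TopologicalSpace Z] (f : Z → E) (hf : IsInducing f) (hr : ∀ z, f z ∈ A) :
    WeightLT Z k := by
  obtain ⟨B, hB, hBo, hBx⟩ := h
  refine ⟨(fun b => f ⁻¹' b) '' B, ?_, Cardinal.mk_image_le.trans_lt hB⟩
  refine TopologicalSpace.isTopologicalBasis_of_isOpen_of_nhds ?_ ?_
  · rintro _ ⟨b, hb, rfl⟩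
    exact (hBo b hb).preimage hf.continuous
  · intro z U hz hU
    obtain ⟨V, hV, rfl⟩ := hf.isOpen_iff.1 hU
    obtain ⟨b, hb, hxb, hbU⟩ := hBx (f z) (hr z) V hV hz
    exact ⟨_, ⟨b, hb, rfl⟩, hxb, fun w hw => hbU ⟨hw, hr w⟩⟩

/-- Local version of `OWeight`. -/
def LocOWeight (k : Cardinal.{u}) (L : Set E) : Prop :=
  ∀ x ∈ L, ∃ U : Set E, IsOpen U ∧ x ∈ U ∧ OWeight k (U ∩ L)

/-- The σ-ideal of sets whose trace on `X` is covered by countably many `G_δ`-subsets of `X` and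
countably many sets locally of weight `< k`. -/
def Negl (k : Cardinal.{u}) (X : Set E) (Z : Set E) : Prop :=
  ∃ H L : ℕ → Set E, (∀ n, IsGδ (H n)) ∧ (∀ n, H n ⊆ X) ∧ (∀ n, LocOWeight k (L n)) ∧
    Z ∩ X ⊆ (⋃ n, H n) ∪ ⋃ n, L n

variable {k : Cardinal.{u}} {X : Set E}

lemma Negl.mono {Z Z' : Set E} (h : Negl k X Z) (hZ : Z' ∩ X ⊆ Z) : Negl k X Z' := by
  obtain ⟨H, L, h1, h2, h3, h4⟩ := h
  exact ⟨H, L, h1, h2, h3, fun x hx => h4 ⟨hZ hx, hx.2⟩⟩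

lemma negl_iUnion {Z : ℕ → Set E} (h : ∀ n, Negl k X (Z n)) : Negl k X (⋃ n, Z n) := by
  choose H L h1 h2 h3 h4 using h
  refine ⟨fun p => H p.unpair.1 p.unpair.2, fun p => L p.unpair.1 p.unpair.2,
    fun n => h1 _ _, fun n => h2 _ _, fun n => h3 _ _, ?_⟩
  rintro x ⟨hx, hxX⟩
  obtain ⟨n, hn⟩ := mem_iUnion.1 hx
  rcases h4 n ⟨hn, hxX⟩ with h | h
  · obtain ⟨m, hm⟩ := mem_iUnion.1 h
    exact Or.inl (mem_iUnion.2 ⟨Nat.pair n m, by simpa using hm⟩)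
  · obtain ⟨m, hm⟩ := mem_iUnion.1 h
    exact Or.inr (mem_iUnion.2 ⟨Nat.pair n m, by simpa using hm⟩)

lemma Negl.union {Z Z' : Set E} (h : Negl k X Z) (h' : Negl k X Z') : Negl k X (Z ∪ Z') := by
  refine (negl_iUnion (Z := fun n => if n = 0 then Z else Z') fun n => ?_).mono ?_
  · split_ifs
    exacts [h, h']
  · rintro x ⟨hx | hx, -⟩
    · exact mem_iUnion.2 ⟨0, by simpa using hx⟩
    · exact mem_iUnion.2 ⟨1, by simpa using hx⟩

lemma negl_of_isGδ {Z : Set E} (h : IsGδ Z) (hZ : Z ⊆ X) : Negl k X Z := by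
  refine ⟨fun _ => Z, fun _ => ∅, fun _ => h, fun _ => hZ, fun _ x hx => hx.elim, ?_⟩
  exact fun x hx => Or.inl (mem_iUnion.2 ⟨0, hx.1⟩)

lemma negl_of_OWeight {Z : Set E} (h : OWeight k Z) : Negl k X Z := by
  refine ⟨fun _ => ∅, fun _ => Z, fun _ => IsGδ.empty, fun _ => empty_subset _, fun _ x hx =>
    ⟨univ, isOpen_univ, mem_univ _, by simpa using h⟩, ?_⟩
  exact fun x hx => Or.inr (mem_iUnion.2 ⟨0, hx.1⟩)

lemma isOpen_glue {ι : Type*} {f : E → ι} (hf : IsLocallyConstant f) {O : ι → Set E}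
    (hO : ∀ i, IsOpen (O i)) : IsOpen {x | x ∈ O (f x)} := by
  have : {x | x ∈ O (f x)} = ⋃ i, ({x | f x = i} ∩ O i) := by
    ext x; simp
  rw [this]
  exact isOpen_iUnion fun i => (hf.isOpen_fiber i).inter (hO i)

lemma isGδ_glue {ι : Type*} {f : E → ι} (hf : IsLocallyConstant f) {H : ι → Set E}
    (hH : ∀ i, IsGδ (H i)) : IsGδ {x | x ∈ H (f x)} := by
  choose O hO hOH using fun i => isGδ_iff_eq_iInter_nat.1 (hH i)
  have : {x | x ∈ H (f x)} = ⋂ n, {x | x ∈ O (f x) n} := by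
    ext x; simp only [mem_ofPred_eq, mem_iInter]; rw [hOH]; simp
  rw [this]
  exact IsGδ.iInter_of_isOpen fun n => isOpen_glue hf (O := fun i => O i n) fun i => hO i n

lemma negl_glue {ι : Type*} {f : E → ι} (hf : IsLocallyConstant f) {Z : ι → Set E}
    (hZ : ∀ i, Negl k X (Z i)) : Negl k X {x | x ∈ Z (f x)} := by
  choose H L h1 h2 h3 h4 using hZ
  refine ⟨fun n => {x | x ∈ H (f x) n}, fun n => {x | x ∈ L (f x) n},
    fun n => isGδ_glue hf (H := fun i => H i n) fun i => h1 i n, fun n x hx => h2 _ _ hx, ?_, ?_⟩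
  · intro n x hx
    obtain ⟨U, hU, hxU, hw⟩ := h3 (f x) n x hx
    refine ⟨U ∩ {y | f y = f x}, hU.inter (hf.isOpen_fiber _), ⟨hxU, rfl⟩, hw.mono ?_⟩
    rintro y ⟨⟨hy, hfy⟩, hyL⟩
    refine ⟨hy, ?_⟩
    have : y ∈ L (f y) n := hyL
    rwa [show f y = f x from hfy] at this
  · rintro x ⟨hx, hxX⟩
    rcases h4 (f x) ⟨hx, hxX⟩ with h | h
    · exact Or.inl (by simpa using h)
    · exact Or.inr (by simpa using h)

end Ideal

section Tree

variable {S : Type u} [TopologicalSpace S] [DiscreteTopology S]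

lemma isLocallyConstant_res (l : ℕ) :
    IsLocallyConstant (fun x : ℕ → S => PiNat.res x l) := by
  refine IsLocallyConstant.iff_isOpen_fiber_apply.2 fun x => ?_
  have := PiNat.isOpen_cylinder (fun _ => S) x l
  rwa [PiNat.cylinder_eq_res] at this

lemma exists_res_sub {U : Set (ℕ → S)} (hU : IsOpen U) {x : ℕ → S} (hx : x ∈ U) :
    ∃ l, ∀ y, PiNat.res y l = PiNat.res x l → y ∈ U := by
  obtain ⟨_, ⟨y, n, rfl⟩, hxy, hsub⟩ :=
    (PiNat.isTopologicalBasis_cylinders (fun _ : ℕ => S)).exists_subset_of_mem_open hx hU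
  refine ⟨n, fun w hw => hsub ?_⟩
  rw [PiNat.cylinder_eq_res] at hxy ⊢
  exact hw.trans hxy

variable {k : Cardinal.{u}} {X : Set (ℕ → S)}

/-- Every nonempty relatively open piece of `D` is not small. -/
def Kern (k : Cardinal.{u}) (X D : Set (ℕ → S)) : Prop :=
  ∀ U : Set (ℕ → S), IsOpen U → (U ∩ D).Nonempty → ¬ Negl k X (U ∩ D)

lemma kernel_claim (Xn : ℕ → Set (ℕ → S)) (hXn : X = ⋂ n, Xn n)
    {C : Set (ℕ → S)} (hC : IsClosed C) (hCs : ¬ Negl k X C) :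
    ∃ n, ∃ D ⊆ C, IsClosed D ∧ D.Nonempty ∧ Kern k X D ∧
      ∀ U : Set (ℕ → S), IsOpen U → (U ∩ D).Nonempty → (U ∩ D ∩ (Xn n)ᶜ).Nonempty := by
  by_contra hcon
  have key : ∀ n, ∃ B : Set (ℕ → S), IsGδ Bᶜ ∧ Negl k X B ∧ C \ B ⊆ Xn n := by
    intro n
    set P : Set (ℕ → S) → Prop := fun K =>
      ∃ B : Set (ℕ → S), IsGδ Bᶜ ∧ Negl k X B ∧ (C ∩ K) \ B ⊆ Xn n with hP
    set Kst : Set (ℕ → S) := ⋃₀ {K | IsOpen K ∧ P K} with hK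
    have hKo : IsOpen Kst := isOpen_sUnion fun K hK => hK.1
    have hsmall0 : Negl k X (∅ : Set (ℕ → S)) := negl_of_isGδ IsGδ.empty (empty_subset _)
    have hPK : P Kst := by
      have h1 : ∀ l (t : List S), ∃ B : Set (ℕ → S), IsGδ Bᶜ ∧ Negl k X B ∧
          (P {y | PiNat.res y l = t} → (C ∩ {y | PiNat.res y l = t}) \ B ⊆ Xn n) := by
        intro l t
        by_cases h : P {y | PiNat.res y l = t}
        · obtain ⟨B, hB⟩ := h
          exact ⟨B, hB.1, hB.2.1, fun _ => hB.2.2⟩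
        · exact ⟨∅, by simp, hsmall0, fun h' => (h h').elim⟩
      choose B hB1 hB2 hB3 using h1
      refine ⟨⋃ l, {x | x ∈ B l (PiNat.res x l)}, ?_, ?_, ?_⟩
      · rw [compl_iUnion]
        exact IsGδ.iInter fun l => isGδ_glue (isLocallyConstant_res l)
          (H := fun t => (B l t)ᶜ) fun t => hB1 l t
      · exact negl_iUnion fun l => negl_glue (isLocallyConstant_res l) fun t => hB2 l t
      · rintro x ⟨⟨hxC, hxK⟩, hxB⟩
        obtain ⟨K, ⟨hKo, B', hB'1, hB'2, hB'3⟩, hxK⟩ := hxK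
        obtain ⟨l, hl⟩ := exists_res_sub hKo hxK
        refine hB3 l (PiNat.res x l) ⟨B', hB'1, hB'2, ?_⟩ ⟨⟨hxC, rfl⟩, fun h => hxB
          (mem_iUnion.2 ⟨l, h⟩)⟩
        exact fun y hy => hB'3 ⟨⟨hy.1.1, hl y hy.1.2⟩, hy.2⟩
    obtain ⟨B, hB1, hB2, hB3⟩ := hPK
    have hD : C \ Kst = ∅ := by
      by_contra hne
      have hne := nonempty_iff_ne_empty.2 hne
      have hDc : IsClosed (C \ Kst) := hC.sdiff hKo
      have hmax : ∀ U, IsOpen U → (U ∩ (C \ Kst)).Nonempty → ¬ P (Kst ∪ U) := by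
        rintro U hU ⟨x, hxU, hxC, hxK⟩ hPU
        exact hxK ⟨Kst ∪ U, ⟨hKo.union hU, hPU⟩, Or.inr hxU⟩
      refine hcon ⟨n, C \ Kst, sdiff_subset, hDc, hne, ?_, ?_⟩
      · intro U hU hUD hsm
        refine hmax U hU hUD ⟨B ∪ (U ∩ (C \ Kst)), ?_, hB2.union hsm, ?_⟩
        · rw [compl_union, compl_inter]
          exact hB1.inter (hU.isClosed_compl.isGδ.union hDc.isOpen_compl.isGδ)
        · rintro x ⟨⟨hxC, hxK | hxU⟩, hxB⟩
          · exact hB3 ⟨⟨hxC, hxK⟩, fun h => hxB (Or.inl h)⟩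
          · by_cases hxK : x ∈ Kst
            · exact hB3 ⟨⟨hxC, hxK⟩, fun h => hxB (Or.inl h)⟩
            · exact (hxB (Or.inr ⟨hxU, hxC, hxK⟩)).elim
      · intro U hU hUD
        by_contra hemp
        refine hmax U hU hUD ⟨B, hB1, hB2, ?_⟩
        rintro x ⟨⟨hxC, hxK⟩, hxB⟩
        by_cases hxK' : x ∈ Kst
        · exact hB3 ⟨⟨hxC, hxK'⟩, hxB⟩
        · by_contra hxX
          exact hemp ⟨x, ⟨hxK.resolve_left hxK', hxC, hxK'⟩, hxX⟩
    refine ⟨B, hB1, hB2, fun x hx => hB3 ⟨⟨hx.1, ?_⟩, hx.2⟩⟩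
    by_contra hxK
    exact (hD ▸ (⟨hx.1, hxK⟩ : x ∈ C \ Kst) : x ∈ (∅ : Set (ℕ → S)))
  choose B hB1 hB2 hB3 using key
  apply hCs
  have h1 : Negl k X (C \ ⋃ n, B n) := by
    refine negl_of_isGδ ?_ ?_
    · rw [sdiff_eq, compl_iUnion]
      exact hC.isGδ.inter (IsGδ.iInter hB1)
    · rw [hXn]
      exact fun x hx => mem_iInter.2 fun n => hB3 n ⟨hx.1, fun h => hx.2 (mem_iUnion.2 ⟨n, h⟩)⟩
  refine (h1.union (negl_iUnion hB2)).mono ?_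
  rintro x ⟨hx, -⟩
  by_cases h : x ∈ ⋃ n, B n
  · exact Or.inr h
  · exact Or.inl ⟨hx, h⟩

end Tree

section Branch

variable {S : Type u} [TopologicalSpace S] [DiscreteTopology S]
  {k : Cardinal.{u}} {X : Set (ℕ → S)}

open Cardinal in
/-- If a set is not small, then the number of its initial segments is at least `k`. -/
lemma le_sum_res {A : Set (ℕ → S)} (hA : ¬ Negl k X A) :
    k ≤ Cardinal.sum (fun l : ℕ => #((fun x => PiNat.res x l) '' A)) := by
  by_contra hlt
  rw [not_le] at hlt
  apply hA
  apply negl_of_OWeight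
  refine ⟨⋃ l : ℕ, (fun t => {y | PiNat.res y l = t}) '' ((fun x => PiNat.res x l) '' A),
    ?_, ?_, ?_⟩
  · refine lt_of_le_of_lt ?_ hlt
    have h1 := Cardinal.mk_iUnion_le_sum_mk_lift.{u, 0}
      (f := fun l : ℕ => (fun t => {y : ℕ → S | PiNat.res y l = t}) ''
        ((fun x => PiNat.res x l) '' A))
    simp only [Cardinal.lift_uzero] at h1
    refine h1.trans (Cardinal.sum_le_sum _ _ fun l => Cardinal.mk_image_le)
  · intro b hb
    obtain ⟨l, t, -, rfl⟩ := mem_iUnion.1 hb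
    exact (isLocallyConstant_res l).isOpen_fiber t
  · intro x hx U hU hxU
    obtain ⟨l, hl⟩ := exists_res_sub hU hxU
    exact ⟨_, mem_iUnion.2 ⟨l, _, ⟨x, hx, rfl⟩, rfl⟩, rfl, fun y hy => hl y hy.1⟩

open Cardinal in
lemma branching (hS : (k = ℵ₀ ∧ #S = 2) ∨ (ℵ₀ < k ∧ #S = k))
    {V D : Set (ℕ → S)} (hV : IsOpen V) (hD : Kern k X D) (hVD : (V ∩ D).Nonempty) :
    ∃ (T : Type u) (g : (ℕ → S) → T), IsLocallyConstant g ∧ #S ≤ #(g '' (V ∩ D)) := by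
  rcases hS with ⟨hk, hS⟩ | ⟨hk, hS⟩
  · have hnt : (V ∩ D).Nontrivial := by
      by_contra hss
      rw [not_nontrivial_iff] at hss
      refine hD V hV hVD (negl_of_OWeight ⟨{Set.univ}, ?_, ?_, ?_⟩)
      · rw [mk_singleton, hk]; exact one_lt_aleph0
      · rintro b rfl; exact isOpen_univ
      · intro x hx U hU hxU
        refine ⟨Set.univ, rfl, mem_univ _, fun y hy => ?_⟩
        rwa [hss hy.2 hx]
    obtain ⟨x, hx, y, hy, hxy⟩ := hnt
    obtain ⟨i, hi⟩ := Function.ne_iff.1 hxy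
    refine ⟨S, fun w => w i, (IsLocallyConstant.iff_continuous _).2 (continuous_apply i), ?_⟩
    rw [hS, two_le_iff]
    exact ⟨⟨x i, x, hx, rfl⟩, ⟨y i, y, hy, rfl⟩, fun h => hi (congrArg Subtype.val h)⟩
  · rw [hS]
    by_cases hbig : ∃ l : ℕ, k ≤ #((fun x => PiNat.res x l) '' (V ∩ D))
    · obtain ⟨l, hl⟩ := hbig
      exact ⟨List S, _, isLocallyConstant_res l, hl⟩
    push Not at hbig
    have hsum := le_sum_res (hD V hV hVD)
    have hinf : ∃ l : ℕ, ℵ₀ ≤ #((fun x => PiNat.res x l) '' (V ∩ D)) := by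
      by_contra hfin
      push Not at hfin
      refine absurd hsum (not_le.2 (lt_of_le_of_lt ?_ hk))
      refine (Cardinal.sum_le_sum _ (fun _ => ℵ₀) fun l => (hfin l).le).trans ?_
      simp
    obtain ⟨l, hl⟩ := hinf
    have := Cardinal.infinite_iff.2 hl
    set t := Infinite.natEmbedding ((fun x => PiNat.res x l) '' (V ∩ D)) with ht
    set Vi : ℕ → Set (ℕ → S) := fun i => V ∩ {y | PiNat.res y l = (t i).1} with hVi
    have hViO : ∀ i, IsOpen (Vi i) := fun i => hV.inter ((isLocallyConstant_res l).isOpen_fiber _)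
    have hViD : ∀ i, (Vi i ∩ D).Nonempty := by
      intro i
      obtain ⟨x, hx, hxt⟩ := (t i).2
      exact ⟨x, ⟨hx.1, hxt⟩, hx.2⟩
    have hm : ∀ i : ℕ, ∃ m : ℕ, #((fun x => PiNat.res x i) '' (V ∩ D)) ≤
        #((fun x => PiNat.res x m) '' (Vi i ∩ D)) := by
      intro i
      by_contra hcon
      push Not at hcon
      have h1 := le_sum_res (hD (Vi i) (hViO i) (hViD i))
      refine absurd h1 (not_le.2 (lt_of_le_of_lt
        (Cardinal.sum_le_sum _ (fun _ => #((fun x => PiNat.res x i) '' (V ∩ D)))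
          fun m => (hcon m).le) ?_))
      simp only [Cardinal.sum_const, Cardinal.mk_nat, Cardinal.lift_aleph0, Cardinal.lift_uzero]
      exact Cardinal.mul_lt_of_lt hk.le hk (hbig i)
    choose m hm using hm
    set m' : List S → ℕ := fun τ => m (Function.invFun (fun i => (t i).1) τ) with hm'
    have htinj : Function.Injective (fun i => (t i).1) := Subtype.val_injective.comp t.injective
    have hm't : ∀ i, m' (t i).1 = m i := fun i => by
      simp only [hm']
      congr 1
      exact Function.leftInverse_invFun htinj i
    refine ⟨List S × List S, fun x => (PiNat.res x l, PiNat.res x (m' (PiNat.res x l))), ?_, ?_⟩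
    · rw [IsLocallyConstant.iff_eventually_eq]
      intro x
      filter_upwards [(isLocallyConstant_res l).eventually_eq x,
        (isLocallyConstant_res (m' (PiNat.res x l))).eventually_eq x] with y h1 h2
      rw [h1, h2]
    · refine hsum.trans ((Cardinal.sum_le_sum _ _ hm).trans ?_)
      rw [← Cardinal.mk_sigma]
      refine Cardinal.mk_le_of_injective (f := fun p => ⟨((t p.1).1, p.2.1), ?_⟩) ?_
      · obtain ⟨x, hx, hxp⟩ := p.2.2
        refine ⟨x, ⟨hx.1.1, hx.2⟩, ?_⟩
        have h1 : PiNat.res x l = (t p.1).1 := hx.1.2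
        simp only [h1, hm't]
        exact Prod.ext rfl hxp
      · rintro ⟨i, a⟩ ⟨j, b⟩ h
        simp only [Subtype.mk.injEq, Prod.mk.injEq] at h
        obtain rfl : i = j := htinj h.1
        rw [Subtype.ext h.2]

end Branch

section Scheme

set_option linter.unusedSectionVars false
set_option linter.unusedVariables false

variable {S : Type u} [TopologicalSpace S] [DiscreteTopology S]
  {k : Cardinal.{u}} {X : Set (ℕ → S)} {F : ℕ → ℕ → Set (ℕ → S)}

/-- A state of the construction. -/
structure SchState (S : Type u) where
  V : Set (ℕ → S)
  D : ℕ → Set (ℕ → S)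
  N : ℕ → ℕ

/-- Validity of a state at stage `p`. -/
structure SchValid (k : Cardinal.{u}) (X : Set (ℕ → S)) (F : ℕ → ℕ → Set (ℕ → S))
    (p : ℕ) (st : SchState S) : Prop where
  clopen : IsClopen st.V
  closed : ∀ i ≤ p, IsClosed (st.D i)
  kern : ∀ i ≤ p, Kern k X (st.D i)
  dense : ∀ i ≤ p, ∀ U : Set (ℕ → S), IsOpen U → (U ∩ st.D i).Nonempty →
    (U ∩ st.D i ∩ (⋃ m, F (st.N i) m)ᶜ).Nonempty
  sub : ∀ i < p, st.D (i + 1) ⊆ st.D i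
  subF : ∀ i < p, ∃ m, st.D (i + 1) ⊆ F i m
  ne : (st.V ∩ st.D p).Nonempty

lemma SchValid.anti {p : ℕ} {st : SchState S} (h : SchValid k X F p st) {i j : ℕ} (hij : i ≤ j)
    (hj : j ≤ p) : st.D j ⊆ st.D i := by
  induction j, hij using Nat.le_induction with
  | base => exact subset_rfl
  | succ j hij ih => exact (h.sub j (by omega)).trans (ih (by omega))

lemma SchValid.restrict {p : ℕ} {st : SchState S} (h : SchValid k X F p st) {i : ℕ} (hi : i ≤ p)
    {V : Set (ℕ → S)} (hV : IsClopen V) (hne : (V ∩ st.D i).Nonempty) :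
    SchValid k X F i ⟨V, st.D, st.N⟩ where
  clopen := hV
  closed j hj := h.closed j (hj.trans hi)
  kern j hj := h.kern j (hj.trans hi)
  dense j hj := h.dense j (hj.trans hi)
  sub j hj := h.sub j (by omega)
  subF j hj := h.subF j (by omega)
  ne := hne

lemma SchValid.extend (hF : ∀ n m, IsClosed (F n m)) (hX : X = ⋂ n, ⋃ m, F n m)
    {i : ℕ} {st : SchState S} (h : SchValid k X F i st) :
    ∃ st' : SchState S, SchValid k X F (i + 1) st' ∧ st'.V = st.V ∧
      ∀ j ≤ i, st'.D j = st.D j ∧ st'.N j = st.N j := by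
  have h1 : ¬ Negl k X (st.V ∩ st.D i) := h.kern i le_rfl _ h.clopen.isOpen h.ne
  have h2 : ∃ m, ¬ Negl k X (F i m ∩ (st.V ∩ st.D i)) := by
    by_contra hcon
    push Not at hcon
    refine h1 ((negl_iUnion hcon).mono ?_)
    rintro x ⟨hx, hxX⟩
    rw [hX] at hxX
    obtain ⟨m, hm⟩ := mem_iUnion.1 (mem_iInter.1 hxX i)
    exact mem_iUnion.2 ⟨m, hm, hx⟩
  obtain ⟨m, hm⟩ := h2
  obtain ⟨n, D, hDsub, hDc, hDne, hDk, hDd⟩ := kernel_claim (fun n => ⋃ m, F n m) hX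
    ((hF i m).inter (h.clopen.isClosed.inter (h.closed i le_rfl))) hm
  have e1 : ∀ j ≤ i, Function.update st.D (i + 1) D j = st.D j := fun j hj =>
    Function.update_of_ne (by omega) _ _
  have e2 : ∀ j ≤ i, Function.update st.N (i + 1) n j = st.N j := fun j hj =>
    Function.update_of_ne (by omega) _ _
  refine ⟨⟨st.V, Function.update st.D (i + 1) D, Function.update st.N (i + 1) n⟩, ?_, rfl,
    fun j hj => ⟨e1 j hj, e2 j hj⟩⟩
  constructor
  · exact h.clopen
  · intro j hj
    rcases Nat.le_succ_iff.1 hj with hj | rfl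
    · simpa only [e1 j hj] using h.closed j hj
    · simpa using hDc
  · intro j hj
    rcases Nat.le_succ_iff.1 hj with hj | rfl
    · simpa only [e1 j hj] using h.kern j hj
    · simpa using hDk
  · intro j hj
    rcases Nat.le_succ_iff.1 hj with hj | rfl
    · simpa only [e1 j hj, e2 j hj] using h.dense j hj
    · simpa only [Nat.succ_eq_add_one, Function.update_self] using hDd
  · intro j hj
    rcases Nat.lt_succ_iff_lt_or_eq.1 hj with hj | rfl
    · simp only [e1 j hj.le, e1 (j + 1) hj]
      exact h.sub j hj
    · simp only [e1 j le_rfl, Function.update_self]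
      exact fun x hx => (hDsub hx).2.2
  · intro j hj
    rcases Nat.lt_succ_iff_lt_or_eq.1 hj with hj | rfl
    · simp only [e1 (j + 1) hj]
      exact h.subF j hj
    · simp only [Function.update_self]
      exact ⟨m, fun x hx => (hDsub hx).1⟩
  · simp only [Function.update_self]
    obtain ⟨x, hx⟩ := hDne
    exact ⟨x, (hDsub hx).2.1, hx⟩

lemma SchValid.extendTo (hF : ∀ n m, IsClosed (F n m)) (hX : X = ⋂ n, ⋃ m, F n m)
    {i q : ℕ} (hiq : i ≤ q) {st : SchState S} (h : SchValid k X F i st) :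
    ∃ st' : SchState S, SchValid k X F q st' ∧ st'.V = st.V ∧
      ∀ j ≤ i, st'.D j = st.D j ∧ st'.N j = st.N j := by
  induction q, hiq using Nat.le_induction with
  | base => exact ⟨st, h, rfl, fun j hj => ⟨rfl, rfl⟩⟩
  | succ q hiq ih =>
    obtain ⟨st1, h1, hV1, hD1⟩ := ih
    obtain ⟨st2, h2, hV2, hD2⟩ := h1.extend hF hX
    exact ⟨st2, h2, hV2.trans hV1, fun j hj => ⟨(hD2 j (hj.trans hiq)).1.trans (hD1 j hj).1,
      (hD2 j (hj.trans hiq)).2.trans (hD1 j hj).2⟩⟩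

lemma SchValid.init (hF : ∀ n m, IsClosed (F n m)) (hX : X = ⋂ n, ⋃ m, F n m)
    (hneg : ¬ Negl k X univ) : ∃ st : SchState S, SchValid k X F 0 st := by
  obtain ⟨n, D, hDsub, hDc, hDne, hDk, hDd⟩ := kernel_claim (fun n => ⋃ m, F n m) hX
    isClosed_univ hneg
  refine ⟨⟨univ, fun _ => D, fun _ => n⟩, isClopen_univ, fun _ _ => hDc, fun _ _ => hDk,
    fun _ _ => hDd, fun i hi => by omega, fun i hi => by omega, by simpa using hDne⟩

/-- The row handled at stage `p`. -/
def schRow (p : ℕ) : ℕ := p.unpair.1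

lemma schRow_le (p : ℕ) : schRow p ≤ p := Nat.unpair_left_le p

open Cardinal in
lemma SchValid.step (hS : (k = ℵ₀ ∧ #S = 2) ∨ (ℵ₀ < k ∧ #S = k)) (z : S)
    (hF : ∀ n m, IsClosed (F n m)) (hX : X = ⋂ n, ⋃ m, F n m)
    {p : ℕ} {st : SchState S} (h : SchValid k X F p st) :
    ∃ f : S → SchState S, (∀ a, SchValid k X F (p + 1) (f a)) ∧ (∀ a, (f a).V ⊆ st.V) ∧
      (∀ a, ∀ x ∈ (f a).V, ∀ y ∈ (f a).V, x p = y p) ∧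
      (∀ y, ∃ U : Set (ℕ → S), IsOpen U ∧ y ∈ U ∧
        ∀ a b, (U ∩ (f a).V).Nonempty → (U ∩ (f b).V).Nonempty → a = b) ∧
      (∀ a j, j ≤ p → (a = z ∨ j ≤ schRow p) → (f a).D j = st.D j ∧ (f a).N j = st.N j) ∧
      (∀ a, a ≠ z → ∀ x ∈ (f a).V, ∀ m ≤ p, x ∉ F (st.N (schRow p)) m) := by
  obtain ⟨T, g, hg, hcard⟩ := branching hS h.clopen.isOpen (h.kern p le_rfl) h.ne
  obtain ⟨t⟩ := Cardinal.le_def _ _ |>.1 hcard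
  have key : ∀ a, ∃ s : SchState S, SchValid k X F (p + 1) s ∧ s.V ⊆ st.V ∧
      (∀ x ∈ s.V, ∀ y ∈ s.V, x p = y p) ∧ (∀ x ∈ s.V, g x = (t a).1) ∧
      (∀ j, j ≤ p → (a = z ∨ j ≤ schRow p) → s.D j = st.D j ∧ s.N j = st.N j) ∧
      (a ≠ z → ∀ x ∈ s.V, ∀ m ≤ p, x ∉ F (st.N (schRow p)) m) := by
    intro a
    obtain ⟨w, ⟨hwV, hwD⟩, hwt⟩ := (t a).2
    have hUclopen : IsClopen (st.V ∩ {x | g x = (t a).1}) := h.clopen.inter (hg.isClopen_fiber _)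
    by_cases ha : a = z
    · set V' := (st.V ∩ {x | g x = (t a).1}) ∩ {x | x p = w p} with hV'
      have hV'c : IsClopen V' := hUclopen.inter
        (((IsLocallyConstant.iff_continuous _).2 (continuous_apply p)).isClopen_fiber _)
      obtain ⟨s, hs, hsV, hsD⟩ := (h.restrict le_rfl hV'c ⟨w, ⟨⟨hwV, hwt⟩, rfl⟩, hwD⟩).extendTo
        hF hX (Nat.le_succ p)
      simp only at hsV hsD
      refine ⟨s, hs, ?_, ?_, ?_, fun j hj _ => hsD j hj, fun h => (h ha).elim⟩
      · rw [hsV]; exact fun x hx => hx.1.1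
      · rw [hsV]; exact fun x hx y hy => hx.2.trans hy.2.symm
      · rw [hsV]; exact fun x hx => hx.1.2
    · have hwD' : w ∈ st.D (schRow p) := h.anti (schRow_le p) le_rfl hwD
      obtain ⟨v, ⟨hvU, hvD⟩, hvF⟩ := h.dense (schRow p) (schRow_le p) _ hUclopen.isOpen
        ⟨w, ⟨hwV, hwt⟩, hwD'⟩
      have hO : IsOpen (⋂ m ∈ Finset.range (p + 1), (F (st.N (schRow p)) m)ᶜ) :=
        isOpen_biInter_finset fun m _ => (hF _ m).isOpen_compl
      have hvO : v ∈ ⋂ m ∈ Finset.range (p + 1), (F (st.N (schRow p)) m)ᶜ := by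
        simp only [mem_iInter]
        exact fun m _ hm => hvF (mem_iUnion.2 ⟨m, hm⟩)
      obtain ⟨l, hl⟩ := exists_res_sub hO hvO
      set V' := (st.V ∩ {x | g x = (t a).1}) ∩ {x | x p = v p} ∩
        {x | PiNat.res x l = PiNat.res v l} with hV'
      have hV'c : IsClopen V' := (hUclopen.inter
        (((IsLocallyConstant.iff_continuous _).2 (continuous_apply p)).isClopen_fiber _)).inter
          ((isLocallyConstant_res l).isClopen_fiber _)
      obtain ⟨s, hs, hsV, hsD⟩ := (h.restrict (schRow_le p) hV'c
        ⟨v, ⟨⟨hvU, rfl⟩, rfl⟩, hvD⟩).extendTo hF hX ((schRow_le p).trans (Nat.le_succ p))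
      simp only at hsV hsD
      refine ⟨s, hs, ?_, ?_, ?_, fun j hj hj' => hsD j (hj'.resolve_left ha), fun _ => ?_⟩
      · rw [hsV]; exact fun x hx => hx.1.1.1
      · rw [hsV]; exact fun x hx y hy => hx.1.2.trans hy.1.2.symm
      · rw [hsV]; exact fun x hx => hx.1.1.2
      · rw [hsV]
        intro x hx m hm
        have := hl x hx.2
        simp only [mem_iInter] at this
        exact this m (Finset.mem_range.2 (by omega))
  choose f h1 h2 h3 h4 h5 h6 using key
  refine ⟨f, h1, h2, h3, fun y => ⟨{x | g x = g y}, hg.isOpen_fiber _, rfl, ?_⟩, h5, h6⟩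
  rintro a b ⟨x, hx, hxa⟩ ⟨x', hx', hxb⟩
  apply t.injective
  apply Subtype.ext
  rw [← h4 a x hxa, ← h4 b x' hxb]
  exact (show g x = g y from hx).trans (show g x' = g y from hx').symm

open Cardinal in
/-- The main construction. -/
theorem exists_scheme (hS : (k = ℵ₀ ∧ #S = 2) ∨ (ℵ₀ < k ∧ #S = k)) (z : S)
    (hF : ∀ n m, IsClosed (F n m)) (hX : X = ⋂ n, ⋃ m, F n m) (hneg : ¬ Negl k X univ) :
    ∃ φ : (ℕ → S) → (ℕ → S), IsClosedEmbedding φ ∧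
      ∀ x, φ x ∈ X ↔ ∀ i, ∀ᶠ j in atTop, x (Nat.pair i j) = z := by
  obtain ⟨st0, hst0⟩ := SchValid.init (k := k) hF hX hneg
  have hstep := fun (p : ℕ) (st : SchState S) (h : SchValid k X F p st) =>
    SchValid.step hS z hF hX h
  choose f f1 f2 f3 f4 f5 f6 using hstep
  -- the states along a branch
  let st : (ℕ → S) → (p : ℕ) → {s : SchState S // SchValid k X F p s} := fun x p =>
    Nat.rec (motive := fun p => {s : SchState S // SchValid k X F p s}) ⟨st0, hst0⟩
      (fun p s => ⟨f p s.1 s.2 (x p), f1 p s.1 s.2 (x p)⟩) p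
  have st_succ : ∀ x p, (st x (p + 1)).1 = f p (st x p).1 (st x p).2 (x p) := fun x p => rfl
  have st_congr : ∀ x y p, (∀ i < p, x i = y i) → st x p = st y p := by
    intro x y p
    induction p with
    | zero => intro _; rfl
    | succ p ih =>
      intro h
      apply Subtype.ext
      rw [st_succ, st_succ, ih (fun i hi => h i (by omega)), h p (by omega)]
  have Vanti : ∀ x p q, p ≤ q → (st x q).1.V ⊆ (st x p).1.V := by
    intro x p q hpq
    induction q, hpq using Nat.le_induction with
    | base => exact subset_rfl
    | succ q hpq ih => rw [st_succ]; exact (f2 _ _ _ _).trans ih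
  have Vne : ∀ x p, (st x p).1.V.Nonempty := fun x p => (st x p).2.ne.mono inter_subset_left
  have Vcoord : ∀ x p, ∀ u ∈ (st x (p + 1)).1.V, ∀ v ∈ (st x (p + 1)).1.V, u p = v p := by
    intro x p
    rw [st_succ]
    exact f3 _ _ _ _
  choose c hc using Vne
  let φ : (ℕ → S) → (ℕ → S) := fun x p => c x (p + 1) p
  have φ_coord : ∀ x p, ∀ u ∈ (st x (p + 1)).1.V, u p = φ x p := fun x p u hu =>
    Vcoord x p u hu (c x (p + 1)) (hc x (p + 1))
  have φ_uniq : ∀ x u, (∀ p, u ∈ (st x p).1.V) → u = φ x := fun x u hu =>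
    funext fun p => φ_coord x p u (hu _)
  have hlim : ∀ x, Tendsto (fun q => c x q) atTop (𝓝 (φ x)) := by
    intro x
    rw [tendsto_pi_nhds]
    intro p
    refine tendsto_const_nhds.congr' ?_
    filter_upwards [eventually_ge_atTop (p + 1)] with q hq
    exact (φ_coord x p _ (Vanti x _ _ hq (hc x q))).symm
  have φ_mem : ∀ x p, φ x ∈ (st x p).1.V := by
    intro x p
    refine (st x p).2.clopen.isClosed.mem_of_tendsto (hlim x) ?_
    filter_upwards [eventually_ge_atTop p] with q hq
    exact Vanti x _ _ hq (hc x q)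
  have φ_cont : Continuous φ := by
    refine continuous_pi fun p => ?_
    refine continuous_iff_continuousAt.2 fun x => ?_
    refine tendsto_const_nhds.congr' ?_
    filter_upwards [(PiNat.isOpen_cylinder (fun _ => S) x (p + 1)).mem_nhds
      (PiNat.self_mem_cylinder x _)] with y hy
    have h1 : st y (p + 1) = st x (p + 1) := st_congr _ _ _ hy
    have h2 := φ_mem y (p + 1)
    rw [h1] at h2
    exact (φ_coord x p _ h2).symm
  -- points near `y` of the image have close preimages
  have hsep : ∀ (x : ℕ → S) (p : ℕ) (y : ℕ → S), ∃ U : Set (ℕ → S), IsOpen U ∧ y ∈ U ∧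
      ∀ v w : ℕ → S, (∀ i < p, v i = x i) → (∀ i < p, w i = x i) → φ v ∈ U → φ w ∈ U →
        v p = w p := by
    intro x p y
    obtain ⟨U, hU, hyU, hUab⟩ := f4 p (st x p).1 (st x p).2 y
    refine ⟨U, hU, hyU, fun v w hv hw hvU hwU => hUab _ _ ⟨φ v, hvU, ?_⟩ ⟨φ w, hwU, ?_⟩⟩
    · have := φ_mem v (p + 1)
      rw [st_succ] at this
      rwa [st_congr v x p hv] at this
    · have := φ_mem w (p + 1)
      rw [st_succ] at this
      rwa [st_congr w x p hw] at this
  -- closedness: via filters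
  have hclosed : ∀ (l : Filter (ℕ → S)) [l.NeBot] (y : ℕ → S), Tendsto φ l (𝓝 y) →
      ∃ x, l ≤ 𝓝 x := by
    intro l _ y hl
    have h1 : ∀ p, ∃ x : ℕ → S, ∀ᶠ v in l, ∀ i < p, v i = x i := by
      intro p
      induction p with
      | zero => exact ⟨fun _ => z, Eventually.of_forall fun v i hi => by omega⟩
      | succ p ih =>
        obtain ⟨x, hx⟩ := ih
        obtain ⟨U, hU, hyU, hUvw⟩ := hsep x p y
        have hev := hx.and (hl (hU.mem_nhds hyU))
        obtain ⟨w, hw1, hw2⟩ := hev.exists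
        refine ⟨w, hev.mono fun v hv i hi => ?_⟩
        rcases Nat.lt_succ_iff_lt_or_eq.1 hi with hi | rfl
        · rw [hv.1 i hi, hw1 i hi]
        · exact hUvw v w hv.1 hw1 hv.2 hw2
    choose x hx using h1
    refine ⟨fun p => x (p + 1) p, ?_⟩
    change Tendsto id l _
    rw [tendsto_pi_nhds]
    intro p
    refine tendsto_const_nhds.congr' ?_
    filter_upwards [hx (p + 1)] with v hv
    exact (hv p (by omega)).symm
  have φ_inj : Function.Injective φ := by
    intro v w hvw
    have h1 : ∀ p, ∀ i < p, v i = w i := by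
      intro p
      induction p with
      | zero => intro i hi; omega
      | succ p ih =>
        intro i hi
        rcases Nat.lt_succ_iff_lt_or_eq.1 hi with hi | rfl
        · exact ih i hi
        · obtain ⟨U, hU, hyU, hUvw⟩ := hsep w i (φ v)
          exact hUvw v w ih (fun _ _ => rfl) hyU (hvw ▸ hyU)
    exact funext fun p => h1 (p + 1) p (by omega)
  have φ_closed : IsClosedMap φ := by
    intro C hC
    refine isClosed_of_closure_subset fun y hy => ?_
    have hne : (comap φ (𝓝 y) ⊓ 𝓟 C).NeBot := by
      rw [← Filter.map_neBot_iff φ, Filter.push_pull', map_principal]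
      exact mem_closure_iff_nhdsWithin_neBot.1 hy
    obtain ⟨x, hx⟩ := hclosed (comap φ (𝓝 y) ⊓ 𝓟 C) y (tendsto_comap.mono_left inf_le_left)
    have hxC : x ∈ C := hC.closure_eq ▸ mem_closure_iff_nhdsWithin_neBot.2
      (hne.mono (le_inf hx inf_le_right))
    refine ⟨x, hxC, ?_⟩
    exact tendsto_nhds_unique ((φ_cont.tendsto x).mono_left hx)
      (tendsto_comap.mono_left inf_le_left)
  refine ⟨φ, IsClosedEmbedding.of_continuous_injective_isClosedMap φ_cont φ_inj φ_closed, ?_⟩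
  -- stability of the data
  have hstab : ∀ (x : ℕ → S) (i q : ℕ), i ≤ q → (∀ p ≥ q, x p = z ∨ i ≤ schRow p) →
      ∀ p ≥ q, (st x p).1.D i = (st x q).1.D i ∧ (st x p).1.N i = (st x q).1.N i := by
    intro x i q hiq hxq p hp
    induction p, hp using Nat.le_induction with
    | base => exact ⟨rfl, rfl⟩
    | succ p hp ih =>
      have := f5 p (st x p).1 (st x p).2 (x p) i (hiq.trans hp) (hxq p hp)
      rw [st_succ]
      exact ⟨this.1.trans ih.1, this.2.trans ih.2⟩
  have hrows : ∀ (x : ℕ → S) (i : ℕ), (∀ i' < i, ∀ᶠ j in atTop, x (Nat.pair i' j) = z) →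
      ∃ q ≥ i, ∀ p ≥ q, x p = z ∨ i ≤ schRow p := by
    intro x i hi
    have h1 : ∀ i', ∃ J, i' < i → ∀ j ≥ J, x (Nat.pair i' j) = z := by
      intro i'
      by_cases h : i' < i
      · obtain ⟨J, hJ⟩ := eventually_atTop.1 (hi i' h)
        exact ⟨J, fun _ => hJ⟩
      · exact ⟨0, fun h' => (h h').elim⟩
    choose J hJ using h1
    have h2 : ∀ᶠ p in atTop, ∀ i' ∈ Finset.range i, ∀ j ∈ Finset.range (J i'),
        p ≠ Nat.pair i' j := by
      rw [Filter.eventually_all_finset]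
      intro i' _
      rw [Filter.eventually_all_finset]
      intro j _
      exact eventually_ne_atTop _
    obtain ⟨q, hq⟩ := eventually_atTop.1 (h2.and (eventually_ge_atTop i))
    refine ⟨q, (hq q le_rfl).2, fun p hp => ?_⟩
    by_contra hcon
    push Not at hcon
    have hlt : p.unpair.1 < i := hcon.2
    have hpp : Nat.pair p.unpair.1 p.unpair.2 = p := Nat.pair_unpair p
    by_cases hj : p.unpair.2 < J p.unpair.1
    · exact (hq p hp).1 _ (Finset.mem_range.2 hlt) _ (Finset.mem_range.2 hj) hpp.symm
    · have := hJ p.unpair.1 hlt p.unpair.2 (not_lt.1 hj)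
      rw [hpp] at this
      exact hcon.1 this
  intro x
  constructor
  · intro hxX
    by_contra hcon
    rw [not_forall] at hcon
    classical
    obtain ⟨i, hi, hmin⟩ : ∃ i, (¬ ∀ᶠ j in atTop, x (Nat.pair i j) = z) ∧
        ∀ i' < i, ∀ᶠ j in atTop, x (Nat.pair i' j) = z := by
      refine ⟨Nat.find hcon, Nat.find_spec hcon, fun i' hi' => ?_⟩
      by_contra h
      exact Nat.find_min hcon hi' h
    obtain ⟨q, hqi, hq⟩ := hrows x i hmin
    have hN := hstab x i q hqi hq
    rw [hX] at hxX
    obtain ⟨m, hm⟩ := mem_iUnion.1 (mem_iInter.1 hxX ((st x q).1.N i))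
    rw [Filter.not_eventually] at hi
    obtain ⟨j, hjne, hjge⟩ := (hi.and_eventually (eventually_ge_atTop (max q m))).exists
    have hjp : j ≤ Nat.pair i j := Nat.right_le_pair i j
    have hrow : schRow (Nat.pair i j) = i := by simp [schRow]
    have hpq : q ≤ Nat.pair i j := (le_max_left _ _).trans (hjge.trans hjp)
    have h6 := f6 (Nat.pair i j) (st x (Nat.pair i j)).1 (st x (Nat.pair i j)).2
      (x (Nat.pair i j)) hjne (φ x) (by rw [← st_succ]; exact φ_mem x _) m
      ((le_max_right _ _).trans (hjge.trans hjp))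
    rw [hrow, (hN _ hpq).2] at h6
    exact h6 hm
  · intro hx
    rw [hX]
    refine mem_iInter.2 fun n => ?_
    obtain ⟨q, hqi, hq⟩ := hrows x (n + 1) (fun i' _ => hx i')
    have hD := hstab x (n + 1) q hqi hq
    obtain ⟨m, hm⟩ := (st x q).2.subF n (by omega)
    refine mem_iUnion.2 ⟨m, hm ?_⟩
    have hcl := (st x q).2.closed (n + 1) hqi
    have hw : ∀ p, ∃ w, p ≥ q → w ∈ (st x p).1.V ∧ w ∈ (st x q).1.D (n + 1) := by
      intro p
      by_cases hp : p ≥ q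
      · obtain ⟨w, hwV, hwD⟩ := (st x p).2.ne
        refine ⟨w, fun _ => ⟨hwV, ?_⟩⟩
        rw [← (hD p hp).1]
        exact (st x p).2.anti (hqi.trans hp) le_rfl hwD
      · exact ⟨φ x, fun h => (hp h).elim⟩
    choose w hw using hw
    refine hcl.mem_of_tendsto (f := w) (b := atTop) ?_ ?_
    · rw [tendsto_pi_nhds]
      intro p
      refine tendsto_const_nhds.congr' ?_
      filter_upwards [eventually_ge_atTop (max q (p + 1))] with r hr
      exact (φ_coord x p _ (Vanti x _ _ ((le_max_right _ _).trans hr)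
        (hw r ((le_max_left _ _).trans hr)).1)).symm
    · filter_upwards [eventually_ge_atTop q] with r hr
      exact (hw r hr).2

end Scheme

section Abs

variable {S : Type u} [TopologicalSpace S] [DiscreteTopology S]

lemma isGδ_range_of_isGδ {H : Set (ℕ → S)} (hH : IsGδ H) {Y : Type*} [TopologicalSpace Y]
    [TopologicalSpace.MetrizableSpace Y] (f : H → Y) (hf : IsEmbedding f) : IsGδ (range f) := by
  obtain ⟨O, hO, hHO⟩ := isGδ_iff_eq_iInter_nat.1 hH
  set G : ℕ → Set Y := fun j => ⋃₀ {N | IsOpen N ∧ ∃ w : ℕ → S, ∃ l ≥ j,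
    (∀ v, PiNat.res v l = PiNat.res w l → v ∈ O j) ∧
      ∀ h : H, f h ∈ N → PiNat.res h.1 l = PiNat.res w l} with hG
  have hGo : ∀ j, IsOpen (G j) := fun j => isOpen_sUnion fun N hN => hN.1
  have : range f = closure (range f) ∩ ⋂ j, G j := by
    apply subset_antisymm
    · rintro _ ⟨h, rfl⟩
      refine ⟨subset_closure ⟨h, rfl⟩, mem_iInter.2 fun j => ?_⟩
      have hhO : h.1 ∈ O j := mem_iInter.1 (hHO.subset h.2) j
      obtain ⟨l, hl⟩ := exists_res_sub (hO j) hhO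
      have hop : IsOpen {h' : H | PiNat.res h'.1 (max l j) = PiNat.res h.1 (max l j)} :=
        ((isLocallyConstant_res (max l j)).isOpen_fiber _).preimage continuous_subtype_val
      obtain ⟨N, hN, hNeq⟩ := hf.isOpen_iff.1 hop
      refine ⟨N, ⟨hN, h.1, max l j, le_max_right _ _, fun v hv => hl v ?_, fun h' hh' => ?_⟩, ?_⟩
      · rw [PiNat.res_eq_res] at hv ⊢
        exact fun m hm => hv (lt_of_lt_of_le hm (le_max_left _ _))
      · have : h' ∈ f ⁻¹' N := hh'
        rw [hNeq] at this
        exact this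
      · have : h ∈ f ⁻¹' N := by rw [hNeq]; exact rfl
        exact this
    · rintro y ⟨hy, hyG⟩
      have hne : (comap f (𝓝 y)).NeBot := 
        comap_neBot_iff_frequently.2 (mem_closure_iff_frequently.1 hy)
      have h1 : ∀ j, ∃ w : ℕ → S, ∃ l ≥ j, (∀ v, PiNat.res v l = PiNat.res w l → v ∈ O j) ∧
          ∀ᶠ h : H in comap f (𝓝 y), PiNat.res h.1 l = PiNat.res w l := by
        intro j
        obtain ⟨N, ⟨hN, w, l, hlj, hwO, hwN⟩, hyN⟩ := mem_iInter.1 hyG j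
        refine ⟨w, l, hlj, hwO, ?_⟩
        filter_upwards [preimage_mem_comap (hN.mem_nhds hyN)] with h hh
        exact hwN h hh
      choose w l hl hw hev using h1
      set v : ℕ → S := fun p => w (p + 1) p with hv
      have htend : Tendsto (fun h : H => h.1) (comap f (𝓝 y)) (𝓝 v) := by
        rw [tendsto_pi_nhds]
        intro p
        refine tendsto_const_nhds.congr' ?_
        filter_upwards [hev (p + 1)] with h hh
        exact (PiNat.res_eq_res.1 hh (Nat.lt_of_succ_le (hl (p + 1)))).symm
      have hvH : v ∈ H := by
        rw [hHO]
        refine mem_iInter.2 fun j => hw j v ?_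
        exact ((isLocallyConstant_res (l j)).isClosed_fiber _).mem_of_tendsto htend (hev j)
      refine ⟨⟨v, hvH⟩, ?_⟩
      have h2 : Tendsto id (comap f (𝓝 y)) (𝓝 (⟨v, hvH⟩ : H)) := by
        rw [tendsto_subtype_rng]
        exact htend
      exact tendsto_nhds_unique ((hf.continuous.tendsto _).comp h2) tendsto_comap
  rw [this]
  let _ := TopologicalSpace.metrizableSpaceMetric Y
  exact isClosed_closure.isGδ.inter (IsGδ.iInter_of_isOpen hGo)

lemma slw_of_negl {k : Cardinal.{u}} {X : Set (ℕ → S)} (h : Negl k X univ) :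
    SLWplusGDS ↥X k := by
  obtain ⟨H, L, h1, h2, h3, h4⟩ := h
  refine ⟨{x | x.1 ∈ ⋃ n, L n}, {x | x.1 ∈ ⋃ n, H n}, ?_, ?_, ?_⟩
  · ext x
    simp only [mem_univ, iff_true]
    rcases h4 ⟨mem_univ _, x.2⟩ with h | h
    · exact Or.inr h
    · exact Or.inl h
  · refine ⟨fun n => {x | x.1.1 ∈ L n}, ?_, ?_⟩
    · ext x
      simpa using mem_iUnion.1 x.2
    · intro n x
      obtain ⟨U, hU, hxU, hw⟩ := h3 n x.1.1.1 x.2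
      refine ⟨{y | y.1.1.1 ∈ U}, ?_, ?_⟩
      · exact (hU.preimage (continuous_subtype_val.comp
          (continuous_subtype_val.comp continuous_subtype_val))).mem_nhds hxU
      · refine hw.weightLT (fun y => y.1.1.1.1) ?_ fun y => ⟨y.2, y.1.2⟩
        exact IsInducing.subtypeVal.comp (IsInducing.subtypeVal.comp
          (IsInducing.subtypeVal.comp IsInducing.subtypeVal))
  · refine ⟨inferInstance, ?_⟩
    intro Y _ _ f hf
    let ι : ∀ n, H n → {x : X | x.1 ∈ ⋃ n, H n} := fun n h =>
      ⟨⟨h.1, h2 n h.2⟩, mem_iUnion.2 ⟨n, h.2⟩⟩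
    have hι : ∀ n, IsEmbedding (ι n) := by
      intro n
      refine IsEmbedding.of_comp ?_ (continuous_subtype_val.comp continuous_subtype_val) ?_
      · exact Continuous.subtype_mk (Continuous.subtype_mk continuous_subtype_val _) _
      · exact IsEmbedding.subtypeVal
    refine ⟨fun n => range (f ∘ ι n), fun n => isGδ_range_of_isGδ (h1 n) _ (hf.comp (hι n)), ?_⟩
    ext y
    simp only [mem_range, mem_iUnion, Function.comp]
    constructor
    · rintro ⟨b, rfl⟩
      obtain ⟨n, hn⟩ := mem_iUnion.1 b.2
      exact ⟨n, ⟨b.1.1, hn⟩, rfl⟩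
    · rintro ⟨n, h, rfl⟩
      exact ⟨_, rfl⟩

end Abs

section Encode

/-- Positions of the separators in the run-length encoding. -/
def rlPos (x : ℕ → ℕ) (j : ℕ) : ℕ := (∑ i ∈ Finset.range (j + 1), x i) + j

lemma rlPos_succ (x : ℕ → ℕ) (j : ℕ) : rlPos x (j + 1) = rlPos x j + x (j + 1) + 1 := by
  unfold rlPos
  rw [Finset.sum_range_succ]
  omega

lemma rlPos_strictMono (x : ℕ → ℕ) : StrictMono (rlPos x) :=
  strictMono_nat_of_lt_succ fun j => by rw [rlPos_succ]; omega

lemma le_rlPos (x : ℕ → ℕ) (j : ℕ) : j ≤ rlPos x j := (rlPos_strictMono x).le_apply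

open Classical in
/-- Run-length encoding of a sequence of natural numbers. -/
noncomputable def rlEnc (x : ℕ → ℕ) (n : ℕ) : Bool := decide (∀ j ≤ n, rlPos x j ≠ n)

lemma rlEnc_eq_false (x : ℕ → ℕ) (n : ℕ) : rlEnc x n = false ↔ n ∈ range (rlPos x) := by
  simp only [rlEnc, decide_eq_false_iff_not, mem_range]
  push Not
  constructor
  · rintro ⟨j, -, h⟩; exact ⟨j, h⟩
  · rintro ⟨j, h⟩; exact ⟨j, h ▸ le_rlPos x j, h⟩

/-- Decoding. -/
noncomputable def rlDec (y : ℕ → Bool) : ℕ → ℕ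
  | 0 => Nat.nth (fun n => y n = false) 0
  | j + 1 => Nat.nth (fun n => y n = false) (j + 1) - Nat.nth (fun n => y n = false) j - 1

lemma infinite_of_ev {y : ℕ → Bool} (hy : ∀ᶠ n in atTop, y n = false) :
    {n | y n = false}.Infinite :=
  Nat.frequently_atTop_iff_infinite.1 hy.frequently

lemma rlPos_rlDec {y : ℕ → Bool} (hy : ∀ᶠ n in atTop, y n = false) (j : ℕ) :
    rlPos (rlDec y) j = Nat.nth (fun n => y n = false) j := by
  induction j with
  | zero => simp [rlPos, rlDec]
  | succ j ih =>
    rw [rlPos_succ, ih]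
    have := Nat.nth_strictMono (infinite_of_ev hy) (Nat.lt_succ_self j)
    simp only [rlDec]
    simp only [Nat.succ_eq_add_one] at this
    omega

lemma rlEnc_rlDec {y : ℕ → Bool} (hy : ∀ᶠ n in atTop, y n = false) : rlEnc (rlDec y) = y := by
  have hr : range (rlPos (rlDec y)) = {n | y n = false} := by
    rw [← Nat.range_nth_of_infinite (infinite_of_ev hy)]
    congr 1
    exact funext fun j => rlPos_rlDec hy j
  funext n
  have h1 := rlEnc_eq_false (rlDec y) n
  rw [hr] at h1
  have h2 : rlEnc (rlDec y) n = false ↔ y n = false := h1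
  cases h : y n <;> cases h' : rlEnc (rlDec y) n <;> simp_all

lemma ev_rlEnc {x : ℕ → ℕ} (hx : ∀ᶠ n in atTop, x n = 0) : ∀ᶠ n in atTop, rlEnc x n = false := by
  obtain ⟨J, hJ⟩ := eventually_atTop.1 hx
  have h1 : ∀ d, rlPos x (J + d) = rlPos x J + d := by
    intro d
    induction d with
    | zero => rfl
    | succ d ih => rw [← add_assoc, rlPos_succ, ih, hJ (J + d + 1) (by omega)]; omega
  filter_upwards [eventually_ge_atTop (rlPos x J)] with n hn
  rw [rlEnc_eq_false]
  exact ⟨J + (n - rlPos x J), by rw [h1]; omega⟩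

lemma rlDec_rlEnc {x : ℕ → ℕ} (hx : ∀ᶠ n in atTop, x n = 0) : rlDec (rlEnc x) = x := by
  have hy := ev_rlEnc hx
  have h1 : rlPos (rlDec (rlEnc x)) = rlPos x := by
    have h2 : range (rlPos (rlDec (rlEnc x))) = range (rlPos x) := by
      ext n
      rw [← rlEnc_eq_false, ← rlEnc_eq_false, rlEnc_rlDec hy]
    exact (StrictMono.range_inj (rlPos_strictMono _) (rlPos_strictMono _)).1 h2
  funext j
  cases j with
  | zero => simpa [rlPos] using congrFun h1 0
  | succ j =>
    have h3 := congrFun h1 (j + 1)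
    have h4 := congrFun h1 j
    rw [rlPos_succ, rlPos_succ] at h3
    omega

lemma ev_rlDec {y : ℕ → Bool} (hy : ∀ᶠ n in atTop, y n = false) :
    ∀ᶠ n in atTop, rlDec y n = 0 := by
  obtain ⟨N, hN⟩ := eventually_atTop.1 hy
  filter_upwards [eventually_ge_atTop (N + 1)] with n hn
  obtain ⟨j, rfl⟩ : ∃ j, n = j + 1 := ⟨n - 1, by omega⟩
  have h1 := rlPos_rlDec hy j
  have h2 := le_rlPos (rlDec y) j
  have h3 : y (rlPos (rlDec y) j + 1) = false := hN _ (by omega)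
  have h4 := rlEnc_rlDec hy
  have h5 : rlPos (rlDec y) j + 1 ∈ range (rlPos (rlDec y)) := by
    rw [← rlEnc_eq_false, h4]; exact h3
  obtain ⟨i, hi⟩ := h5
  have h6 : j < i := (rlPos_strictMono (rlDec y)).lt_iff_lt.1 (by omega)
  have h7 : rlPos (rlDec y) (j + 1) ≤ rlPos (rlDec y) i :=
    (rlPos_strictMono (rlDec y)).monotone h6
  rw [rlPos_succ] at h7
  omega

lemma continuous_rlEnc : Continuous rlEnc := by
  refine continuous_pi fun n => ?_
  have h1 : Continuous (fun (x : ℕ → ℕ) (j : Fin (n + 1)) => rlPos x j) := by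
    unfold rlPos
    fun_prop
  classical
  have h2 : (fun x => rlEnc x n) = (fun v : Fin (n + 1) → ℕ => decide (∀ j, v j ≠ n)) ∘
      (fun (x : ℕ → ℕ) (j : Fin (n + 1)) => rlPos x j) := by
    funext x
    simp only [rlEnc, Function.comp, decide_eq_decide]
    exact ⟨fun h j => h j (Nat.lt_succ_iff.1 j.2), fun h j hj => h ⟨j, Nat.lt_succ_iff.2 hj⟩⟩
  rw [h2]
  exact continuous_of_discreteTopology.comp h1

lemma nth_ev_const {y : ℕ → Bool} (hy : ∀ᶠ n in atTop, y n = false) (j : ℕ) :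
    ∀ᶠ y' in 𝓝 y, Nat.nth (fun n => y' n = false) j = Nat.nth (fun n => y n = false) j := by
  set n := Nat.nth (fun n => y n = false) j with hn
  filter_upwards [(PiNat.isOpen_cylinder (fun _ => Bool) y (n + 1)).mem_nhds
    (PiNat.self_mem_cylinder y _)] with y' hy'
  have hyn : y n = false := Nat.nth_mem_of_infinite (infinite_of_ev hy) j
  have hy'n : y' n = false := (hy' n (Nat.lt_succ_self n)).trans hyn
  have hc : Nat.count (fun m => y m = false) n = j := Nat.count_nth_of_infinite (infinite_of_ev hy) j
  have hc' : Nat.count (fun m => y' m = false) n = j := by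
    rw [← hc]
    simp only [Nat.count_eq_card_filter_range]
    congr 1
    refine Finset.filter_congr fun m hm => ?_
    rw [hy' m (Nat.lt_succ_of_lt (Finset.mem_range.1 hm))]
  have := Nat.nth_count (p := fun m => y' m = false) hy'n
  rwa [hc'] at this

/-- `Q(ω)` and the eventually zero binary sequences are homeomorphic. -/
noncomputable def rlHomeo : {x : ℕ → ℕ // ∀ᶠ n in atTop, x n = 0} ≃ₜ
    {y : ℕ → Bool // ∀ᶠ n in atTop, y n = false} where
  toFun x := ⟨rlEnc x.1, ev_rlEnc x.2⟩
  invFun y := ⟨rlDec y.1, ev_rlDec y.2⟩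
  left_inv x := Subtype.ext (rlDec_rlEnc x.2)
  right_inv y := Subtype.ext (rlEnc_rlDec y.2)
  continuous_toFun := Continuous.subtype_mk (continuous_rlEnc.comp continuous_subtype_val) _
  continuous_invFun := by
    refine Continuous.subtype_mk (continuous_pi fun j => ?_) _
    refine continuous_iff_continuousAt.2 fun y => ?_
    refine tendsto_const_nhds.congr' ?_
    cases j with
    | zero =>
      filter_upwards [continuous_subtype_val.continuousAt.eventually (nth_ev_const y.2 0)]
        with y' h0
      simp only [rlDec, h0]
    | succ j =>
      filter_upwards [continuous_subtype_val.continuousAt.eventually (nth_ev_const y.2 j),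
        continuous_subtype_val.continuousAt.eventually (nth_ev_const y.2 (j + 1))] with y' h0 h1
      simp only [rlDec, h0, h1]

end Encode

section Transfer

set_option linter.unusedSectionVars false

/-- Pointed bijections of discrete spaces induce homeomorphisms of σ-products. -/
noncomputable def sigmaProdCongr {S T : Type*} [TopologicalSpace S] [DiscreteTopology S]
    [TopologicalSpace T] [DiscreteTopology T] (e : S ≃ T) (s : S) (t : T) (h : e s = t) :
    {x : ℕ → S // ∀ᶠ n in atTop, x n = s} ≃ₜ {y : ℕ → T // ∀ᶠ n in atTop, y n = t} where
  toFun x := ⟨fun n => e (x.1 n), x.2.mono fun n hn => by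
    show e (x.1 n) = t
    rw [hn, h]⟩
  invFun y := ⟨fun n => e.symm (y.1 n), y.2.mono fun n hn => by
    show e.symm (y.1 n) = s
    rw [hn, ← h, e.symm_apply_apply]⟩
  left_inv x := Subtype.ext (by simp)
  right_inv y := Subtype.ext (by simp)
  continuous_toFun := Continuous.subtype_mk (continuous_pi fun n =>
    continuous_of_discreteTopology.comp ((continuous_apply n).comp continuous_subtype_val)) _
  continuous_invFun := Continuous.subtype_mk (continuous_pi fun n =>
    continuous_of_discreteTopology.comp ((continuous_apply n).comp continuous_subtype_val)) _

/-- The set of sequences all of whose rows are eventually `z`. -/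
def rowSet {S : Type*} (z : S) : Set (ℕ → S) :=
  {x | ∀ i, ∀ᶠ j in atTop, x (Nat.pair i j) = z}

/-- The row set is the countable power of the σ-product. -/
def rowHomeo {S : Type*} [TopologicalSpace S] (z : S) :
    rowSet z ≃ₜ (ℕ → {y : ℕ → S // ∀ᶠ n in atTop, y n = z}) where
  toFun x i := ⟨fun j => x.1 (Nat.pair i j), x.2 i⟩
  invFun y := ⟨fun p => (y p.unpair.1).1 p.unpair.2, fun i => by simpa using (y i).2⟩
  left_inv x := by ext; simp
  right_inv y := by ext; simp
  continuous_toFun := by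
    refine continuous_pi fun i => Continuous.subtype_mk (continuous_pi fun j => ?_) _
    exact (continuous_apply (Nat.pair i j)).comp continuous_subtype_val
  continuous_invFun := by
    refine Continuous.subtype_mk (continuous_pi fun p => ?_) _
    have h1 : Continuous (fun y : ℕ → {y : ℕ → S // ∀ᶠ n in atTop, y n = z} =>
        (y p.unpair.1).1) := continuous_subtype_val.comp (continuous_apply p.unpair.1)
    exact (continuous_apply p.unpair.2).comp h1

variable {S : Type*} [TopologicalSpace S]

lemma tendsto_update_atTop (x : ℕ → S) (p : ℕ → ℕ) (hp : Function.Injective p) (a : S) :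
    Tendsto (fun j => Function.update x (p j) a) atTop (𝓝 x) := by
  rw [tendsto_pi_nhds]
  intro n
  refine tendsto_const_nhds.congr' ?_
  have : ∀ᶠ j in atTop, p j ≠ n := by
    have h1 := hp.tendsto_cofinite.eventually (eventually_cofinite_ne n)
    rwa [Nat.cofinite_eq_atTop] at h1
  filter_upwards [this] with j hj
  rw [Function.update_of_ne hj.symm]

lemma rowSet_update {z : S} (x : ℕ → S) (p : ℕ) (a : S) :
    Function.update x p a ∈ rowSet z ↔ x ∈ rowSet z := by
  refine forall_congr' fun i => eventually_congr ?_
  filter_upwards [eventually_gt_atTop p] with j hj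
  rw [Function.update_of_ne]
  exact (lt_of_lt_of_le hj (Nat.right_le_pair i j)).ne'

lemma dense_rowSet (z : S) : Dense (rowSet z) := by
  intro x
  refine mem_closure_of_tendsto (f := fun N : ℕ => fun p => if p < N then x p else z)
    (b := atTop) ?_ (Eventually.of_forall fun N i => ?_)
  · rw [tendsto_pi_nhds]
    intro n
    refine tendsto_const_nhds.congr' ?_
    filter_upwards [eventually_gt_atTop n] with N hN
    simp [hN]
  · filter_upwards [eventually_ge_atTop N] with j hj
    have : ¬ Nat.pair i j < N := not_lt.2 (hj.trans (Nat.right_le_pair i j))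
    simp [this]

/-- Shift of the rows: row `0` becomes constant `z`. -/
def rowShift (z : S) (x : ℕ → S) (p : ℕ) : S :=
  if p.unpair.1 = 0 then z else x (Nat.pair (p.unpair.1 - 1) p.unpair.2)

lemma rowShift_zero (z : S) (x : ℕ → S) (j : ℕ) : rowShift z x (Nat.pair 0 j) = z := by
  simp [rowShift]

lemma rowShift_succ (z : S) (x : ℕ → S) (i j : ℕ) :
    rowShift z x (Nat.pair (i + 1) j) = x (Nat.pair i j) := by
  simp [rowShift]

lemma rowShift_mem (z : S) (x : ℕ → S) : rowShift z x ∈ rowSet z ↔ x ∈ rowSet z := by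
  constructor
  · intro h i
    simpa only [rowShift_succ] using h (i + 1)
  · intro h i
    cases i with
    | zero => simp [rowShift_zero]
    | succ i => simpa only [rowShift_succ] using h i

lemma rowShift_isClosedEmbedding [T2Space S] (z : S) : IsClosedEmbedding (rowShift z) := by
  have hc : Continuous (rowShift z) := by
    refine continuous_pi fun p => ?_
    unfold rowShift
    split_ifs
    · exact continuous_const
    · exact continuous_apply _
  let r : (ℕ → S) → (ℕ → S) := fun y p => y (Nat.pair (p.unpair.1 + 1) p.unpair.2)
  have hr : Continuous r := continuous_pi fun p => continuous_apply _
  have hl : Function.LeftInverse r (rowShift z) := by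
    intro x
    funext p
    simp only [r, rowShift_succ, Nat.pair_unpair]
  exact hl.isClosedEmbedding hr hc

lemma interior_preimage_range_eq_empty {φ : (ℕ → S) → (ℕ → S)} (hφ : Continuous φ)
    (hinj : Function.Injective φ) {z a : S} (ha : a ≠ z) {T : Set (ℕ → S)}
    (hT : ∀ x p, φ x ∈ T → φ (Function.update x p a) ∈ T) :
    interior (Subtype.val ⁻¹' (range (φ ∘ rowShift z)) : Set T) = ∅ := by
  rw [eq_empty_iff_forall_notMem]
  rintro ⟨y, hyT⟩ hy
  have hy' : (⟨y, hyT⟩ : T) ∈ (Subtype.val ⁻¹' range (φ ∘ rowShift z) : Set T) :=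
    interior_subset hy
  obtain ⟨w, rfl⟩ := (show y ∈ range (φ ∘ rowShift z) from hy')
  rw [mem_interior_iff_mem_nhds, nhds_subtype_eq_comap] at hy
  obtain ⟨U, hU, hUs⟩ := hy
  have h1 := (hφ.tendsto _).comp
    (tendsto_update_atTop (rowShift z w) (fun j => Nat.pair 0 j)
      (fun i j h => (Nat.pair_eq_pair.1 h).2) a)
  obtain ⟨j, hj⟩ := (h1.eventually hU).exists
  have h2 : φ (Function.update (rowShift z w) (Nat.pair 0 j) a) ∈ T := hT _ _ hyT
  obtain ⟨v, hv⟩ : φ (Function.update (rowShift z w) (Nat.pair 0 j) a) ∈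
      range (φ ∘ rowShift z) := hUs (show (⟨_, h2⟩ : T) ∈ Subtype.val ⁻¹' U from hj)
  have h3 := congrFun (hinj hv) (Nat.pair 0 j)
  rw [rowShift_zero, Function.update_self] at h3
  exact ha h3.symm

/-- Restriction of an embedding to a preimage. -/
noncomputable def restrictHomeo {Φ : (ℕ → S) → (ℕ → S)} (hΦ : IsEmbedding Φ)
    (W N : Set (ℕ → S)) (h : Φ '' W = N) : N ≃ₜ W :=
  ((hΦ.homeomorphImage W).trans (Homeomorph.setCongr h)).symm

end Transfer

section Main

lemma mk_QBase (k : Cardinal.{u}) (hk : Cardinal.aleph0 ≤ k) : Cardinal.mk (QBase k) = k := by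
  have h1 : Cardinal.mk (QBase k) = Cardinal.mk (DiscT k) + 1 := by
    unfold QBase
    simp
  have h2 : Cardinal.mk (DiscT k) = k := Cardinal.mk_out k
  rw [h1, h2]
  exact Cardinal.add_one_eq hk

lemma exists_star (k : Cardinal.{u}) (hk : Cardinal.aleph0 ≤ k) :
    ((k = Cardinal.aleph0 ∧ Cardinal.mk (StarT k) = 2) ∨
      (Cardinal.aleph0 < k ∧ Cardinal.mk (StarT k) = k)) ∧
    ∃ z a : StarT k, a ≠ z ∧ Nonempty ({y : ℕ → StarT k // ∀ᶠ n in atTop, y n = z} ≃ₜ Qk k) := by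
  by_cases h : k = Cardinal.aleph0
  · have hT : StarT k = ULift.{u} Bool := if_pos h
    let e : StarT k ≃ Bool := (Equiv.cast hT).trans Equiv.ulift
    refine ⟨Or.inl ⟨h, by rw [hT]; simp⟩, e.symm false, e.symm true, by simp, ?_⟩
    obtain ⟨f⟩ : Nonempty (ℕ ≃ QBase k) := by
      refine Cardinal.lift_mk_eq'.1 ?_
      rw [mk_QBase k hk, h]; simp
    classical
    let g : ℕ ≃ QBase k := f.trans (Equiv.swap (f 0) (Sum.inr PUnit.unit))
    have hg : g 0 = Sum.inr PUnit.unit := Equiv.swap_apply_left _ _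
    exact ⟨((sigmaProdCongr e (e.symm false) false (by simp)).trans rlHomeo.symm).trans
      (sigmaProdCongr g 0 (Sum.inr PUnit.unit) hg)⟩
  · have hT : StarT k = DiscT k := if_neg h
    have hc : Cardinal.mk (StarT k) = k := by rw [hT]; exact Cardinal.mk_out k
    have hlt : Cardinal.aleph0 < k := lt_of_le_of_ne hk (Ne.symm h)
    obtain ⟨e⟩ : Nonempty (StarT k ≃ QBase k) :=
      Cardinal.eq.1 (hc.trans (mk_QBase k hk).symm)
    have : Infinite (StarT k) := Cardinal.infinite_iff.2 (by rw [hc]; exact hk)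
    obtain ⟨a, ha⟩ := exists_ne (e.symm (Sum.inr PUnit.unit))
    exact ⟨Or.inr ⟨hlt, hc⟩, e.symm (Sum.inr PUnit.unit), a, ha,
      ⟨sigmaProdCongr e _ (Sum.inr PUnit.unit) (e.apply_symm_apply _)⟩⟩

lemma rowSet_isQkOmega (k : Cardinal.{u}) (z : StarT k)
    (e : {y : ℕ → StarT k // ∀ᶠ n in atTop, y n = z} ≃ₜ Qk k) :
    Nonempty (rowSet z ≃ₜ QkOmega k) :=
  ⟨(rowHomeo z).trans (Homeomorph.piCongrRight fun _ => e)⟩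

end Main

/-- The main theorem with the underlying product space written out. -/
lemma stmt_aux (k : Cardinal.{u}) (hk : Cardinal.aleph0 ≤ k)
    (X : Set (ℕ → StarT k)) (hX : IsFsigmaDelta X)
    (hnot : ¬ SLWplusGDS ↥X k) :
    ∃ M : Set (ℕ → StarT k), IsClosed M ∧
      IsClosed (Subtype.val ⁻¹' M : Set ↥X) ∧
      IsNowhereDense (Subtype.val ⁻¹' M : Set ↥X) ∧
      IsQkOmega k ↥(M ∩ X) ∧
      IsClosed (Subtype.val ⁻¹' M : Set ↥(Xᶜ)) ∧
      IsNowhereDense (Subtype.val ⁻¹' M : Set ↥(Xᶜ)) ∧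
      IsAII k ↥(M \ X) ∧
      Nonempty (↥M ≃ₜ (ℕ → StarT k)) := by
  obtain ⟨G, hG, hXG⟩ := hX
  choose F hF hGF using hG
  have hXF : X = ⋂ n, ⋃ m, F n m := by
    rw [hXG]
    exact iInter_congr hGF
  have hneg : ¬ Negl k X univ := fun h => hnot (slw_of_negl h)
  obtain ⟨hS, z, a, ha, ⟨e⟩⟩ := exists_star k hk
  obtain ⟨φ, hφ, hφX⟩ := exists_scheme hS z hF hXF hneg
  have hφX' : ∀ x, φ x ∈ X ↔ x ∈ rowSet z := hφX
  have hΦ : IsClosedEmbedding (φ ∘ rowShift z) := hφ.comp (rowShift_isClosedEmbedding z)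
  have hΦX : ∀ x, (φ ∘ rowShift z) x ∈ X ↔ x ∈ rowSet z := fun x =>
    (hφX' _).trans (rowShift_mem z x)
  obtain ⟨q⟩ := rowSet_isQkOmega k z e
  have him1 : (φ ∘ rowShift z) '' rowSet z = range (φ ∘ rowShift z) ∩ X := by
    ext y
    constructor
    · rintro ⟨x, hx, rfl⟩
      exact ⟨mem_range_self x, (hΦX x).2 hx⟩
    · rintro ⟨⟨x, rfl⟩, hx⟩
      exact ⟨x, (hΦX x).1 hx, rfl⟩
  have him2 : (φ ∘ rowShift z) '' (rowSet z)ᶜ = range (φ ∘ rowShift z) \ X := by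
    ext y
    constructor
    · rintro ⟨x, hx, rfl⟩
      exact ⟨mem_range_self x, fun h => hx ((hΦX x).1 h)⟩
    · rintro ⟨⟨x, rfl⟩, hx⟩
      exact ⟨x, fun h => hx ((hΦX x).2 h), rfl⟩
  have hcl1 : IsClosed (Subtype.val ⁻¹' range (φ ∘ rowShift z) : Set ↥X) :=
    hΦ.isClosed_range.preimage continuous_subtype_val
  have hcl2 : IsClosed (Subtype.val ⁻¹' range (φ ∘ rowShift z) : Set ↥(Xᶜ)) :=
    hΦ.isClosed_range.preimage continuous_subtype_val
  refine ⟨range (φ ∘ rowShift z), hΦ.isClosed_range, hcl1, ?_,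
    ⟨(restrictHomeo hΦ.isEmbedding _ _ him1).trans q⟩, hcl2, ?_,
    ⟨rowSet z, dense_rowSet z, ⟨q⟩, ⟨restrictHomeo hΦ.isEmbedding _ _ him2⟩⟩,
    ⟨hΦ.isEmbedding.toHomeomorph.symm⟩⟩
  · rw [hcl1.isNowhereDense_iff]
    refine interior_preimage_range_eq_empty hφ.continuous hφ.injective ha fun x p hx => ?_
    exact (hφX' _).2 ((rowSet_update x p a).2 ((hφX' _).1 hx))
  · rw [hcl2.isNowhereDense_iff]
    refine interior_preimage_range_eq_empty hφ.continuous hφ.injective ha fun x p hx => ?_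
    exact fun h => hx ((hφX' _).2 ((rowSet_update x p a).1 ((hφX' _).1 h)))

/-- Theorem `t-vqx`: splitting off a closed copy `M` of `B*(k)` whose
trace on `X` is a nowhere dense closed copy of `Q(k)^ω` and whose trace on the
complement is a nowhere dense closed copy of `A^{II}_k`. -/
theorem stmt_13 (k : Cardinal.{u}) (hk : Cardinal.aleph0 ≤ k)
    (X : Set (BaireStar k)) (hX : IsFsigmaDelta X)
    (hnot : ¬ SLWplusGDS ↥X k) :
    ∃ M : Set (BaireStar k), IsClosed M ∧
      IsClosed (Subtype.val ⁻¹' M : Set ↥X) ∧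
      IsNowhereDense (Subtype.val ⁻¹' M : Set ↥X) ∧
      IsQkOmega k ↥(M ∩ X) ∧
      IsClosed (Subtype.val ⁻¹' M : Set ↥(Xᶜ)) ∧
      IsNowhereDense (Subtype.val ⁻¹' M : Set ↥(Xᶜ)) ∧
      IsAII k ↥(M \ X) ∧
      Nonempty (↥M ≃ₜ BaireStar k) := by
  exact stmt_aux k hk X hX hnot
end
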